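/- Let n ≥ 2, let Ω ⊂ ℝⁿ be a bounded domain, and let f : Ω × ℝⁿ → ℝ be a Carathéodory function, convex in the second variable for a.e. x, satisfying for some 1 ≤ L < ∞, μ ≥ 0 and a nonnegative function g ∈ L^{p/(p−1)}(Ω): |z|^p − g(x)^{p/(p−1)} ≤ f(x,z) ≤ L|z|^q + g(x)^{p/(p−1)} and f(x,2z) ≤ μ + L·f(x,z) for all z and a.e. x. Assume 1 ≤ p < q < ∞ with ε := min{1/q + 1/(n−1), 1} − 1/p ≥ 0, that p < n, and that g^{1/(p−1)} ∈ L^{n,1}(Ω). Then every quasi-minimizer u ∈ W^{1,1}_loc(Ω) of F[u,A] = ∫_A f(x,∇u(x)) dx belongs to L^∞_loc(Ω). -/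

import Mathlib

open MeasureTheory Metric Set
open scoped ENNReal NNReal Topology

noncomputable section

/-- `du` is the weak gradient of `u` on the open set `Ω ⊆ ℝⁿ`, in the sense of
integration by parts against smooth compactly supported test functions. -/
def IsWeakGradOn (n : ℕ) (Ω : Set (EuclideanSpace ℝ (Fin n)))
    (u : EuclideanSpace ℝ (Fin n) → ℝ)
    (du : EuclideanSpace ℝ (Fin n) → EuclideanSpace ℝ (Fin n)) : Prop :=
  ∀ φ : EuclideanSpace ℝ (Fin n) → ℝ,
    ContDiff ℝ (⊤ : ℕ∞) φ → HasCompactSupport φ → tsupport φ ⊆ Ω →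
    ∀ i : Fin n,
      (∫ x in Ω, u x * (fderiv ℝ φ x (EuclideanSpace.single i (1 : ℝ))))
        = - ∫ x in Ω, du x i * φ x

/-- `u ∈ W^{1,1}_loc(Ω)` (with weak gradient `du`) is a `Q`-minimizer of the functional
`F[v,A] = ∫_A f(x, ∇v(x)) dx`: for every `φ ∈ W^{1,1}(Ω)` (with weak gradient `dφ`)
whose support is compactly contained in `Ω`, `F[u, supp φ] < ∞` (encoded as
integrability of `x ↦ f x (du x)` on `supp φ`) and
`F[u, supp φ] ≤ Q · F[u + φ, supp φ]`. -/
def IsQMinimizer (n : ℕ) (Ω : Set (EuclideanSpace ℝ (Fin n)))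
    (f : EuclideanSpace ℝ (Fin n) → EuclideanSpace ℝ (Fin n) → ℝ) (Q : ℝ)
    (u : EuclideanSpace ℝ (Fin n) → ℝ)
    (du : EuclideanSpace ℝ (Fin n) → EuclideanSpace ℝ (Fin n)) : Prop :=
  IsWeakGradOn n Ω u du ∧ LocallyIntegrableOn u Ω ∧ LocallyIntegrableOn du Ω ∧
  ∀ (φ : EuclideanSpace ℝ (Fin n) → ℝ)
    (dφ : EuclideanSpace ℝ (Fin n) → EuclideanSpace ℝ (Fin n)),
    IsWeakGradOn n Ω φ dφ → IntegrableOn φ Ω → IntegrableOn dφ Ω →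
    IsCompact (tsupport φ) → tsupport φ ⊆ Ω →
    IntegrableOn (fun x => f x (du x)) (tsupport φ) ∧
    (IntegrableOn (fun x => f x (du x + dφ x)) (tsupport φ) →
      (∫ x in tsupport φ, f x (du x)) ≤ Q * ∫ x in tsupport φ, f x (du x + dφ x))

/-- The nonincreasing rearrangement `h*(t) = inf {σ > 0 : |{|h| > σ}| ≤ t}` of a
function `h : ℝⁿ → ℝ`. -/
def rearr (n : ℕ) (h : EuclideanSpace ℝ (Fin n) → ℝ) (t : ℝ) : ℝ :=
  sInf {σ : ℝ | 0 < σ ∧ volume {x | σ < |h x|} ≤ ENNReal.ofReal t}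

/-- The Lorentz `L^{n,1}(Ω)` norm `∫_0^{|Ω|} t^{1/n} (h·χ_Ω)*(t) dt/t`. -/
def lorentzN1 (n : ℕ) (Ω : Set (EuclideanSpace ℝ (Fin n)))
    (h : EuclideanSpace ℝ (Fin n) → ℝ) : ℝ≥0∞ :=
  ∫⁻ t in Ioo (0 : ℝ) (volume Ω).toReal,
    ENNReal.ofReal (t ^ (1 / (n : ℝ)) * rearr n (Ω.indicator h) t / t)

local notation "𝔼" n:max => EuclideanSpace ℝ (Fin n)

section Mollification

open Filter ContinuousLinearMap

/-- A bump function concentrated at scale `1 / (m + 1)`. -/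
def stdBump (n m : ℕ) : ContDiffBump (0 : 𝔼 n) where
  rIn := 1 / (2 * (m + 1))
  rOut := 1 / (m + 1)
  rIn_pos := by positivity
  rIn_lt_rOut := by
    apply one_div_lt_one_div_of_lt <;> [positivity; skip]
    have : (0 : ℝ) ≤ m := by positivity
    linarith

/-- The mollification of `h` at scale `1 / (m + 1)`. -/
def moll {n : ℕ} {F : Type*} [NormedAddCommGroup F] [NormedSpace ℝ F]
    (m : ℕ) (h : 𝔼 n → F) : 𝔼 n → F :=
  convolution ((stdBump n m).normed volume) h (lsmul ℝ ℝ) volume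

variable {n : ℕ} {F : Type*} [NormedAddCommGroup F] [NormedSpace ℝ F] {h : 𝔼 n → F}

lemma stdBump_rOut (n m : ℕ) : (stdBump n m).rOut = 1 / (m + 1) := rfl

lemma moll_apply (m : ℕ) (x : 𝔼 n) :
    moll m h x = ∫ t, (stdBump n m).normed volume t • h (x - t) := rfl

lemma moll_apply_swap (m : ℕ) (x : 𝔼 n) :
    moll m h x = ∫ t, (stdBump n m).normed volume (x - t) • h t := by
  rw [moll, convolution_eq_swap]; rfl

lemma ae_tendsto_moll [CompleteSpace F] (hh : LocallyIntegrable h) :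
    ∀ᵐ x, Tendsto (fun m => moll m h x) atTop (𝓝 (h x)) := by
  refine ContDiffBump.ae_convolution_tendsto_right_of_locallyIntegrable (K := 2)
    (φ := fun m => stdBump n m) ?_ ?_ hh
  · exact tendsto_one_div_add_atTop_nhds_zero_nat
  · refine Eventually.of_forall fun m => le_of_eq ?_
    simp only [stdBump]
    field_simp

lemma contDiff_moll (m : ℕ) (hh : LocallyIntegrable h) :
    ContDiff ℝ (⊤ : ℕ∞) (moll m h) := by
  exact (stdBump n m).hasCompactSupport_normed.contDiff_convolution_left _
    (stdBump n m).contDiff_normed hh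

lemma moll_eq_zero {m : ℕ} {x : 𝔼 n} (hx : ∀ y, dist y x < 1 / (m + 1) → h y = 0) :
    moll m h x = 0 := by
  rw [moll_apply_swap]
  refine integral_eq_zero_of_ae (Eventually.of_forall fun t => ?_)
  by_cases ht : dist t x < 1 / (m + 1)
  · simp [hx t ht]
  · have : x - t ∉ Function.support ((stdBump n m).normed (volume : Measure (𝔼 n))) := by
      rw [(stdBump n m).support_normed_eq, stdBump_rOut, mem_ball_zero_iff, ← dist_eq_norm,
        dist_comm]
      exact ht
    simp [Function.notMem_support.mp this]

lemma hasCompactSupport_moll (m : ℕ) (hh : HasCompactSupport h) :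
    HasCompactSupport (moll m h) :=
  HasCompactSupport.convolution _ (stdBump n m).hasCompactSupport_normed hh

lemma lintegral_moll_rpow_le (m : ℕ) (hh : AEStronglyMeasurable h) {p : ℝ} (hp : 1 ≤ p) :
    ∫⁻ x, ‖moll m h x‖ₑ ^ p ≤ ∫⁻ x, ‖h x‖ₑ ^ p := by
  set ρ : 𝔼 n → ℝ := (stdBump n m).normed volume with hρ
  have hρc : Continuous ρ := (stdBump n m).continuous_normed
  have hρm : Measurable fun t => ENNReal.ofReal (ρ t) := hρc.measurable.ennreal_ofReal
  have hρ0 : ∀ t, 0 ≤ ρ t := (stdBump n m).nonneg_normed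
  have h1 : ∫⁻ t, ENNReal.ofReal (ρ t) = 1 := by
    rw [← ofReal_integral_eq_lintegral_ofReal (stdBump n m).integrable_normed
      (Eventually.of_forall hρ0), (stdBump n m).integral_normed, ENNReal.ofReal_one]
  set ν : Measure (𝔼 n) := volume.withDensity fun t => ENNReal.ofReal (ρ t) with hν
  have : IsProbabilityMeasure ν := ⟨by rw [hν, withDensity_apply _ MeasurableSet.univ]; simpa⟩
  have hac : ν ≪ volume := withDensity_absolutelyContinuous _ _
  have hmeas : ∀ x : 𝔼 n, AEStronglyMeasurable (fun t => h (x - t)) volume := fun x =>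
    hh.comp_quasiMeasurePreserving
      (quasiMeasurePreserving_sub_left volume x)
  have key : ∀ x, ‖moll m h x‖ₑ ^ p ≤ ∫⁻ t, ENNReal.ofReal (ρ t) * ‖h (x - t)‖ₑ ^ p := by
    intro x
    have e1 : ‖moll m h x‖ₑ ≤ eLpNorm (fun t => h (x - t)) 1 ν := by
      rw [eLpNorm_one_eq_lintegral_enorm, lintegral_withDensity_eq_lintegral_mul₀ hρm.aemeasurable
        (hmeas x).enorm, moll_apply]
      refine (enorm_integral_le_lintegral_enorm _).trans (le_of_eq (lintegral_congr fun t => ?_))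
      simp only [enorm_smul, Pi.mul_apply]
      rw [Real.enorm_eq_ofReal (hρ0 t)]
    have e2 : eLpNorm (fun t => h (x - t)) 1 ν ≤ eLpNorm (fun t => h (x - t)) (ENNReal.ofReal p) ν :=
      eLpNorm_le_eLpNorm_of_exponent_le (by simpa using hp) ((hmeas x).mono_ac hac)
    have hp0 : 0 < p := by linarith
    calc ‖moll m h x‖ₑ ^ p ≤ (eLpNorm (fun t => h (x - t)) (ENNReal.ofReal p) ν) ^ p := by
          gcongr; exact e1.trans e2
      _ = ∫⁻ t, ‖h (x - t)‖ₑ ^ p ∂ν := by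
          rw [eLpNorm_eq_lintegral_rpow_enorm_toReal (by simpa using hp0) ENNReal.ofReal_ne_top,
            ENNReal.toReal_ofReal hp0.le, ← ENNReal.rpow_mul, one_div, inv_mul_cancel₀ hp0.ne',
            ENNReal.rpow_one]
      _ = _ := by
          rw [lintegral_withDensity_eq_lintegral_mul₀ hρm.aemeasurable
            ((hmeas x).enorm.pow_const _)]
          rfl
  calc ∫⁻ x, ‖moll m h x‖ₑ ^ p ≤ ∫⁻ x, ∫⁻ t, ENNReal.ofReal (ρ t) * ‖h (x - t)‖ₑ ^ p :=
        lintegral_mono key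
    _ = ∫⁻ t, ∫⁻ x, ENNReal.ofReal (ρ t) * ‖h (x - t)‖ₑ ^ p := by
        refine lintegral_lintegral_swap ?_
        refine AEMeasurable.mul ?_ ?_
        · exact (hρm.comp measurable_snd).aemeasurable
        · exact (AEStronglyMeasurable.comp_quasiMeasurePreserving hh
            (quasiMeasurePreserving_sub volume volume)).enorm.pow_const _
    _ = ∫⁻ t, ENNReal.ofReal (ρ t) * ∫⁻ x, ‖h x‖ₑ ^ p := by
        refine lintegral_congr fun t => ?_
        rw [lintegral_const_mul' _ _ ENNReal.ofReal_ne_top,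
          lintegral_sub_right_eq_self (fun x => ‖h x‖ₑ ^ p) t]
    _ = ∫⁻ x, ‖h x‖ₑ ^ p := by
        rw [lintegral_mul_const _ hρm, h1, one_mul]

lemma tendsto_lintegral_moll_sub [CompleteSpace F] (hh : Integrable h) :
    Tendsto (fun m => ∫⁻ x, ‖moll m h x - h x‖ₑ) atTop (𝓝 0) := by
  have hlim := ae_tendsto_moll hh.locallyIntegrable
  have hc : ∀ m, Continuous (moll m h) := fun m => (contDiff_moll m hh.locallyIntegrable).continuous
  have hhm := hh.aestronglyMeasurable
  set b := ∫⁻ x, ‖h x‖ₑ with hb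
  have hbt : b ≠ ⊤ := hh.2.ne
  have hmb : ∀ m, ∫⁻ x, ‖moll m h x‖ₑ ≤ b := fun m => by
    simpa using lintegral_moll_rpow_le m hhm le_rfl
  have hsub : ∀ m x, ‖moll m h x - h x‖ₑ ≤ ‖h x‖ₑ + ‖moll m h x‖ₑ := fun m x => by
    rw [add_comm]; exact enorm_sub_le
  have hsm : ∀ m, AEMeasurable (fun x => ‖moll m h x - h x‖ₑ) := fun m =>
    ((hc m).aestronglyMeasurable.sub hhm).enorm
  have hat : ∀ m, ∫⁻ x, ‖moll m h x - h x‖ₑ ≤ 2 * b := fun m =>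
    (lintegral_mono (hsub m)).trans <| by
      rw [lintegral_add_left' hhm.enorm, two_mul]; exact add_le_add le_rfl (hmb m)
  have fatou : 2 * b ≤ liminf (fun m => ∫⁻ x, (‖h x‖ₑ + ‖moll m h x‖ₑ - ‖moll m h x - h x‖ₑ))
      atTop := by
    refine le_trans ?_ (lintegral_liminf_le' fun m =>
      (hhm.enorm.add (hc m).aestronglyMeasurable.enorm).sub (hsm m))
    rw [hb, ← lintegral_const_mul'' _ hhm.enorm]
    refine lintegral_mono_ae ?_
    filter_upwards [hlim] with x hx
    have t1 : Tendsto (fun m => ‖h x‖ₑ + ‖moll m h x‖ₑ - ‖moll m h x - h x‖ₑ) atTop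
        (𝓝 (‖h x‖ₑ + ‖h x‖ₑ - ‖h x - h x‖ₑ)) := by
      refine ENNReal.Tendsto.sub (tendsto_const_nhds.add hx.enorm) (hx.sub_const _).enorm ?_
      right; simp
    rw [t1.liminf_eq]; simp [two_mul]
  rw [ENNReal.tendsto_atTop_zero]
  intro ε hε
  by_cases hb0 : b = 0
  · exact ⟨0, fun m _ => (hat m).trans (by simp [hb0])⟩
  have hlt : 2 * b - min ε (2 * b) < 2 * b := by
    apply ENNReal.sub_lt_self (by finiteness) (by simpa using hb0)
    have : 0 < min ε (2 * b) := lt_min hε (by positivity)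
    exact this.ne'
  have ev := eventually_lt_of_lt_liminf (hlt.trans_le fatou)
  obtain ⟨N, hN⟩ := eventually_atTop.1 ev
  refine ⟨N, fun m hm => ?_⟩
  have h2 := hN m hm
  have h3 : (∫⁻ x, (‖h x‖ₑ + ‖moll m h x‖ₑ - ‖moll m h x - h x‖ₑ))
      ≤ 2 * b - ∫⁻ x, ‖moll m h x - h x‖ₑ := by
    rw [lintegral_sub' (hsm m) ((hat m).trans_lt (by finiteness)).ne
      (Eventually.of_forall (hsub m)), lintegral_add_left' hhm.enorm, two_mul]
    gcongr
    exact hmb m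
  have h4 := h2.trans_le h3
  have h5 : min ε (2 * b) ≥ ∫⁻ x, ‖moll m h x - h x‖ₑ := by
    by_contra hcon
    push Not at hcon
    exact absurd h4 (not_lt.2 (tsub_le_tsub_left hcon.le _))
  exact h5.trans (min_le_left _ _)

end Mollification

section WeakGradient

open Filter ContinuousLinearMap

variable {n : ℕ}

lemma gradient_apply {η : 𝔼 n → ℝ} (x : 𝔼 n) (i : Fin n) :
    gradient η x i = fderiv ℝ η x (EuclideanSpace.single i 1) := by
  rw [← inner_gradient_left, EuclideanSpace.inner_single_right]
  simp

lemma norm_gradient {η : 𝔼 n → ℝ} (x : 𝔼 n) : ‖gradient η x‖ = ‖fderiv ℝ η x‖ := by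
  simp [gradient]

lemma fderiv_moll_apply {m : ℕ} {Ω K : Set (𝔼 n)} {u : 𝔼 n → ℝ} {du : 𝔼 n → 𝔼 n}
    (hu : IsWeakGradOn n Ω u du) (hK : MeasurableSet K) (hKΩ : K ⊆ Ω)
    (hi : IntegrableOn u K) (hdi : IntegrableOn du K) {x : 𝔼 n}
    (hx : closedBall x (1 / (m + 1)) ⊆ K) (i : Fin n) :
    fderiv ℝ (moll m (K.indicator u)) x (EuclideanSpace.single i 1)
      = moll m (K.indicator du) x i := by
  set ρ : 𝔼 n → ℝ := (stdBump n m).normed volume with hρ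
  have hρs : ContDiff ℝ (⊤ : ℕ∞) ρ := (stdBump n m).contDiff_normed
  have hρc : HasCompactSupport ρ := (stdBump n m).hasCompactSupport_normed
  have hρz : ∀ t, t ∉ closedBall (0 : 𝔼 n) (1 / (m + 1)) → ρ t = 0 := fun t ht =>
    image_eq_zero_of_notMem_tsupport (by
      rwa [(stdBump n m).tsupport_normed_eq, stdBump_rOut])
  have hρz' : ∀ t, t ∉ closedBall (0 : 𝔼 n) (1 / (m + 1)) → fderiv ℝ ρ t = 0 := fun t ht =>
    image_eq_zero_of_notMem_tsupport (fun h => ht (by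
      have := tsupport_fderiv_subset ℝ h
      rwa [(stdBump n m).tsupport_normed_eq, stdBump_rOut] at this))
  have hui : Integrable (K.indicator u) := hi.integrable_indicator hK
  have hdui : Integrable (K.indicator du) := hdi.integrable_indicator hK
  -- the derivative as an integral
  have h1 : fderiv ℝ (moll m (K.indicator u)) x (EuclideanSpace.single i 1)
      = ∫ t, fderiv ℝ ρ (x - t) (EuclideanSpace.single i 1) * K.indicator u t := by
    have := (hρc.hasFDerivAt_convolution_left (lsmul ℝ ℝ) (hρs.of_le (by simp))
      hui.locallyIntegrable x).fderiv
    rw [moll, this]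
    have hex : ConvolutionExists (fderiv ℝ ρ) (K.indicator u)
        ((lsmul ℝ ℝ : ℝ →L[ℝ] ℝ →L[ℝ] ℝ).precompL (𝔼 n)) volume :=
      HasCompactSupport.convolutionExists_left _ (hρc.fderiv ℝ)
        (hρs.continuous_fderiv (by simp)) hui.locallyIntegrable
    have h2 := (hex x).integrable
    rw [convolution, ContinuousLinearMap.integral_apply h2]
    rw [← integral_sub_left_eq_self _ volume x]
    simp [precompL_apply]
  have h2 : moll m (K.indicator du) x i = ∫ t, ρ (x - t) * K.indicator du t i := by
    rw [moll_apply_swap]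
    have hint : Integrable fun t => ρ (x - t) • K.indicator du t :=
      (HasCompactSupport.convolutionExists_left (lsmul ℝ ℝ) hρc hρs.continuous
        hdui.locallyIntegrable x).integrable_swap
    have := (EuclideanSpace.proj (𝕜 := ℝ) i : 𝔼 n →L[ℝ] ℝ).integral_comp_comm hint
    simpa using this.symm
  set ψ : 𝔼 n → ℝ := fun t => ρ (x - t) with hψ
  have hψs : ContDiff ℝ (⊤ : ℕ∞) ψ := hρs.comp (contDiff_const.sub contDiff_id)
  have hψd : ∀ t, fderiv ℝ ψ t = - fderiv ℝ ρ (x - t) := fun t => by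
    have h := ((hρs.differentiable (by simp) (x - t)).hasFDerivAt).comp t
      ((hasFDerivAt_id t).const_sub x)
    have h' : HasFDerivAt ψ (fderiv ℝ ρ (x - t) ∘L (-ContinuousLinearMap.id ℝ (𝔼 n))) t := h
    rw [h'.fderiv]
    ext; simp
  have hψt : tsupport ψ ⊆ closedBall x (1 / (m + 1)) := by
    refine closure_minimal (fun t ht => ?_) isClosed_closedBall
    by_contra hcon
    refine ht (hρz _ fun h => hcon ?_)
    rwa [mem_closedBall_zero_iff, ← dist_eq_norm, dist_comm] at h
  have hψc : HasCompactSupport ψ :=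
    HasCompactSupport.intro (isCompact_closedBall x _) fun t ht =>
      image_eq_zero_of_notMem_tsupport fun h => ht (hψt h)
  have hw := hu ψ hψs hψc (hψt.trans (hx.trans hKΩ)) i
  have mem : ∀ t, t ∉ K → x - t ∉ closedBall (0 : 𝔼 n) (1 / (m + 1)) := fun t ht h => ht (hx (by
    rwa [mem_closedBall_zero_iff, ← dist_eq_norm, dist_comm] at h))
  rw [setIntegral_eq_integral_of_forall_compl_eq_zero (fun t ht => by
      simp [hψd, hρz' _ (mem t fun h => ht (hKΩ h))]),
    setIntegral_eq_integral_of_forall_compl_eq_zero (fun t ht => by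
      simp [hψ, hρz _ (mem t fun h => ht (hKΩ h))])] at hw
  rw [h1, h2]
  rw [← neg_inj, ← integral_neg]
  convert! hw using 2
  · ext t
    by_cases ht : t ∈ K
    · simp [hψd, ht, mul_comm]
    · simp [hψd, hρz' _ (mem t ht)]
  · congr 1
    ext t
    by_cases ht : t ∈ K
    · simp [ht, mul_comm, hψ]
    · simp [hψ, hρz _ (mem t ht)]

lemma tendsto_integral_mul_of_bounded {α : Type*} [MeasurableSpace α] {μ : Measure α}
    {c : ℕ → α → ℝ} {c' : α → ℝ} {v : ℕ → α → ℝ} {v' : α → ℝ} {B : ℝ}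
    (hcm : ∀ m, AEStronglyMeasurable (c m) μ) (hcB : ∀ m x, |c m x| ≤ B)
    (hc : ∀ᵐ x ∂μ, Tendsto (fun m => c m x) atTop (𝓝 (c' x)))
    (hv : ∀ m, Integrable (v m) μ) (hv' : Integrable v' μ)
    (hlim : Tendsto (fun m => ∫⁻ x, ‖v m x - v' x‖ₑ ∂μ) atTop (𝓝 0)) :
    Tendsto (fun m => ∫ x, c m x * v m x ∂μ) atTop (𝓝 (∫ x, c' x * v' x ∂μ)) := by
  have hc'm : AEStronglyMeasurable c' μ := aestronglyMeasurable_of_tendsto_ae atTop hcm hc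
  have hc'B : ∀ᵐ x ∂μ, |c' x| ≤ B := by
    filter_upwards [hc] with x hx
    exact le_of_tendsto hx.abs (Eventually.of_forall fun m => hcB m x)
  have hB : ∀ m x, ‖c m x‖ₑ ≤ ENNReal.ofReal B := fun m x => by
    rw [← ofReal_norm]; exact ENNReal.ofReal_le_ofReal (hcB m x)
  have hB' : ∀ᵐ x ∂μ, ‖c' x‖ₑ ≤ ENNReal.ofReal B := by
    filter_upwards [hc'B] with x hx
    rw [← ofReal_norm]; exact ENNReal.ofReal_le_ofReal hx
  refine tendsto_integral_of_L1' _ (hv'.bdd_mul hc'm hc'B).aestronglyMeasurable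
    (Eventually.of_forall fun m => (hv m).bdd_mul (hcm m) (Eventually.of_forall (hcB m))) ?_
  have hdom : Tendsto (fun m => ∫⁻ x, ‖c m x - c' x‖ₑ * ‖v' x‖ₑ ∂μ) atTop (𝓝 0) := by
    have : Tendsto (fun m => ∫⁻ x, ‖c m x - c' x‖ₑ * ‖v' x‖ₑ ∂μ) atTop (𝓝 (∫⁻ x, 0 ∂μ)) := by
      refine tendsto_lintegral_of_dominated_convergence'
        (fun x => (ENNReal.ofReal B + ENNReal.ofReal B) * ‖v' x‖ₑ)
        (fun m => ((hcm m).sub hc'm).enorm.mul hv'.aestronglyMeasurable.enorm)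
        (fun m => ?_) ?_ ?_
      · filter_upwards [hB'] with x hx
        gcongr
        exact enorm_sub_le.trans (add_le_add (hB m x) hx)
      · rw [lintegral_const_mul'' _ hv'.aestronglyMeasurable.enorm]
        exact ENNReal.mul_ne_top (by finiteness) hv'.2.ne
      · filter_upwards [hc] with x hx
        have h0 : Tendsto (fun m => ‖c m x - c' x‖ₑ) atTop (𝓝 0) := by
          simpa using (hx.sub_const (c' x)).enorm
        simpa using ENNReal.Tendsto.mul_const h0 (Or.inr (by finiteness : ‖v' x‖ₑ ≠ ⊤))
    simpa using this
  have hsum := (ENNReal.Tendsto.const_mul hlim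
    (Or.inr (ENNReal.ofReal_ne_top (r := B)))).add hdom
  simp only [mul_zero, add_zero] at hsum
  simp only [eLpNorm_one_eq_lintegral_enorm]
  refine tendsto_of_tendsto_of_tendsto_of_le_of_le tendsto_const_nhds hsum
    (fun _ => zero_le) fun m => ?_
  dsimp only [Pi.sub_apply]
  rw [← lintegral_const_mul' _ _ ENNReal.ofReal_ne_top,
    ← lintegral_add_left' (show AEMeasurable (fun x => ENNReal.ofReal B * ‖v m x - v' x‖ₑ) μ from
      ((hv m).sub hv').aestronglyMeasurable.enorm.const_mul _)]
  refine lintegral_mono fun x => ?_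
  have : c m x * v m x - c' x * v' x = c m x * (v m x - v' x) + (c m x - c' x) * v' x := by ring
  rw [this]
  refine (enorm_add_le _ _).trans ?_
  rw [enorm_mul, enorm_mul]
  gcongr
  exact hB m x

lemma fderiv_eq_zero_of_notMem_tsupport {η : 𝔼 n → ℝ} {x : 𝔼 n} (hx : x ∉ tsupport η) :
    fderiv ℝ η x = 0 :=
  image_eq_zero_of_notMem_tsupport fun h => hx (tsupport_fderiv_subset ℝ h)

lemma exists_compact_nhd {K Ω : Set (𝔼 n)} (hK : IsCompact K) (hΩ : IsOpen Ω) (h : K ⊆ Ω) :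
    ∃ K', IsCompact K' ∧ K' ⊆ Ω ∧ K ⊆ K' ∧ ∀ᶠ m : ℕ in atTop, ∀ x ∈ K,
      closedBall x (1 / ((m : ℝ) + 1)) ⊆ K' := by
  obtain ⟨δ, hδ, hδΩ⟩ := hK.exists_cthickening_subset_open hΩ h
  refine ⟨cthickening δ K, hK.cthickening, hδΩ, self_subset_cthickening _, ?_⟩
  have := (tendsto_one_div_add_atTop_nhds_zero_nat (𝕜 := ℝ)).eventually (gt_mem_nhds hδ)
  filter_upwards [this] with m hm x hx
  exact (closedBall_subset_closedBall hm.le).trans (closedBall_subset_cthickening hx δ)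

lemma integral_mul_comp_fderiv {Ω : Set (𝔼 n)} (hΩ : IsOpen Ω) {u : 𝔼 n → ℝ} {du : 𝔼 n → 𝔼 n}
    (hu : IsWeakGradOn n Ω u du) (hi : LocallyIntegrableOn u Ω) (hdi : LocallyIntegrableOn du Ω)
    {η : 𝔼 n → ℝ} {C : ℝ≥0} (hη : LipschitzWith C η) (hηc : HasCompactSupport η)
    (hηΩ : tsupport η ⊆ Ω) {G : ℝ → ℝ} (hG : ContDiff ℝ 1 G) (hG0 : G 0 = 0)
    (hG1 : ∀ s, |deriv G s| ≤ 1) {ψ : 𝔼 n → ℝ} (hψ : ContDiff ℝ (⊤ : ℕ∞) ψ)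
    (hψc : HasCompactSupport ψ) (i : Fin n) :
    ∫ x, (η x * G (u x)) * fderiv ℝ ψ x (EuclideanSpace.single i 1)
      = - ∫ x, (G (u x) * fderiv ℝ η x (EuclideanSpace.single i 1)
          + η x * deriv G (u x) * du x i) * ψ x := by
  obtain ⟨K, hK, hKΩ, hηK, hball⟩ := exists_compact_nhd hηc hΩ hηΩ
  set e : 𝔼 n := EuclideanSpace.single i 1 with he
  have hKm := hK.measurableSet
  have hiK := hi.integrableOn_compact_subset hKΩ hK
  have hdiK := hdi.integrableOn_compact_subset hKΩ hK
  set U := K.indicator u with hU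
  set dU := K.indicator du with hdU
  have hUi : Integrable U := hiK.integrable_indicator hKm
  have hdUi : Integrable dU := hdiK.integrable_indicator hKm
  have hηK0 : ∀ x, x ∉ K → η x = 0 := fun x hx =>
    image_eq_zero_of_notMem_tsupport fun h => hx (hηK h)
  have hηK1 : ∀ x, x ∉ K → fderiv ℝ η x = 0 := fun x hx =>
    fderiv_eq_zero_of_notMem_tsupport fun h => hx (hηK h)
  have hGl : LipschitzWith 1 G := lipschitzWith_of_nnnorm_deriv_le (hG.differentiable (by simp))
    fun s => by simpa [← NNReal.coe_le_coe] using hG1 s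
  have hGs : ∀ a b, |G a - G b| ≤ |a - b| := fun a b => by
    simpa [Real.dist_eq] using hGl.dist_le_mul a b
  have hGd : Continuous (deriv G) := hG.continuous_deriv (by simp)
  have hηb : ∃ B, ∀ x, |η x| ≤ B := by
    obtain ⟨B, hB⟩ := hη.continuous.bounded_above_of_compact_support hηc; exact ⟨B, hB⟩
  have hψb : ∃ B, ∀ x, |ψ x| ≤ B := by
    obtain ⟨B, hB⟩ := hψ.continuous.bounded_above_of_compact_support hψc; exact ⟨B, hB⟩
  have hψdc : Continuous fun x => fderiv ℝ ψ x e :=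
    (hψ.continuous_fderiv (by simp)).clm_apply continuous_const
  have hψdb : ∃ B, ∀ x, |fderiv ℝ ψ x e| ≤ B := by
    obtain ⟨B, hB⟩ := hψdc.bounded_above_of_compact_support (hψc.fderiv_apply ℝ e); exact ⟨B, hB⟩
  obtain ⟨B₁, hB₁⟩ := hηb
  obtain ⟨B₂, hB₂⟩ := hψb
  obtain ⟨B₃, hB₃⟩ := hψdb
  have hηd : ∀ x, |fderiv ℝ η x e| ≤ C := fun x => by
    refine ((fderiv ℝ η x).le_opNorm e).trans ?_
    simpa [he] using norm_fderiv_le_of_lipschitz ℝ hη (x₀ := x)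
  have hb13 : ∀ x, |η x * fderiv ℝ ψ x e| ≤ B₁ * B₃ := fun x => by
    rw [abs_mul]
    exact mul_le_mul (hB₁ x) (hB₃ x) (abs_nonneg _) ((abs_nonneg _).trans (hB₁ x))
  have hbC2 : ∀ x, |fderiv ℝ η x e * ψ x| ≤ C * B₂ := fun x => by
    rw [abs_mul]
    exact mul_le_mul (hηd x) (hB₂ x) (abs_nonneg _) C.2
  have hb12 : ∀ s x, |η x * ψ x * deriv G s| ≤ B₁ * B₂ := fun s x => by
    have h1 := (abs_nonneg _).trans (hB₁ x)
    rw [abs_mul, abs_mul, ← mul_one (B₁ * B₂)]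
    exact mul_le_mul (mul_le_mul (hB₁ x) (hB₂ x) (abs_nonneg _) h1) (hG1 s) (abs_nonneg _)
      (mul_nonneg h1 ((abs_nonneg _).trans (hB₂ x)))
  have hηdm : AEStronglyMeasurable (fun x => fderiv ℝ η x e) volume :=
    (measurable_fderiv_apply_const ℝ η e).aestronglyMeasurable
  set V : ℕ → 𝔼 n → ℝ := fun m => moll m U with hV
  have hVs : ∀ m, ContDiff ℝ (⊤ : ℕ∞) (V m) := fun m => contDiff_moll m hUi.locallyIntegrable
  have hUc : HasCompactSupport U := HasCompactSupport.intro hK fun x hx => by simp [hU, hx]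
  have hdUc : HasCompactSupport dU := HasCompactSupport.intro hK fun x hx => by simp [hdU, hx]
  have hVi : ∀ m, Integrable (V m) := fun m =>
    (hVs m).continuous.integrable_of_hasCompactSupport (hasCompactSupport_moll m hUc)
  have hdVi : ∀ m, Integrable fun x => moll m dU x i := fun m => by
    have : Integrable (moll m dU) := 
      (contDiff_moll m hdUi.locallyIntegrable).continuous.integrable_of_hasCompactSupport
        (hasCompactSupport_moll m hdUc)
    exact (EuclideanSpace.proj (𝕜 := ℝ) i : 𝔼 n →L[ℝ] ℝ).integrable_comp this
  have hdUii : Integrable fun x => dU x i :=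
    (EuclideanSpace.proj (𝕜 := ℝ) i : 𝔼 n →L[ℝ] ℝ).integrable_comp hdUi
  have hGi : ∀ {v : 𝔼 n → ℝ}, Integrable v → Integrable fun x => G (v x) := fun hv =>
    hv.mono (hG.continuous.comp_aestronglyMeasurable hv.aestronglyMeasurable)
      (Eventually.of_forall fun x => by simpa [hG0] using hGs _ 0)
  have hL1 := tendsto_lintegral_moll_sub hUi
  have hL1d : Tendsto (fun m => ∫⁻ x, ‖moll m dU x i - dU x i‖ₑ) atTop (𝓝 0) := by
    refine tendsto_of_tendsto_of_tendsto_of_le_of_le tendsto_const_nhds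
      (tendsto_lintegral_moll_sub hdUi) (fun _ => zero_le) fun m => lintegral_mono fun x => ?_
    rw [← ofReal_norm, ← ofReal_norm]
    exact ENNReal.ofReal_le_ofReal (PiLp.norm_apply_le (moll m dU x - dU x) i)
  have hL1G : Tendsto (fun m => ∫⁻ x, ‖G (V m x) - G (U x)‖ₑ) atTop (𝓝 0) := by
    refine tendsto_of_tendsto_of_tendsto_of_le_of_le tendsto_const_nhds hL1
      (fun _ => zero_le) fun m => lintegral_mono fun x => ?_
    rw [← ofReal_norm, ← ofReal_norm]
    exact ENNReal.ofReal_le_ofReal (hGs _ _)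
  have hae := ae_tendsto_moll hUi.locallyIntegrable
  -- the identity for the mollified functions
  have hident : ∀ᶠ m in atTop, ∫ x, (η x * fderiv ℝ ψ x e) * G (V m x)
      = - (∫ x, (fderiv ℝ η x e * ψ x) * G (V m x))
        - ∫ x, (η x * ψ x * deriv G (V m x)) * moll m dU x i := by
    filter_upwards [hball] with m hm
    have hgd : ContDiff ℝ 1 fun x => G (V m x) * ψ x :=
      (hG.comp ((hVs m).of_le (by simp))).mul (hψ.of_le (by simp))
    have hgc : HasCompactSupport fun x => G (V m x) * ψ x := hψc.mul_left
    obtain ⟨D, hD⟩ := hgd.lipschitzWith_of_hasCompactSupport hgc one_ne_zero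
    have ibp := hη.integral_lineDeriv_mul_eq (μ := volume) hD hgc e
    have hl : ∫ x, lineDeriv ℝ η x e * (G (V m x) * ψ x)
        = ∫ x, (fderiv ℝ η x e * ψ x) * G (V m x) := by
      refine integral_congr_ae ?_
      filter_upwards [hη.ae_differentiableAt (μ := volume)] with x hx
      rw [hx.lineDeriv_eq_fderiv]; ring
    have hr : ∀ x, lineDeriv ℝ (fun x => G (V m x) * ψ x) x (-e) * η x
        = - ((η x * fderiv ℝ ψ x e) * G (V m x))
          - (η x * ψ x * deriv G (V m x)) * moll m dU x i := by
      intro x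
      by_cases hx : x ∈ tsupport η
      · rw [((hgd.differentiable (by simp)) x).lineDeriv_eq_fderiv]
        have hVd := ((hVs m).differentiable (by simp) x)
        have h1 : HasFDerivAt (fun x => G (V m x)) (deriv G (V m x) • fderiv ℝ (V m) x) x :=
          ((hG.differentiable (by simp) (V m x)).hasDerivAt).comp_hasFDerivAt x hVd.hasFDerivAt
        have h2 := h1.mul ((hψ.differentiable (by simp) x).hasFDerivAt)
        rw [show (fun x => G (V m x) * ψ x) = (fun x => G (V m x)) * ψ from rfl, h2.fderiv]
        have h3 := fderiv_moll_apply hu hKm hKΩ hiK hdiK (hm x hx) i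
        simp only [map_neg, add_apply, smul_apply,
          smul_eq_mul]
        rw [hV, hU, h3]
        ring
      · simp [image_eq_zero_of_notMem_tsupport hx]
    rw [hl] at ibp
    have i1 : Integrable fun x => (η x * fderiv ℝ ψ x e) * G (V m x) :=
      (hGi (hVi m)).bdd_mul (c := B₁ * B₃)
        (hη.continuous.mul hψdc).aestronglyMeasurable
        (Eventually.of_forall hb13)
    have i2 : Integrable fun x => (η x * ψ x * deriv G (V m x)) * moll m dU x i :=
      (hdVi m).bdd_mul (c := B₁ * B₂)
        ((hη.continuous.mul hψ.continuous).mul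
          (hGd.comp (hVs m).continuous)).aestronglyMeasurable
        (Eventually.of_forall fun x => hb12 _ x)
    simp_rw [hr] at ibp
    have hs := integral_sub i1.neg i2
    simp only [Pi.neg_apply, integral_neg] at hs
    rw [hs] at ibp
    linarith
  -- pass to the limit
  have t1 := tendsto_integral_mul_of_bounded (μ := volume) (c := fun _ x => η x * fderiv ℝ ψ x e)
    (c' := fun x => η x * fderiv ℝ ψ x e) (B := B₁ * B₃)
    (fun m => (hη.continuous.mul hψdc).aestronglyMeasurable)
    (fun m => hb13)
    (Eventually.of_forall fun x => tendsto_const_nhds) (fun m => hGi (hVi m)) (hGi hUi) hL1G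
  have t2 := tendsto_integral_mul_of_bounded (μ := volume) (c := fun _ x => fderiv ℝ η x e * ψ x)
    (c' := fun x => fderiv ℝ η x e * ψ x) (B := C * B₂)
    (fun m => hηdm.mul hψ.continuous.aestronglyMeasurable)
    (fun m => hbC2)
    (Eventually.of_forall fun x => tendsto_const_nhds) (fun m => hGi (hVi m)) (hGi hUi) hL1G
  have t3 := tendsto_integral_mul_of_bounded (μ := volume)
    (c := fun m x => η x * ψ x * deriv G (V m x))
    (c' := fun x => η x * ψ x * deriv G (U x)) (B := B₁ * B₂)
    (fun m => ((hη.continuous.mul hψ.continuous).mul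
          (hGd.comp (hVs m).continuous)).aestronglyMeasurable)
    (fun m x => hb12 _ x)
    (by
      filter_upwards [hae] with x hx
      exact tendsto_const_nhds.mul ((hGd.tendsto _).comp hx)) hdVi hdUii hL1d
  have hfin := tendsto_nhds_unique (t1.congr' hident) (t2.neg.sub t3)
  have j2 : Integrable fun x => (fderiv ℝ η x e * ψ x) * G (U x) :=
    (hGi hUi).bdd_mul (c := C * B₂) (hηdm.mul hψ.continuous.aestronglyMeasurable)
      (Eventually.of_forall hbC2)
  have j3 : Integrable fun x => (η x * ψ x * deriv G (U x)) * dU x i :=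
    hdUii.bdd_mul (c := B₁ * B₂)
      ((hη.continuous.mul hψ.continuous).aestronglyMeasurable.mul
        (hGd.comp_aestronglyMeasurable hUi.aestronglyMeasurable))
      (Eventually.of_forall fun x => hb12 _ x)
  have hfin2 : ∫ x, (η x * fderiv ℝ ψ x e) * G (U x)
      = - ∫ x, ((fderiv ℝ η x e * ψ x) * G (U x) + (η x * ψ x * deriv G (U x)) * dU x i) := by
    rw [integral_add j2 j3, hfin]; ring
  convert! hfin2 using 2
  · ext x
    by_cases hx : x ∈ K
    · simp only [hU, indicator_of_mem hx]; ring
    · simp [hηK0 x hx]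
  · congr 1
    ext x
    by_cases hx : x ∈ K
    · simp only [hU, hdU, indicator_of_mem hx]; ring
    · simp [hηK0 x hx, hηK1 x hx]

end WeakGradient

section Truncation

open Filter ContinuousLinearMap

variable {n : ℕ}

lemma hasDerivAt_posPart_sq (s : ℝ) : HasDerivAt (fun s : ℝ => max s 0 ^ 2) (2 * max s 0) s := by
  rcases lt_trichotomy s 0 with h | h | h
  · have : (fun s : ℝ => max s 0 ^ 2) =ᶠ[𝓝 s] fun _ => 0 := by
      filter_upwards [gt_mem_nhds h] with t ht
      simp [max_eq_right ht.le]
    rw [max_eq_right h.le, mul_zero]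
    exact (hasDerivAt_const s (0 : ℝ)).congr_of_eventuallyEq this
  · subst h
    simp only [max_self, mul_zero]
    rw [hasDerivAt_iff_isLittleO]
    have : (fun x : ℝ => max x 0 ^ 2) =O[𝓝 0] fun x : ℝ => x ^ 2 := by
      refine Asymptotics.isBigO_of_le _ fun x => ?_
      rw [norm_pow, norm_pow]
      gcongr
      rcases le_total x 0 with hx | hx <;> simp [hx]
    have h2 : (fun x : ℝ => x ^ 2) =o[𝓝 0] fun x : ℝ => x := by
      simpa using (Asymptotics.isLittleO_pow_pow (𝕜 := ℝ) (one_lt_two : 1 < 2))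
    simpa using this.trans_isLittleO h2
  · have : (fun s : ℝ => max s 0 ^ 2) =ᶠ[𝓝 s] fun t => t ^ 2 := by
      filter_upwards [lt_mem_nhds h] with t ht
      simp [max_eq_left ht.le]
    rw [max_eq_left h.le]
    simpa using (hasDerivAt_pow 2 s).congr_of_eventuallyEq this

/-- A `C¹` regularization of `max s 0`. -/
def smoothPos (ε s : ℝ) : ℝ := √(max s 0 ^ 2 + ε ^ 2) - ε

lemma hasDerivAt_smoothPos {ε : ℝ} (hε : 0 < ε) (s : ℝ) :
    HasDerivAt (smoothPos ε) (max s 0 / √(max s 0 ^ 2 + ε ^ 2)) s := by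
  have h := (((hasDerivAt_posPart_sq s).add_const (ε ^ 2)).sqrt (by positivity)).sub_const ε
  exact h.congr_deriv (mul_div_mul_left _ _ two_ne_zero)

lemma deriv_smoothPos {ε : ℝ} (hε : 0 < ε) :
    deriv (smoothPos ε) = fun s => max s 0 / √(max s 0 ^ 2 + ε ^ 2) :=
  funext fun s => (hasDerivAt_smoothPos hε s).deriv

lemma contDiff_smoothPos {ε : ℝ} (hε : 0 < ε) : ContDiff ℝ 1 (smoothPos ε) := by
  rw [contDiff_one_iff_deriv, deriv_smoothPos hε]
  refine ⟨fun s => (hasDerivAt_smoothPos hε s).differentiableAt, ?_⟩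
  have : ∀ s : ℝ, √(max s 0 ^ 2 + ε ^ 2) ≠ 0 := fun s => by positivity
  fun_prop (disch := assumption)

lemma abs_deriv_smoothPos_le {ε : ℝ} (hε : 0 < ε) (s : ℝ) : |deriv (smoothPos ε) s| ≤ 1 := by
  rw [deriv_smoothPos hε]
  simp only
  rw [abs_of_nonneg (by positivity), div_le_one (by positivity)]
  exact Real.le_sqrt_of_sq_le (by nlinarith)

lemma abs_smoothPos_le {ε : ℝ} (hε : 0 < ε) (s : ℝ) : |smoothPos ε s| ≤ |s| := by
  have h0 : ε ≤ √(max s 0 ^ 2 + ε ^ 2) := Real.le_sqrt_of_sq_le (by nlinarith [sq_nonneg (max s 0)])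
  have hm : 0 ≤ max s 0 := le_max_right _ _
  have h1 : √(max s 0 ^ 2 + ε ^ 2) ≤ max s 0 + ε :=
    Real.sqrt_le_iff.2 ⟨by positivity, by nlinarith⟩
  rw [smoothPos, abs_of_nonneg (by linarith)]
  have : max s 0 ≤ |s| := max_le (le_abs_self s) (abs_nonneg s)
  linarith

lemma tendsto_smoothPos (s : ℝ) :
    Tendsto (fun j : ℕ => smoothPos (1 / ((j : ℝ) + 1)) s) atTop (𝓝 (max s 0)) := by
  have h : Continuous fun ε : ℝ => smoothPos ε s := by unfold smoothPos; fun_prop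
  have := (h.tendsto 0).comp (tendsto_one_div_add_atTop_nhds_zero_nat (𝕜 := ℝ))
  simpa [smoothPos, Real.sqrt_sq, Function.comp_def] using this

lemma tendsto_deriv_smoothPos (s : ℝ) :
    Tendsto (fun j : ℕ => deriv (smoothPos (1 / ((j : ℝ) + 1))) s) atTop
      (𝓝 (if 0 < s then 1 else 0)) := by
  have e : ∀ j : ℕ, deriv (smoothPos (1 / ((j : ℝ) + 1))) s
      = max s 0 / √(max s 0 ^ 2 + (1 / ((j : ℝ) + 1)) ^ 2) := fun j => by
    rw [deriv_smoothPos (by positivity)]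
  simp_rw [e]
  split_ifs with hs
  · have h : ContinuousAt (fun ε : ℝ => max s 0 / √(max s 0 ^ 2 + ε ^ 2)) 0 := by
      refine ContinuousAt.div (by fun_prop) (by fun_prop) ?_
      have : 0 < max s 0 := lt_max_of_lt_left hs
      positivity
    have := h.tendsto.comp (tendsto_one_div_add_atTop_nhds_zero_nat (𝕜 := ℝ))
    simp only [max_eq_left hs.le] at this ⊢
    convert! this using 2
    simp [Real.sqrt_sq hs.le, hs.ne']
  · simp [max_eq_right (not_lt.1 hs)]

lemma IsWeakGradOn.neg {Ω : Set (𝔼 n)} {u : 𝔼 n → ℝ} {du : 𝔼 n → 𝔼 n}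
    (hu : IsWeakGradOn n Ω u du) : IsWeakGradOn n Ω (-u) (-du) := by
  intro φ h1 h2 h3 i
  have := hu φ h1 h2 h3 i
  simp only [Pi.neg_apply, neg_mul, integral_neg, PiLp.neg_apply, this]

lemma integral_fderiv_eq_zero {φ : 𝔼 n → ℝ} (h1 : ContDiff ℝ (⊤ : ℕ∞) φ)
    (h2 : HasCompactSupport φ) (e : 𝔼 n) : ∫ x, fderiv ℝ φ x e = 0 := by
  obtain ⟨D, hD⟩ := h1.lipschitzWith_of_hasCompactSupport h2 (by simp)
  have := (LipschitzWith.const (1 : ℝ) : LipschitzWith 0 fun _ : 𝔼 n => (1 : ℝ)).integral_lineDeriv_mul_eq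
    (μ := volume) hD h2 (-e)
  simp only [lineDeriv, deriv_const, zero_mul, integral_zero, mul_one, neg_neg] at this
  rw [this]
  refine integral_congr_ae (Eventually.of_forall fun x => ?_)
  exact ((h1.differentiable (by simp)) x).lineDeriv_eq_fderiv.symm

lemma IsWeakGradOn.sub_const {Ω : Set (𝔼 n)} {u : 𝔼 n → ℝ} {du : 𝔼 n → 𝔼 n}
    (hu : IsWeakGradOn n Ω u du) (hi : LocallyIntegrableOn u Ω) (k : ℝ) :
    IsWeakGradOn n Ω (fun x => u x - k) du := by
  intro φ h1 h2 h3 i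
  rw [← hu φ h1 h2 h3 i]
  set e : 𝔼 n := EuclideanSpace.single i 1
  have hc : Continuous fun x => fderiv ℝ φ x e :=
    (h1.continuous_fderiv (by simp)).clm_apply continuous_const
  have hsup : ∀ x, x ∉ tsupport φ → fderiv ℝ φ x e = 0 := fun x hx => by
    rw [fderiv_eq_zero_of_notMem_tsupport hx]; rfl
  have hint : IntegrableOn (fun x => u x * fderiv ℝ φ x e) (tsupport φ) :=
    (hi.integrableOn_compact_subset h3 h2).mul_continuousOn hc.continuousOn h2
  have hint' : IntegrableOn (fun x => k * fderiv ℝ φ x e) (tsupport φ) :=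
    (hc.const_mul k).continuousOn.integrableOn_compact h2
  have e1 : ∀ f : 𝔼 n → ℝ, ∫ x in Ω, f x * fderiv ℝ φ x e
      = ∫ x in tsupport φ, f x * fderiv ℝ φ x e := fun f => by
    rw [setIntegral_eq_integral_of_forall_compl_eq_zero (fun x hx => by
      rw [hsup x fun h => hx (h3 h), mul_zero]),
      setIntegral_eq_integral_of_forall_compl_eq_zero (fun x hx => by
      rw [hsup x hx, mul_zero])]
  rw [e1, e1]
  simp_rw [sub_mul]
  rw [integral_sub hint hint', setIntegral_eq_integral_of_forall_compl_eq_zero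
    (s := tsupport φ) (f := fun x => k * fderiv ℝ φ x e) (fun x hx => by
      rw [hsup x hx, mul_zero]), integral_const_mul, integral_fderiv_eq_zero h1 h2]
  simp

/-- The product of a Lipschitz cutoff with a truncated Sobolev function. -/
def truncFun (η u : 𝔼 n → ℝ) (k : ℝ) : 𝔼 n → ℝ := fun x => η x * max (u x - k) 0

/-- The weak gradient of `truncFun η u k`. -/
def truncGrad (η u : 𝔼 n → ℝ) (du : 𝔼 n → 𝔼 n) (k : ℝ) : 𝔼 n → 𝔼 n := fun x =>
  max (u x - k) 0 • gradient η x + (if k < u x then η x else 0) • du x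

lemma measurable_gradient (η : 𝔼 n → ℝ) : Measurable (gradient η) := by
  unfold gradient
  exact (LinearIsometryEquiv.continuous _).measurable.comp (measurable_fderiv ℝ η)

lemma norm_gradient_le {η : 𝔼 n → ℝ} {C : ℝ≥0} (hη : LipschitzWith C η) (x : 𝔼 n) :
    ‖gradient η x‖ ≤ C := by
  rw [norm_gradient]; exact norm_fderiv_le_of_lipschitz ℝ hη

lemma gradient_eq_zero_of_notMem_tsupport {η : 𝔼 n → ℝ} {x : 𝔼 n} (hx : x ∉ tsupport η) :
    gradient η x = 0 := by
  rw [← norm_eq_zero, norm_gradient, fderiv_eq_zero_of_notMem_tsupport hx, norm_zero]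

lemma integrable_truncFun {Ω : Set (𝔼 n)} {u : 𝔼 n → ℝ} (hi : LocallyIntegrableOn u Ω)
    {η : 𝔼 n → ℝ} {C : ℝ≥0} (hη : LipschitzWith C η) (hηc : HasCompactSupport η)
    (hηΩ : tsupport η ⊆ Ω) (k : ℝ) : Integrable (truncFun η u k) := by
  have h1 : IntegrableOn (fun x => max (u x - k) 0) (tsupport η) :=
    ((hi.integrableOn_compact_subset hηΩ hηc).sub
      (continuous_const.continuousOn.integrableOn_compact hηc)).pos_part
  refine (integrableOn_iff_integrable_of_support_subset (s := tsupport η) fun x hx => ?_).1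
    (h1.continuousOn_mul hη.continuous.continuousOn hηc)
  exact subset_tsupport _ (left_ne_zero_of_mul hx)

lemma integrable_truncGrad {Ω : Set (𝔼 n)} {u : 𝔼 n → ℝ} {du : 𝔼 n → 𝔼 n} (hi : LocallyIntegrableOn u Ω)
    (hdi : LocallyIntegrableOn du Ω)
    {η : 𝔼 n → ℝ} {C : ℝ≥0} (hη : LipschitzWith C η) (hηc : HasCompactSupport η)
    (hηΩ : tsupport η ⊆ Ω) (k : ℝ) : Integrable (truncGrad η u du k) := by
  obtain ⟨B, hB⟩ := hη.continuous.bounded_above_of_compact_support hηc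
  have hiK := hi.integrableOn_compact_subset hηΩ hηc
  have h1 : IntegrableOn (fun x => max (u x - k) 0) (tsupport η) :=
    (hiK.sub (continuous_const.continuousOn.integrableOn_compact hηc)).pos_part
  have h2 : IntegrableOn (fun x => max (u x - k) 0 • gradient η x) (tsupport η) :=
    Integrable.smul_bdd (𝕜 := ℝ) (β := 𝔼 n) (f := gradient η) (φ := fun x => max (u x - k) 0) h1
      (C : ℝ) (measurable_gradient η).aestronglyMeasurable
      (Eventually.of_forall fun x => norm_gradient_le hη x)
  have h3 : IntegrableOn (fun x => (if k < u x then η x else 0) • du x) (tsupport η) := by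
    refine Integrable.bdd_smul (𝕜 := ℝ) (φ := fun x => if k < u x then η x else 0)
      (hdi.integrableOn_compact_subset hηΩ hηc) B ?_ ?_
    · have hm : NullMeasurableSet {x | k < u x} (volume.restrict (tsupport η)) :=
        nullMeasurableSet_lt aemeasurable_const hiK.aestronglyMeasurable.aemeasurable
      exact (hη.continuous.aestronglyMeasurable.indicator₀ hm).congr
        (Eventually.of_forall fun x => by simp [indicator])
    · refine Eventually.of_forall fun x => ?_
      split_ifs
      · exact hB x
      · simpa using (norm_nonneg _).trans (hB x)
  refine (integrableOn_iff_integrable_of_support_subset (s := tsupport η) fun x hx => ?_).1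
    (h2.add h3)
  by_contra hcon
  exact hx (by simp [truncGrad, gradient_eq_zero_of_notMem_tsupport hcon,
    image_eq_zero_of_notMem_tsupport hcon])

lemma isWeakGradOn_trunc {Ω : Set (𝔼 n)} {u : 𝔼 n → ℝ} {du : 𝔼 n → 𝔼 n} (hi : LocallyIntegrableOn u Ω)
    (hdi : LocallyIntegrableOn du Ω)
    {η : 𝔼 n → ℝ} {C : ℝ≥0} (hη : LipschitzWith C η) (hηc : HasCompactSupport η)
    (hηΩ : tsupport η ⊆ Ω) (k : ℝ)
    (hΩ : IsOpen Ω) (hu : IsWeakGradOn n Ω u du) :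
    IsWeakGradOn n univ (truncFun η u k) (truncGrad η u du k) := by
  have hu' := hu.sub_const hi k
  have hiK := hi.integrableOn_compact_subset hηΩ hηc
  have hiK' : IntegrableOn (fun x => u x - k) (tsupport η) :=
    hiK.sub (continuous_const.continuousOn.integrableOn_compact hηc)
  have hi' : LocallyIntegrableOn (fun x => u x - k) Ω :=
    hi.sub ((locallyIntegrable_const k).locallyIntegrableOn Ω)
  intro ψ hψ hψc hψu i
  simp only [Measure.restrict_univ]
  set e : 𝔼 n := EuclideanSpace.single i 1 with he
  have hψdc : Continuous fun x => fderiv ℝ ψ x e :=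
    (hψ.continuous_fderiv (by simp)).clm_apply continuous_const
  have hdiK : IntegrableOn (fun x => du x i) (tsupport η) :=
    (EuclideanSpace.proj (𝕜 := ℝ) i : 𝔼 n →L[ℝ] ℝ).integrable_comp
      (hdi.integrableOn_compact_subset hηΩ hηc)
  have hηd : ∀ x, |fderiv ℝ η x e| ≤ C := fun x => by
    refine ((fderiv ℝ η x).le_opNorm e).trans ?_
    simpa [he] using norm_fderiv_le_of_lipschitz ℝ hη (x₀ := x)
  have hηdm : Measurable (fun x => fderiv ℝ η x e) := measurable_fderiv_apply_const ℝ η e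
  set ε : ℕ → ℝ := fun j => 1 / ((j : ℝ) + 1) with hεdef
  have hε : ∀ j, 0 < ε j := fun j => Nat.one_div_pos_of_nat
  have hG0 : ∀ j, smoothPos (ε j) 0 = 0 := fun j => by
    simp [smoothPos, Real.sqrt_sq (hε j).le]
  have hid := fun j : ℕ => integral_mul_comp_fderiv hΩ hu' hi' hdi hη hηc hηΩ
    (contDiff_smoothPos (hε j)) (hG0 j) (abs_deriv_smoothPos_le (hε j)) hψ hψc i
  have r1 : ∀ f : 𝔼 n → ℝ, ∫ x, (η x * f x) * fderiv ℝ ψ x e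
      = ∫ x in tsupport η, (η x * f x) * fderiv ℝ ψ x e := fun f =>
    (setIntegral_eq_integral_of_forall_compl_eq_zero fun x hx => by
      simp [image_eq_zero_of_notMem_tsupport hx]).symm
  have r2 : ∀ f f' : 𝔼 n → ℝ, ∫ x, (f x * fderiv ℝ η x e + η x * f' x * du x i) * ψ x
      = ∫ x in tsupport η, (f x * fderiv ℝ η x e + η x * f' x * du x i) * ψ x := fun f f' =>
    (setIntegral_eq_integral_of_forall_compl_eq_zero fun x hx => by
      simp [image_eq_zero_of_notMem_tsupport hx, fderiv_eq_zero_of_notMem_tsupport hx]).symm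
  have t1 : Tendsto (fun j => ∫ x, (η x * smoothPos (ε j) (u x - k)) * fderiv ℝ ψ x e) atTop
      (𝓝 (∫ x, (η x * max (u x - k) 0) * fderiv ℝ ψ x e)) := by
    simp_rw [r1]
    refine tendsto_integral_of_dominated_convergence
      (fun x => |(u x - k) * (η x * fderiv ℝ ψ x e)|) (fun j => ?_) ?_ (fun j => ?_) ?_
    · exact (hη.continuous.aestronglyMeasurable.mul
        ((contDiff_smoothPos (hε j)).continuous.comp_aestronglyMeasurable
          hiK'.aestronglyMeasurable)).mul hψdc.aestronglyMeasurable
    · exact (hiK'.mul_continuousOn (hη.continuous.mul hψdc).continuousOn hηc).abs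
    · refine Eventually.of_forall fun x => ?_
      rw [Real.norm_eq_abs, abs_mul, abs_mul, abs_mul, abs_mul, mul_comm |η x|, mul_assoc]
      exact mul_le_mul_of_nonneg_right (abs_smoothPos_le (hε j) _) (by positivity)
    · exact Eventually.of_forall fun x =>
        (tendsto_const_nhds.mul (tendsto_smoothPos _)).mul tendsto_const_nhds
  have t2 : Tendsto (fun j => ∫ x, (smoothPos (ε j) (u x - k) * fderiv ℝ η x e
      + η x * deriv (smoothPos (ε j)) (u x - k) * du x i) * ψ x) atTop
      (𝓝 (∫ x, (max (u x - k) 0 * fderiv ℝ η x e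
        + η x * (if 0 < u x - k then 1 else 0) * du x i) * ψ x)) := by
    simp_rw [fun j => r2 (fun x => smoothPos (ε j) (u x - k))
      (fun x => deriv (smoothPos (ε j)) (u x - k)), r2]
    refine tendsto_integral_of_dominated_convergence
      (fun x => C * |(u x - k) * ψ x| + |du x i * (η x * ψ x)|) (fun j => ?_) ?_ (fun j => ?_) ?_
    · refine AEStronglyMeasurable.mul (.add ?_ ?_) hψ.continuous.aestronglyMeasurable
      · exact ((contDiff_smoothPos (hε j)).continuous.comp_aestronglyMeasurable
          hiK'.aestronglyMeasurable).mul hηdm.aestronglyMeasurable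
      · exact (hη.continuous.aestronglyMeasurable.mul
          (((contDiff_smoothPos (hε j)).continuous_deriv le_rfl).comp_aestronglyMeasurable
          hiK'.aestronglyMeasurable)).mul hdiK.aestronglyMeasurable
    · exact ((hiK'.mul_continuousOn hψ.continuous.continuousOn hηc).abs.const_mul _).add
        (hdiK.mul_continuousOn (hη.continuous.mul hψ.continuous).continuousOn hηc).abs
    · refine Eventually.of_forall fun x => ?_
      rw [Real.norm_eq_abs, add_mul]
      refine (abs_add_le _ _).trans (add_le_add ?_ ?_)
      · have h1 := abs_smoothPos_le (hε j) (u x - k)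
        have h2 := hηd x
        rw [abs_mul, abs_mul, abs_mul, ← mul_assoc, mul_comm (C : ℝ)]
        exact mul_le_mul_of_nonneg_right (mul_le_mul h1 h2 (abs_nonneg _) (abs_nonneg _))
          (abs_nonneg _)
      · have h1 := abs_deriv_smoothPos_le (hε j) (u x - k)
        have : η x * deriv (smoothPos (ε j)) (u x - k) * du x i * ψ x
          = deriv (smoothPos (ε j)) (u x - k) * (du x i * (η x * ψ x)) := by ring
        rw [this, abs_mul]
        exact mul_le_of_le_one_left (abs_nonneg _) h1
    · exact Eventually.of_forall fun x =>
        ((((tendsto_smoothPos _).mul tendsto_const_nhds).add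
          ((tendsto_const_nhds.mul (tendsto_deriv_smoothPos _)).mul tendsto_const_nhds)).mul
          tendsto_const_nhds)
  have hfin := tendsto_nhds_unique (t1.congr hid) t2.neg
  convert! hfin using 2
  congr 1
  ext x
  simp only [truncGrad, PiLp.add_apply, PiLp.smul_apply, gradient_apply, smul_eq_mul, sub_pos]
  split_ifs <;> simp [he]

end Truncation

section Sobolev

open Filter

variable {n : ℕ}

/-- Integrable functions with an integrable weak gradient on the whole space, both vanishing
off `K`. -/
structure IsSobolev (K : Set (𝔼 n)) (v : 𝔼 n → ℝ) (dv : 𝔼 n → 𝔼 n) : Prop where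
  int : Integrable v
  dint : Integrable dv
  weak : IsWeakGradOn n univ v dv
  eq_zero : ∀ x, x ∉ K → v x = 0
  deq_zero : ∀ x, x ∉ K → dv x = 0

lemma isSobolev_trunc {Ω : Set (𝔼 n)} {u : 𝔼 n → ℝ} {du : 𝔼 n → 𝔼 n}
    (hi : LocallyIntegrableOn u Ω) (hdi : LocallyIntegrableOn du Ω)
    {η : 𝔼 n → ℝ} {C : ℝ≥0} (hη : LipschitzWith C η) (hηc : HasCompactSupport η)
    (hηΩ : tsupport η ⊆ Ω) (k : ℝ) (hΩ : IsOpen Ω) (hu : IsWeakGradOn n Ω u du) :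
    IsSobolev (tsupport η) (truncFun η u k) (truncGrad η u du k) where
  int := integrable_truncFun hi hη hηc hηΩ k
  dint := integrable_truncGrad hi hdi hη hηc hηΩ k
  weak := isWeakGradOn_trunc hi hdi hη hηc hηΩ k hΩ hu
  eq_zero x hx := by simp [truncFun, image_eq_zero_of_notMem_tsupport hx]
  deq_zero x hx := by
    simp [truncGrad, gradient_eq_zero_of_notMem_tsupport hx, image_eq_zero_of_notMem_tsupport hx]

lemma gns_smooth {E : Type*} [NormedAddCommGroup E] [NormedSpace ℝ E] [MeasurableSpace E]
    [BorelSpace E] [FiniteDimensional ℝ E] (μ : Measure E) [μ.IsAddHaarMeasure]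
    {p p' : ℝ} (hp : 1 ≤ p) (hpn : p < Module.finrank ℝ E)
    (hp' : 1 / p' = 1 / p - 1 / (Module.finrank ℝ E : ℝ)) :
    ∃ C : ℝ≥0, ∀ u : E → ℝ, ContDiff ℝ 1 u → HasCompactSupport u →
      (∫⁻ x, ‖u x‖ₑ ^ p' ∂μ) ^ (1 / p') ≤ C * (∫⁻ x, ‖fderiv ℝ u x‖ₑ ^ p ∂μ) ^ (1 / p) := by
  have hp0 : 0 < p := by linarith
  have hp'0 : 0 < p' := by
    have : 0 < 1 / p' := by
      rw [hp']
      exact sub_pos.2 (one_div_lt_one_div_of_lt hp0 hpn)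
    exact one_div_pos.1 this
  refine ⟨SNormLESNormFDerivOfEqConst ℝ μ (p.toNNReal : ℝ), fun u hu huc => ?_⟩
  have := eLpNorm_le_eLpNorm_fderiv_of_eq (F := ℝ) μ hu huc (p := p.toNNReal)
    (p' := p'.toNNReal) (by simpa using hp) (by exact_mod_cast hp0.trans hpn)
    (by simpa [hp0.le, hp'0.le] using hp')
  rw [eLpNorm_nnreal_eq_lintegral (by simpa using hp'0),
    eLpNorm_nnreal_eq_lintegral (by simpa using hp0)] at this
  simpa [hp0.le, hp'0.le] using this

namespace IsSobolev

variable {K : Set (𝔼 n)} {v : 𝔼 n → ℝ} {dv : 𝔼 n → 𝔼 n}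

lemma hasCompactSupport (hv : IsSobolev K v dv) (hK : IsCompact K) : HasCompactSupport v :=
  HasCompactSupport.intro hK hv.eq_zero

lemma contDiff_moll (hv : IsSobolev K v dv) (m : ℕ) : ContDiff ℝ (⊤ : ℕ∞) (moll m v) :=
  _root_.contDiff_moll m hv.int.locallyIntegrable

lemma fderiv_moll (hv : IsSobolev K v dv) (m : ℕ) (x : 𝔼 n) (i : Fin n) :
    fderiv ℝ (moll m v) x (EuclideanSpace.single i 1) = moll m dv x i := by
  simpa using fderiv_moll_apply (m := m) hv.weak .univ subset_rfl hv.int.integrableOn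
    hv.dint.integrableOn (subset_univ (closedBall x _)) i

lemma norm_fderiv_moll (hv : IsSobolev K v dv) (m : ℕ) (x : 𝔼 n) :
    ‖fderiv ℝ (moll m v) x‖ₑ = ‖moll m dv x‖ₑ := by
  have : gradient (moll m v) x = moll m dv x := by
    ext i
    rw [gradient_apply, hv.fderiv_moll]
  rw [enorm_eq_nnnorm, enorm_eq_nnnorm, ← this]
  congr 1
  ext
  simp [norm_gradient]

lemma lintegral_fderiv_moll_le (hv : IsSobolev K v dv) (m : ℕ) {p : ℝ} (hp : 1 ≤ p) :
    ∫⁻ x, ‖fderiv ℝ (moll m v) x‖ₑ ^ p ≤ ∫⁻ x, ‖dv x‖ₑ ^ p := by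
  simp_rw [hv.norm_fderiv_moll]
  exact lintegral_moll_rpow_le m hv.dint.aestronglyMeasurable hp

lemma gns (hK : IsCompact K) (hv : IsSobolev K v dv) {p p' : ℝ} (hp : 1 ≤ p) (hp'0 : 0 < p')
    {C : ℝ≥0}
    (hC : ∀ u : 𝔼 n → ℝ, ContDiff ℝ 1 u → HasCompactSupport u →
      (∫⁻ x, ‖u x‖ₑ ^ p') ^ (1 / p') ≤ C * (∫⁻ x, ‖fderiv ℝ u x‖ₑ ^ p) ^ (1 / p)) :
    (∫⁻ x, ‖v x‖ₑ ^ p') ^ (1 / p') ≤ C * (∫⁻ x, ‖dv x‖ₑ ^ p) ^ (1 / p) := by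
  have hm : ∀ m, ∫⁻ x, ‖moll m v x‖ₑ ^ p' ≤ (C * (∫⁻ x, ‖dv x‖ₑ ^ p) ^ (1 / p)) ^ p' := by
    intro m
    have h1 := hC (moll m v) ((hv.contDiff_moll m).of_le (by exact_mod_cast le_top))
      (hasCompactSupport_moll m (hv.hasCompactSupport hK))
    have h2 := hv.lintegral_fderiv_moll_le m hp
    have h3 : (∫⁻ x, ‖moll m v x‖ₑ ^ p') ^ (1 / p') ≤ C * (∫⁻ x, ‖dv x‖ₑ ^ p) ^ (1 / p) :=
      h1.trans (by gcongr)
    have := ENNReal.rpow_le_rpow h3 hp'0.le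
    rwa [← ENNReal.rpow_mul, one_div_mul_cancel hp'0.ne', ENNReal.rpow_one] at this
  have h4 : ∫⁻ x, ‖v x‖ₑ ^ p' ≤ (C * (∫⁻ x, ‖dv x‖ₑ ^ p) ^ (1 / p)) ^ p' := by
    calc ∫⁻ x, ‖v x‖ₑ ^ p'
        ≤ ∫⁻ x, liminf (fun m => ‖moll m v x‖ₑ ^ p') atTop := by
          refine lintegral_mono_ae ?_
          filter_upwards [ae_tendsto_moll hv.int.locallyIntegrable] with x hx
          exact (((ENNReal.continuous_rpow_const.tendsto _).comp hx.enorm).liminf_eq).ge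
      _ ≤ liminf (fun m => ∫⁻ x, ‖moll m v x‖ₑ ^ p') atTop :=
          lintegral_liminf_le' fun m =>
            ((hv.contDiff_moll m).continuous.measurable.enorm.pow_const _).aemeasurable
      _ ≤ _ := liminf_le_of_frequently_le' (Frequently.of_forall hm)
  have := ENNReal.rpow_le_rpow h4 (one_div_pos.2 hp'0).le
  rwa [← ENNReal.rpow_mul, mul_one_div_cancel hp'0.ne', ENNReal.rpow_one] at this

end IsSobolev

lemma exists_lipschitz_cutoff {Ω K : Set (𝔼 n)} (hΩ : IsOpen Ω) (hK : IsCompact K) (hKΩ : K ⊆ Ω) :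
    ∃ (η : 𝔼 n → ℝ) (C : ℝ≥0), LipschitzWith C η ∧ HasCompactSupport η ∧ tsupport η ⊆ Ω ∧
      (∀ x ∈ K, η x = 1) ∧ ∀ x, 0 ≤ η x ∧ η x ≤ 1 := by
  rcases K.eq_empty_or_nonempty with rfl | hne
  · refine ⟨0, 0, LipschitzWith.const 0, HasCompactSupport.zero, ?_, by simp, by simp⟩
    simp [tsupport]
  obtain ⟨δ, hδ, hδΩ⟩ := hK.exists_cthickening_subset_open hΩ hKΩ
  have hts : tsupport (fun x => max 0 (1 - infDist x K / δ)) ⊆ cthickening δ K := by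
    refine closure_minimal (fun x hx => ?_) isClosed_cthickening
    rw [mem_cthickening_iff, ENNReal.le_ofReal_iff_toReal_le (infEDist_ne_top hne) hδ.le]
    change infDist x K ≤ δ
    by_contra h
    refine hx (max_eq_left ?_)
    rw [sub_nonpos, le_div_iff₀ hδ]
    linarith
  have hl : LipschitzWith (δ⁻¹).toNNReal (fun x => infDist x K / δ) := by
    refine LipschitzWith.of_dist_le_mul fun x y => ?_
    rw [Real.dist_eq, ← sub_div, abs_div, abs_of_pos hδ, Real.coe_toNNReal _ (by positivity),
      div_eq_inv_mul]
    gcongr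
    simpa [Real.dist_eq] using (lipschitz_infDist_pt K).dist_le_mul x y
  refine ⟨fun x => max 0 (1 - infDist x K / δ), (δ⁻¹).toNNReal, ?_, ?_, hts.trans hδΩ, ?_, ?_⟩
  · refine LipschitzWith.const_max ?_ 0
    simpa using (LipschitzWith.const (1 : ℝ)).sub hl
  · exact (hK.cthickening).of_isClosed_subset (isClosed_tsupport _) hts
  · intro x hx
    simp [infDist_zero_of_mem hx]
  · intro x
    have : 0 ≤ infDist x K / δ := div_nonneg infDist_nonneg hδ.le
    exact ⟨le_max_left _ _, max_le zero_le_one (by linarith)⟩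

lemma memLp_ofReal_iff {E : Type*} [NormedAddCommGroup E] {μ : Measure (𝔼 n)} {w : 𝔼 n → E} {r : ℝ}
    (hr : 0 < r) (hw : AEStronglyMeasurable w μ) :
    MemLp w (ENNReal.ofReal r) μ ↔ ∫⁻ x, ‖w x‖ₑ ^ r ∂μ < ⊤ := by
  have h0 : ENNReal.ofReal r ≠ 0 := (ENNReal.ofReal_pos.2 hr).ne'
  rw [MemLp, eLpNorm_lt_top_iff_lintegral_rpow_enorm_lt_top h0 ENNReal.ofReal_ne_top,
    ENNReal.toReal_ofReal hr.le]
  exact and_iff_right hw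

lemma norm_truncGrad_le {η u : 𝔼 n → ℝ} {du : 𝔼 n → 𝔼 n} {C : ℝ≥0} (hη : LipschitzWith C η)
    (hη1 : ∀ x, 0 ≤ η x ∧ η x ≤ 1) (k : ℝ) (x : 𝔼 n) :
    ‖truncGrad η u du k x‖ ≤ max (u x - k) 0 * C + if k < u x then ‖du x‖ else 0 := by
  refine (norm_add_le _ _).trans (add_le_add ?_ ?_)
  · rw [norm_smul, Real.norm_of_nonneg (le_max_right _ _)]
    gcongr
    exact norm_gradient_le hη x
  · rw [norm_smul]
    split_ifs
    · rw [Real.norm_of_nonneg (hη1 x).1]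
      exact mul_le_of_le_one_left (norm_nonneg _) (hη1 x).2
    · simp

lemma memLp_trunc_of_memLp {Ω : Set (𝔼 n)} {u : 𝔼 n → ℝ} {du : 𝔼 n → 𝔼 n} (hΩ : IsOpen Ω)
    (hi : LocallyIntegrableOn u Ω) (hdi : LocallyIntegrableOn du Ω) (hu : IsWeakGradOn n Ω u du)
    {r r' : ℝ} (hr : 1 ≤ r) (hrn : r < n) (hr' : 1 / r' = 1 / r - 1 / (n : ℝ))
    {η : 𝔼 n → ℝ} {C : ℝ≥0} (hη : LipschitzWith C η) (hηc : HasCompactSupport η)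
    (hηΩ : tsupport η ⊆ Ω) (hη1 : ∀ x, 0 ≤ η x ∧ η x ≤ 1)
    (h1 : MemLp u (ENNReal.ofReal r) (volume.restrict (tsupport η)))
    (h2 : MemLp du (ENNReal.ofReal r) (volume.restrict (tsupport η))) :
    MemLp (truncFun η u 0) (ENNReal.ofReal r') := by
  have hr0 : 0 < r := by linarith
  have hr'0 : 0 < r' := by
    rw [← one_div_pos, hr']
    exact sub_pos.2 (one_div_lt_one_div_of_lt hr0 hrn)
  have hS := isSobolev_trunc hi hdi hη hηc hηΩ 0 hΩ hu
  obtain ⟨D, hD⟩ := gns_smooth (volume : Measure (𝔼 n)) hr (by simpa using hrn)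
    (by simpa using hr')
  have hd : MemLp (truncGrad η u du 0) (ENNReal.ofReal r) (volume.restrict (tsupport η)) := by
    refine ((h1.norm.mul_const C).add h2.norm).mono'
      hS.dint.aestronglyMeasurable.restrict (Eventually.of_forall fun x => ?_)
    refine (norm_truncGrad_le hη hη1 0 x).trans (add_le_add ?_ ?_)
    · refine mul_le_mul_of_nonneg_right ?_ C.2
      simp [le_abs_self]
    · split_ifs
      · exact le_rfl
      · positivity
  rw [memLp_ofReal_iff hr0 hd.1] at hd
  rw [memLp_ofReal_iff hr'0 hS.int.aestronglyMeasurable]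
  have hfin : ∫⁻ x, ‖truncGrad η u du 0 x‖ₑ ^ r < ⊤ := by
    rwa [← setLIntegral_eq_of_support_subset (s := tsupport η)]
    intro x hx
    by_contra hcon
    exact hx (by simp [hS.deq_zero x hcon, hr0])
  have := (hS.gns hηc hr hr'0 hD).trans_lt
    (ENNReal.mul_lt_top ENNReal.coe_lt_top (ENNReal.rpow_lt_top_of_nonneg (by positivity) hfin.ne))
  exact (ENNReal.rpow_lt_top_iff_of_pos (one_div_pos.2 hr'0)).1 this

/-- A function whose weak gradient is locally `L^p`, `p < n`, is locally `L^p`. -/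
lemma memLp_of_isWeakGradOn {Ω : Set (𝔼 n)} {u : 𝔼 n → ℝ} {du : 𝔼 n → 𝔼 n} (hΩ : IsOpen Ω)
    (hi : LocallyIntegrableOn u Ω) (hdi : LocallyIntegrableOn du Ω) (hu : IsWeakGradOn n Ω u du)
    {p : ℝ} (hp : 1 ≤ p) (hpn : p < n)
    (hd : ∀ K, IsCompact K → K ⊆ Ω → MemLp du (ENNReal.ofReal p) (volume.restrict K))
    {K : Set (𝔼 n)} (hK : IsCompact K) (hKΩ : K ⊆ Ω) :
    MemLp u (ENNReal.ofReal p) (volume.restrict K) := by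
  have hn0 : (0 : ℝ) < n := by linarith
  have hp0 : 0 < p := by linarith
  have key : ∀ j : ℕ, ∀ K, IsCompact K → K ⊆ Ω →
      MemLp u (ENNReal.ofReal (1 / max (1 / p) (1 - j / n))) (volume.restrict K) := by
    intro j
    induction j with
    | zero =>
      intro K hK hKΩ
      have : max (1 / p) 1 = 1 := max_eq_right ((div_le_one hp0).2 hp)
      rw [Nat.cast_zero, zero_div, sub_zero, this, div_one, ENNReal.ofReal_one]
      exact memLp_one_iff_integrable.2 (hi.integrableOn_compact_subset hKΩ hK)
    | succ j ih =>
      intro K hK hKΩ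
      rcases le_or_gt (1 - j / n : ℝ) (1 / p) with hj | hj
      · have h2 : (1 - (j + 1 : ℕ) / n : ℝ) ≤ 1 / p := by
          refine le_trans ?_ hj
          gcongr
          exact_mod_cast j.le_succ
        have := ih K hK hKΩ
        rwa [max_eq_left hj, ← max_eq_left h2] at this
      obtain ⟨η, C, hη, hηc, hηΩ, hηK, hη1⟩ := exists_lipschitz_cutoff hΩ hK hKΩ
      have : IsFiniteMeasure (volume.restrict (tsupport η)) :=
        ⟨by simpa using hηc.isCompact.measure_lt_top⟩
      have : IsFiniteMeasure (volume.restrict K) := ⟨by simpa using hK.measure_lt_top⟩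
      set r : ℝ := 1 / (1 - j / n) with hrdef
      have hj0 : (0 : ℝ) < 1 - j / n := (one_div_pos.2 hp0).trans hj
      have hrp : r ≤ p := by
        rw [hrdef, one_div_le hj0 hp0]; exact hj.le
      have hr1 : 1 ≤ r := by
        rw [hrdef, le_div_iff₀ hj0]
        have : (0 : ℝ) ≤ j / n := by positivity
        linarith
      have h1 := ih (tsupport η) hηc hηΩ
      rw [max_eq_right hj.le] at h1
      have h2 := (hd (tsupport η) hηc hηΩ).mono_exponent (ENNReal.ofReal_le_ofReal hrp)
      set r' : ℝ := 1 / (1 - (j + 1 : ℕ) / n) with hr'def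
      have hr' : 1 / r' = 1 / r - 1 / (n : ℝ) := by
        rw [hr'def, hrdef, one_div_one_div, one_div_one_div]
        push_cast
        ring
      have hj1 : (0 : ℝ) < 1 - (j + 1 : ℕ) / n := by
        rw [← one_div_one_div (1 - (j + 1 : ℕ) / n : ℝ), ← hr'def, hr']
        exact sub_pos.2 (one_div_lt_one_div_of_lt (by linarith) (hrp.trans_lt hpn))
      have t1 := memLp_trunc_of_memLp hΩ hi hdi hu hr1 (hrp.trans_lt hpn) hr' hη hηc hηΩ hη1 h1 h2
      have t2 := memLp_trunc_of_memLp hΩ hi.neg hdi.neg hu.neg hr1 (hrp.trans_lt hpn) hr' hη hηc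
        hηΩ hη1 h1.neg h2.neg
      have t3 := (t1.sub t2).restrict K
      refine (MemLp.mono_exponent (q := ENNReal.ofReal r') (t3.ae_eq ?_) ?_)
      · refine (ae_restrict_iff' hK.measurableSet).2 (Eventually.of_forall fun x hx => ?_)
        simp only [truncFun, Pi.sub_apply, hηK x hx, one_mul, sub_zero, Pi.neg_apply]
        rcases le_total (u x) 0 with h | h
        · rw [max_eq_right h, max_eq_left (by linarith)]; ring
        · rw [max_eq_left h, max_eq_right (by linarith)]; ring
      · refine ENNReal.ofReal_le_ofReal ?_
        exact one_div_le_one_div_of_le hj1 (le_max_right _ _)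
  have := key n K hK hKΩ
  rw [div_self hn0.ne', sub_self, max_eq_left (by positivity), one_div_one_div] at this
  exact this

end Sobolev

section SliceSobolev

open Filter

lemma lintegral_rpow_le_of_exponent_le {X : Type*} [MeasurableSpace X] {μ : Measure X}
    {f : X → ℝ≥0∞} {a b : ℝ} (ha : 0 < a) (hab : a ≤ b) (hf : AEMeasurable f μ) :
    (∫⁻ x, f x ^ a ∂μ) ^ (1 / a) ≤ (∫⁻ x, f x ^ b ∂μ) ^ (1 / b) * μ univ ^ (1 / a - 1 / b) := by
  simpa [eLpNorm'] using eLpNorm'_le_eLpNorm'_mul_rpow_measure_univ ha hab hf.aestronglyMeasurable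

lemma setLIntegral_rpow_le_of_exponent_le {X : Type*} [MeasurableSpace X] {μ : Measure X}
    {S : Set X} {f : X → ℝ≥0∞} {a b : ℝ} (ha : 0 < a) (hab : a ≤ b) (hf : AEMeasurable f μ)
    (hS : ∀ x, x ∉ S → f x = 0) :
    (∫⁻ x, f x ^ a ∂μ) ^ (1 / a) ≤ (∫⁻ x, f x ^ b ∂μ) ^ (1 / b) * μ S ^ (1 / a - 1 / b) := by
  have h : ∀ c : ℝ, 0 < c → ∫⁻ x, f x ^ c ∂μ = ∫⁻ x in S, f x ^ c ∂μ := fun c hc => by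
    refine (setLIntegral_eq_of_support_subset fun x hx => ?_).symm
    by_contra hcon
    exact hx (by simp [hS x hcon, hc])
  rw [h a ha, h b (ha.trans_le hab)]
  simpa using lintegral_rpow_le_of_exponent_le ha hab (hf.restrict (s := S))

variable {N : ℕ}

lemma enorm_le_lintegral_fderiv_fin_one {v : (Fin 1 → ℝ) → ℝ} (hv : ContDiff ℝ 1 v)
    (hvc : HasCompactSupport v) (x : Fin 1 → ℝ) : ‖v x‖ₑ ≤ ∫⁻ y, ‖fderiv ℝ v y‖ₑ := by
  let e : ℝ →L[ℝ] (Fin 1 → ℝ) := ContinuousLinearMap.pi fun _ => .id ℝ ℝ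
  have he : ∀ t, e t = fun _ => t := fun t => rfl
  have hx : e (x 0) = x := by ext i; simp [he, Subsingleton.elim i 0]
  have hmp := (volume_preserving_funUnique (Fin 1) ℝ).symm
  have hes : ⇑(MeasurableEquiv.funUnique (Fin 1) ℝ).symm = e := by
    ext t i; simp [he]
  have hce : Topology.IsClosedEmbedding e := by
    have := (Homeomorph.funUnique (Fin 1) ℝ).symm.isClosedEmbedding
    exact this
  have h1 := HasCompactSupport.enorm_le_lintegral_Ici_deriv (f := v ∘ e)
    (hv.comp e.contDiff) (hvc.comp_isClosedEmbedding hce) (x 0)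
  rw [Function.comp_apply, hx] at h1
  refine h1.trans ((setLIntegral_le_lintegral _ _).trans ?_)
  have h3 := hmp.lintegral_comp_emb (MeasurableEquiv.measurableEmbedding _)
    (fun y => ‖fderiv ℝ v y‖ₑ)
  rw [hes] at h3
  refine le_of_le_of_eq ?_ h3
  refine lintegral_mono fun t => ?_
  have hd : deriv (v ∘ e) t = fderiv ℝ v (e t) (e 1) := by
    have h2 := ((hv.differentiable (by simp)) (e t)).hasFDerivAt.comp_hasDerivAt t
      (e.hasDerivAt (x := t))
    exact h2.deriv
  rw [hd]
  refine ((fderiv ℝ v (e t)).le_opENorm (e 1)).trans ?_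
  refine mul_le_of_le_one_right' ?_
  rw [← ofReal_norm]
  refine ENNReal.ofReal_le_one.2 ?_
  simp [he]

lemma exists_subcritical_sobolev (hN : 1 ≤ N) {p q : ℝ} (hp : 1 ≤ p) (hpq : p < q)
    (hε : 1 / p ≤ min (1 / q + 1 / (N : ℝ)) 1) :
    ∃ (s b : ℝ) (C : ℝ≥0), 1 ≤ s ∧ s ≤ p ∧ b ≤ 1 / q ∧ b = 1 / s - 1 / (N : ℝ) ∧
      ∀ (S : Set (Fin N → ℝ)) (v : (Fin N → ℝ) → ℝ), ContDiff ℝ 1 v → HasCompactSupport v →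
        (∀ x, x ∉ S → v x = 0) →
        (∫⁻ x, ‖v x‖ₑ ^ q) ^ (1 / q)
          ≤ C * volume S ^ (1 / q - b) * (∫⁻ x, ‖fderiv ℝ v x‖ₑ ^ s) ^ (1 / s) := by
  have hp0 : 0 < p := by linarith
  have hq0 : 0 < q := by linarith
  have hN0 : (0 : ℝ) < N := by exact_mod_cast hN
  rcases hN.eq_or_lt with rfl | hN2
  · refine ⟨1, 0, 1, le_rfl, hp, by positivity, by simp, fun S v hv hvc hS => ?_⟩
    simp only [ENNReal.coe_one, one_mul, sub_zero, ENNReal.rpow_one, div_one]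
    have h := enorm_le_lintegral_fderiv_fin_one hv hvc
    set B := ∫⁻ y, ‖fderiv ℝ v y‖ₑ
    have h1 : ∫⁻ x, ‖v x‖ₑ ^ q ≤ B ^ q * volume S := by
      calc ∫⁻ x, ‖v x‖ₑ ^ q = ∫⁻ x in S, ‖v x‖ₑ ^ q := by
            refine (setLIntegral_eq_of_support_subset fun x hx => ?_).symm
            by_contra hcon
            exact hx (by simp [hS x hcon, hq0])
        _ ≤ ∫⁻ x in S, B ^ q := by gcongr with x; exact h x
        _ = B ^ q * volume S := by simp
    calc (∫⁻ x, ‖v x‖ₑ ^ q) ^ (1 / q) ≤ (B ^ q * volume S) ^ (1 / q) := by gcongr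
      _ = volume S ^ (1 / q) * B := by
        rw [ENNReal.mul_rpow_of_nonneg _ _ (by positivity), ← ENNReal.rpow_mul,
          mul_one_div_cancel hq0.ne', ENNReal.rpow_one, mul_comm]
  · have hN1 : (1 : ℝ) < N := by exact_mod_cast hN2
    set a : ℝ := min (1 / q + 1 / (N : ℝ)) 1 with ha
    have ha1 : a ≤ 1 := min_le_right _ _
    have ha0 : 1 / (N : ℝ) < a := by
      refine lt_min ?_ ?_
      · have : 0 < 1 / q := by positivity
        linarith
      · rwa [div_lt_one hN0]
    have hapos : 0 < a := lt_trans (by positivity) ha0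
    have hsN : 1 / a < (N : ℝ) := by rwa [one_div_lt hapos hN0]
    have hb0 : 0 < a - 1 / (N : ℝ) := by linarith
    obtain ⟨C, hC⟩ := gns_smooth (volume : Measure (Fin N → ℝ)) (p := 1 / a)
      (p' := 1 / (a - 1 / (N : ℝ))) (by rwa [le_div_iff₀ hapos, one_mul])
      (by simpa using hsN) (by simp)
    refine ⟨1 / a, a - 1 / N, C, ?_, ?_, ?_, by simp, fun S v hv hvc hS => ?_⟩
    · rwa [le_div_iff₀ hapos, one_mul]
    · rw [one_div_le hapos hp0]; exact hε
    · have : a ≤ 1 / q + 1 / N := min_le_left _ _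
      linarith
    have hbq : q ≤ 1 / (a - 1 / (N : ℝ)) := by
      rw [le_one_div hq0 hb0]
      have : a ≤ 1 / q + 1 / N := min_le_left _ _
      linarith
    have h1 := setLIntegral_rpow_le_of_exponent_le (μ := volume) (S := S)
      (f := fun x => ‖v x‖ₑ) hq0 hbq hv.continuous.measurable.enorm.aemeasurable
      (fun x hx => by simp [hS x hx])
    refine h1.trans ?_
    rw [one_div_one_div (a - 1 / (N : ℝ)), mul_right_comm]
    gcongr
    have h2 := hC v hv hvc
    rwa [one_div_one_div (a - 1 / (N : ℝ))] at h2

/-- The Sobolev inequality `W^{1,p} → L^q` on cubes of the `(n-1)`-dimensional slices. -/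
lemma exists_slice_sobolev (hN : 1 ≤ N) {p q : ℝ} (hp : 1 ≤ p) (hpq : p < q)
    (hε : 1 / p ≤ min (1 / q + 1 / (N : ℝ)) 1) :
    ∃ C : ℝ≥0, ∀ (c : Fin N → ℝ) (r : ℝ), 0 < r → ∀ v : (Fin N → ℝ) → ℝ, ContDiff ℝ 1 v →
      (∀ x, x ∉ closedBall c r → v x = 0) →
      (∫⁻ x, ‖v x‖ₑ ^ q) ^ (1 / q)
        ≤ C * ENNReal.ofReal r ^ (1 + N / q - N / p) * (∫⁻ x, ‖fderiv ℝ v x‖ₑ ^ p) ^ (1 / p) := by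
  obtain ⟨s, b, C, hs1, hsp, hbq, hb, h⟩ := exists_subcritical_sobolev hN hp hpq hε
  have hs0 : 0 < s := by linarith
  have hp0 : 0 < p := by linarith
  have hN0 : (0 : ℝ) < N := by exact_mod_cast hN
  set e : ℝ := 1 + N / q - N / p with he
  have hee : e = N * (1 / q - b + (1 / s - 1 / p)) := by
    rw [hb, he]; field_simp; ring
  have h1s : 0 ≤ 1 / s - 1 / p := sub_nonneg.2 (one_div_le_one_div_of_le hs0 hsp)
  have he0 : 0 ≤ e := by rw [hee]; have := sub_nonneg.2 hbq; positivity
  refine ⟨C * ((2 : ℝ≥0) ^ e), fun c r hr v hv hS => ?_⟩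
  have hvc : HasCompactSupport v := HasCompactSupport.intro (isCompact_closedBall c r) hS
  have hSd : ∀ x, x ∉ closedBall c r → fderiv ℝ v x = 0 := fun x hx =>
    fderiv_of_notMem_tsupport (𝕜 := ℝ) fun hx' => hx (closure_minimal
      (fun y hy => by by_contra hcon; exact hy (hS y hcon)) isClosed_closedBall hx')
  have h1 := h (closedBall c r) v hv hvc hS
  have h2 := setLIntegral_rpow_le_of_exponent_le (μ := volume) (S := closedBall c r)
    (f := fun x => ‖fderiv ℝ v x‖ₑ) hs0 hsp
    (hv.continuous_fderiv (by simp)).measurable.enorm.aemeasurable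
    (fun x hx => by rw [hSd x hx, ← ofReal_norm, norm_zero, ENNReal.ofReal_zero])
  refine h1.trans ?_
  set V := volume (closedBall c r) with hV
  have hVr : V = (2 * ENNReal.ofReal r) ^ (N : ℝ) := by
    rw [hV, Real.volume_pi_closedBall c hr.le, Fintype.card_fin,
      ENNReal.ofReal_pow (by positivity), ENNReal.ofReal_mul (by simp), ENNReal.rpow_natCast]
    simp
  calc ↑C * V ^ (1 / q - b) * (∫⁻ x, ‖fderiv ℝ v x‖ₑ ^ s) ^ (1 / s)
      ≤ C * V ^ (1 / q - b) * ((∫⁻ x, ‖fderiv ℝ v x‖ₑ ^ p) ^ (1 / p) * V ^ (1 / s - 1 / p)) := by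
        gcongr
    _ = C * V ^ (1 / q - b + (1 / s - 1 / p)) * (∫⁻ x, ‖fderiv ℝ v x‖ₑ ^ p) ^ (1 / p) := by
        rw [ENNReal.rpow_add_of_nonneg _ _ (sub_nonneg.2 hbq) h1s]
        ring
    _ = _ := by
        rw [hVr, ← ENNReal.rpow_mul, ← hee, ENNReal.mul_rpow_of_nonneg _ _ he0, ENNReal.coe_mul,
          ENNReal.coe_rpow_of_nonneg _ he0, ENNReal.coe_ofNat]
        ring

end SliceSobolev

section Slicing

open Filter

/-- The closed cube with center `x₀` and half side length `r`. -/
def cube {n : ℕ} (x₀ : 𝔼 n) (r : ℝ) : Set (𝔼 n) := {x | ∀ i, |x i - x₀ i| ≤ r}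

section Cube

variable {n : ℕ} {x₀ : 𝔼 n} {r s : ℝ}

lemma mem_cube {x : 𝔼 n} : x ∈ cube x₀ r ↔ ∀ i, |x i - x₀ i| ≤ r := Iff.rfl

lemma cube_eq_preimage (hr : 0 ≤ r) :
    cube x₀ r = WithLp.ofLp ⁻¹' closedBall (WithLp.ofLp x₀) r := by
  ext x
  simp [mem_cube, dist_pi_le_iff hr, Real.dist_eq]

lemma isClosed_cube : IsClosed (cube x₀ r) := by
  simp only [cube, ofPred_forall]
  exact isClosed_iInter fun i => isClosed_le (by fun_prop) continuous_const

lemma cube_mono (h : r ≤ s) : cube x₀ r ⊆ cube x₀ s := fun _ hx i => (hx i).trans h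

lemma abs_apply_le_norm (x : 𝔼 n) (i : Fin n) : |x i| ≤ ‖x‖ := by
  simpa using PiLp.norm_apply_le x i

lemma closedBall_subset_cube : closedBall x₀ r ⊆ cube x₀ r := fun x hx i => by
  rw [mem_closedBall, dist_eq_norm] at hx
  exact (abs_apply_le_norm (x - x₀) i).trans hx

lemma cube_subset_closedBall : cube x₀ r ⊆ closedBall x₀ (n * r) := fun x hx => by
  rw [mem_closedBall, dist_eq_norm]
  calc ‖x - x₀‖ ≤ ∑ i, ‖(x - x₀) i‖ := by
        have := norm_sum_le Finset.univ fun i => EuclideanSpace.single i ((x - x₀) i)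
        refine le_trans (le_of_eq ?_) (this.trans (le_of_eq ?_))
        · congr 1
          ext j
          simp [Pi.single_apply]
        · simp
    _ ≤ ∑ _i : Fin n, r := Finset.sum_le_sum fun i _ => hx i
    _ = n * r := by simp

lemma isCompact_cube : IsCompact (cube x₀ r) :=
  (isCompact_closedBall x₀ (n * r)).of_isClosed_subset isClosed_cube cube_subset_closedBall

lemma volume_cube (hr : 0 ≤ r) : volume (cube x₀ r) = ENNReal.ofReal ((2 * r) ^ n) := by
  rw [cube_eq_preimage hr, (PiLp.volume_preserving_ofLp (Fin n)).measure_preimage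
    isClosed_closedBall.measurableSet.nullMeasurableSet, Real.volume_pi_closedBall _ hr,
    Fintype.card_fin]

end Cube

variable {N : ℕ}

/-- The point of `ℝᴺ⁺¹` with `i`-th coordinate `t` and other coordinates `y`. -/
def slicePt (i : Fin (N + 1)) (t : ℝ) (y : Fin N → ℝ) : 𝔼 (N + 1) :=
  WithLp.toLp 2 (i.insertNth t y)

@[simp] lemma slicePt_same (i : Fin (N + 1)) (t : ℝ) (y : Fin N → ℝ) : slicePt i t y i = t := by
  simp [slicePt]

@[simp] lemma slicePt_succAbove (i : Fin (N + 1)) (t : ℝ) (y : Fin N → ℝ) (j : Fin N) :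
    slicePt i t y (i.succAbove j) = y j := by
  simp [slicePt]

lemma measurePreserving_slicePt (i : Fin (N + 1)) :
    MeasurePreserving (fun z : ℝ × (Fin N → ℝ) => slicePt i z.1 z.2) := by
  have h1 := (volume_preserving_piFinSuccAbove (fun _ => ℝ) i).symm
  exact (PiLp.volume_preserving_toLp (Fin (N + 1))).comp h1

lemma lintegral_slice (i : Fin (N + 1)) {f : 𝔼 (N + 1) → ℝ≥0∞} (hf : Measurable f) :
    ∫⁻ x, f x = ∫⁻ t, ∫⁻ y, f (slicePt i t y) := by
  have h := measurePreserving_slicePt i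
  rw [← h.lintegral_comp hf, Measure.volume_eq_prod,
    lintegral_prod (fun z : ℝ × (Fin N → ℝ) => f (slicePt i z.1 z.2))
      (hf.comp h.measurable).aemeasurable]

lemma ae_slice (i : Fin (N + 1)) {P : 𝔼 (N + 1) → Prop} (hP : ∀ᵐ x, P x) :
    ∀ᵐ t, ∀ᵐ y, P (slicePt i t y) := by
  have h := (measurePreserving_slicePt i).quasiMeasurePreserving.ae hP
  rw [Measure.volume_eq_prod] at h
  exact Measure.ae_ae_of_ae_prod h

/-- The linear part of `slicePt`. -/
def sliceLin (i : Fin (N + 1)) : (Fin N → ℝ) →L[ℝ] 𝔼 (N + 1) :=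
  LinearMap.toContinuousLinearMap
    { toFun := slicePt i 0
      map_add' := fun y z => by
        ext j
        induction j using i.succAboveCases <;> simp
      map_smul' := fun c y => by
        ext j
        induction j using i.succAboveCases <;> simp }

lemma sliceLin_apply (i : Fin (N + 1)) (y : Fin N → ℝ) : sliceLin i y = slicePt i 0 y := rfl

lemma slicePt_eq (i : Fin (N + 1)) (t : ℝ) (y : Fin N → ℝ) :
    slicePt i t y = slicePt i t 0 + sliceLin i y := by
  ext j
  rw [sliceLin_apply]
  induction j using i.succAboveCases <;> simp

lemma exists_slicing_smooth (hN : 1 ≤ N) {p q : ℝ} (hp : 1 ≤ p) (hpq : p < q)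
    (hε : 1 / p ≤ min (1 / q + 1 / (N : ℝ)) 1) :
    ∃ C : ℝ≥0, ∀ (x₀ : 𝔼 (N + 1)) (r : ℝ), 0 < r → ∀ v : 𝔼 (N + 1) → ℝ, ContDiff ℝ 1 v →
      (∀ x, x ∉ cube x₀ r → v x = 0) → ∀ i,
      ∫⁻ t, (∫⁻ y, ‖v (slicePt i t y)‖ₑ ^ q) ^ (p / q)
        ≤ C * ENNReal.ofReal r ^ (p * (1 + N / q - N / p)) * ∫⁻ x, ‖fderiv ℝ v x‖ₑ ^ p := by
  obtain ⟨C, hC⟩ := exists_slice_sobolev hN hp hpq hε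
  have hp0 : 0 < p := by linarith
  have hq0 : 0 < q := by linarith
  set D : ℝ≥0 := ∑ i : Fin (N + 1), ‖sliceLin i‖₊ with hD
  refine ⟨C ^ p * D ^ p, fun x₀ r hr v hv hvs i => ?_⟩
  have hDi : ‖sliceLin i‖ₑ ≤ D := by
    rw [enorm_eq_nnnorm]
    exact_mod_cast Finset.single_le_sum (f := fun i => ‖sliceLin i‖₊) (fun _ _ => zero_le)
      (Finset.mem_univ i)
  have hfm : Measurable fun x => ‖fderiv ℝ v x‖ₑ ^ p :=
    (hv.continuous_fderiv (by simp)).measurable.enorm.pow_const p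
  have hfd : ∀ t y, HasFDerivAt (fun y => v (slicePt i t y))
      ((fderiv ℝ v (slicePt i t y)).comp (sliceLin i)) y := fun t y => by
    have h1 : HasFDerivAt (slicePt i t) (sliceLin i) y := by
      have : slicePt i t = fun y => slicePt i t 0 + sliceLin i y := funext (slicePt_eq i t)
      rw [this]
      exact (sliceLin i).hasFDerivAt.const_add _
    exact ((hv.differentiable (by simp)) _).hasFDerivAt.comp y h1
  have key : ∀ t, (∫⁻ y, ‖v (slicePt i t y)‖ₑ ^ q) ^ (p / q)
      ≤ (C ^ p * D ^ p : ℝ≥0) * ENNReal.ofReal r ^ (p * (1 + N / q - N / p))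
        * ∫⁻ y, ‖fderiv ℝ v (slicePt i t y)‖ₑ ^ p := by
    intro t
    have hs : ContDiff ℝ 1 (fun y => v (slicePt i t y)) := by
      have : slicePt i t = fun y => slicePt i t 0 + sliceLin i y := funext (slicePt_eq i t)
      rw [this]
      exact hv.comp (contDiff_const.add (sliceLin i).contDiff)
    have h1 := hC (fun j => x₀ (i.succAbove j)) r hr _ hs (fun y hy => hvs _ fun hcon => hy (by
      rw [mem_closedBall, dist_pi_le_iff hr.le]
      intro j
      simpa [Real.dist_eq] using hcon (i.succAbove j)))
    have h2 := ENNReal.rpow_le_rpow h1 hp0.le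
    rw [← ENNReal.rpow_mul, one_div_mul_eq_div, ENNReal.mul_rpow_of_nonneg _ _ hp0.le,
      ENNReal.mul_rpow_of_nonneg _ _ hp0.le, ← ENNReal.rpow_mul, ← ENNReal.rpow_mul,
      one_div_mul_cancel hp0.ne', ENNReal.rpow_one] at h2
    refine h2.trans ?_
    have h3 : ∫⁻ y, ‖fderiv ℝ (fun y => v (slicePt i t y)) y‖ₑ ^ p
        ≤ D ^ p * ∫⁻ y, ‖fderiv ℝ v (slicePt i t y)‖ₑ ^ p := by
      rw [← lintegral_const_mul' _ _ (by finiteness)]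
      refine lintegral_mono fun y => ?_
      rw [(hfd t y).fderiv, ← ENNReal.mul_rpow_of_nonneg _ _ hp0.le]
      gcongr
      refine (ContinuousLinearMap.opENorm_comp_le _ _).trans ?_
      rw [mul_comm]
      gcongr
    calc _ ≤ _ := mul_le_mul_right h3 _
      _ = _ := by
        rw [ENNReal.coe_mul, ENNReal.coe_rpow_of_nonneg _ hp0.le,
          ENNReal.coe_rpow_of_nonneg _ hp0.le, mul_comm (1 + _ - _ : ℝ) p]
        ring
  calc _ ≤ ∫⁻ t, (C ^ p * D ^ p : ℝ≥0) * ENNReal.ofReal r ^ (p * (1 + N / q - N / p))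
        * ∫⁻ y, ‖fderiv ℝ v (slicePt i t y)‖ₑ ^ p := lintegral_mono key
    _ = _ := by
      rw [lintegral_const_mul, lintegral_slice i hfm]
      exact (hfm.comp (measurePreserving_slicePt i).measurable).lintegral_prod_right'

lemma exists_slicing (hN : 1 ≤ N) {p q : ℝ} (hp : 1 ≤ p) (hpq : p < q)
    (hε : 1 / p ≤ min (1 / q + 1 / (N : ℝ)) 1) :
    ∃ C : ℝ≥0, ∀ (x₀ : 𝔼 (N + 1)) (r : ℝ), 0 < r → ∀ v dv, IsSobolev (cube x₀ r) v dv → ∀ i,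
      ∫⁻ t, (∫⁻ y, ‖v (slicePt i t y)‖ₑ ^ q) ^ (p / q)
        ≤ C * ENNReal.ofReal r ^ (p * (1 + N / q - N / p)) * ∫⁻ x, ‖dv x‖ₑ ^ p := by
  obtain ⟨C, hC⟩ := exists_slicing_smooth hN hp hpq hε
  have hp0 : 0 < p := by linarith
  have hq0 : 0 < q := by linarith
  have hN0 : (0 : ℝ) < N := by exact_mod_cast hN
  set e : ℝ := p * (1 + N / q - N / p) with he
  have he0 : 0 ≤ e := by
    refine mul_nonneg hp0.le ?_
    have := hε.trans (min_le_left _ _)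
    have h2 := mul_le_mul_of_nonneg_left this hN0.le
    rw [mul_add, mul_one_div_cancel hN0.ne', mul_one_div, mul_one_div] at h2
    linarith
  refine ⟨C * 2 ^ e, fun x₀ r hr v dv hv i => ?_⟩
  set B := C * ENNReal.ofReal (2 * r) ^ e * ∫⁻ x, ‖dv x‖ₑ ^ p with hB
  have hsm : ∀ᶠ m : ℕ in atTop,
      ∫⁻ t, (∫⁻ y, ‖moll m v (slicePt i t y)‖ₑ ^ q) ^ (p / q) ≤ B := by
    have h1 : ∀ᶠ m : ℕ in atTop, 1 / ((m : ℝ) + 1) < r :=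
      (tendsto_one_div_add_atTop_nhds_zero_nat (𝕜 := ℝ)).eventually (gt_mem_nhds hr)
    filter_upwards [h1] with m hm
    refine (hC x₀ (2 * r) (by positivity) (moll m v)
      ((hv.contDiff_moll m).of_le (by exact_mod_cast le_top)) (fun x hx => ?_) i).trans ?_
    · refine moll_eq_zero fun y hy => hv.eq_zero y fun hcon => hx fun j => ?_
      have h2 := abs_apply_le_norm (y - x) j
      rw [← dist_eq_norm, PiLp.sub_apply] at h2
      have h3 := hcon j
      have h4 : x j - x₀ j = (y j - x₀ j) - (y j - x j) := by ring
      rw [h4]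
      refine (abs_sub _ _).trans ?_
      linarith
    · rw [hB]
      refine mul_le_mul_right ?_ _
      exact hv.lintegral_fderiv_moll_le m hp
  have hθ : Continuous fun a : ℝ≥0∞ => a ^ (p / q) := ENNReal.continuous_rpow_const
  have hmono : Monotone fun a : ℝ≥0∞ => a ^ (p / q) :=
    ENNReal.monotone_rpow_of_nonneg (by positivity)
  have hmm : ∀ m, Measurable fun z : ℝ × (Fin N → ℝ) => ‖moll m v (slicePt i z.1 z.2)‖ₑ ^ q :=
    fun m => ((hv.contDiff_moll m).continuous.measurable.enorm.pow_const q).comp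
      (measurePreserving_slicePt i).measurable
  have hfin : ∫⁻ t, (∫⁻ y, ‖v (slicePt i t y)‖ₑ ^ q) ^ (p / q) ≤ B := by
    calc _ ≤ ∫⁻ t, liminf (fun m => (∫⁻ y, ‖moll m v (slicePt i t y)‖ₑ ^ q) ^ (p / q)) atTop := by
          refine lintegral_mono_ae ?_
          filter_upwards [ae_slice i (ae_tendsto_moll hv.int.locallyIntegrable)] with t ht
          have h1 : ∫⁻ y, ‖v (slicePt i t y)‖ₑ ^ q
              ≤ liminf (fun m => ∫⁻ y, ‖moll m v (slicePt i t y)‖ₑ ^ q) atTop := by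
            refine le_trans (lintegral_mono_ae ?_) (lintegral_liminf_le' fun m =>
              ((hmm m).comp measurable_prodMk_left).aemeasurable)
            filter_upwards [ht] with y hy
            exact (((ENNReal.continuous_rpow_const.tendsto _).comp hy.enorm).liminf_eq).ge
          refine (hmono h1).trans (le_of_eq ?_)
          exact hmono.map_liminf_of_continuousAt _ hθ.continuousAt
      _ ≤ liminf (fun m => ∫⁻ t, (∫⁻ y, ‖moll m v (slicePt i t y)‖ₑ ^ q) ^ (p / q)) atTop :=
          lintegral_liminf_le fun m => ((hmm m).lintegral_prod_right').pow_const _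
      _ ≤ B := liminf_le_of_frequently_le' hsm.frequently
  refine hfin.trans (le_of_eq ?_)
  rw [hB, ENNReal.ofReal_mul zero_le_two, ENNReal.mul_rpow_of_nonneg _ _ he0, ENNReal.coe_mul,
    ENNReal.coe_rpow_of_nonneg _ he0, ENNReal.coe_ofNat, ENNReal.ofReal_ofNat]
  ring

end Slicing

section Cutoff

open Filter

lemma exists_compact_le_of_lintegral_le {M : ℝ → ℝ≥0∞} (hM : Measurable M) {a b θ : ℝ} (hab : a < b)
    (hθ : 0 < θ) {K : ℝ≥0∞} (hK : K ≠ ⊤) (hMK : ∫⁻ t, M t ^ θ ≤ K) :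
    ∃ G ⊆ Icc a b, IsCompact G ∧ ENNReal.ofReal ((b - a) / 4) ≤ volume G ∧
      ∫⁻ t in G, M t ≤ ENNReal.ofReal (b - a) * (2 * K / ENNReal.ofReal (b - a)) ^ (1 / θ) := by
  set l := ENNReal.ofReal (b - a) with hl
  have hba : 0 < b - a := sub_pos.2 hab
  have hl0 : l ≠ 0 := (ENNReal.ofReal_pos.2 hba).ne'
  have hlt : l ≠ ⊤ := ENNReal.ofReal_ne_top
  set c := 2 * K / l with hc
  have hMm : Measurable fun t => M t ^ θ := hM.pow_const θ
  set T := {t | c < M t ^ θ} with hT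
  have hTm : MeasurableSet T := measurableSet_lt measurable_const hMm
  have hTl : volume T ≤ ENNReal.ofReal ((b - a) / 2) := by
    rcases eq_or_ne K 0 with rfl | hK0
    · have h0 : ∫⁻ t, M t ^ θ = 0 := le_antisymm hMK bot_le
      rw [lintegral_eq_zero_iff hMm] at h0
      have : volume T = 0 := by
        refine measure_mono_null (fun t ht => ?_) h0
        simp only [mem_compl_iff]
        intro hcon
        have hcon' : M t ^ θ = 0 := hcon
        rw [hT, mem_ofPred_eq, hcon'] at ht
        exact not_lt_bot ht
      rw [this]; exact bot_le
    · have hc0 : c ≠ 0 := by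
        rw [hc]; exact (ENNReal.div_pos (by simp [hK0]) hlt).ne'
      have hct : c ≠ ⊤ := ENNReal.div_ne_top (ENNReal.mul_ne_top (by simp) hK) hl0
      calc volume T ≤ volume {t | c ≤ M t ^ θ} := measure_mono fun t (ht : c < M t ^ θ) => ht.le
        _ ≤ (∫⁻ t, M t ^ θ) / c := meas_ge_le_lintegral_div hMm.aemeasurable hc0 hct
        _ ≤ K / c := by gcongr
        _ = ENNReal.ofReal ((b - a) / 2) := by
          have hKc : K = l / 2 * c := by
            calc K = (l * l⁻¹) * (2⁻¹ * 2) * K := by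
                  rw [ENNReal.mul_inv_cancel hl0 hlt, ENNReal.inv_mul_cancel (by simp) (by simp)]
                  simp
              _ = _ := by rw [hc]; simp only [div_eq_mul_inv]; ring
          rw [ENNReal.ofReal_div_of_pos two_pos, ENNReal.ofReal_ofNat, ← hl]
          nth_rw 1 [hKc]
          exact ENNReal.mul_div_cancel_right hc0 hct
  have hS : ENNReal.ofReal ((b - a) / 4) < volume (Icc a b \ T) := by
    have h1 : volume (Icc a b) - volume T ≤ volume (Icc a b \ T) := le_measure_sdiff
    refine lt_of_lt_of_le ?_ h1
    rw [Real.volume_Icc]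
    calc ENNReal.ofReal ((b - a) / 4) < ENNReal.ofReal ((b - a) / 2) :=
          (ENNReal.ofReal_lt_ofReal_iff (by positivity)).2 (by linarith)
      _ = ENNReal.ofReal (b - a) - ENNReal.ofReal ((b - a) / 2) := by
          rw [← ENNReal.ofReal_sub _ (by positivity)]; congr 1; ring
      _ ≤ _ := by gcongr
  obtain ⟨G, hGS, hGc, hG⟩ := (measurableSet_Icc.diff hTm).exists_lt_isCompact hS
  refine ⟨G, hGS.trans sdiff_subset, hGc, hG.le, ?_⟩
  calc ∫⁻ t in G, M t ≤ ∫⁻ t in G, c ^ (1 / θ) := by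
        refine setLIntegral_mono' hGc.measurableSet fun t ht => ?_
        have h1 : M t ^ θ ≤ c := not_lt.1 (hGS ht).2
        have h2 := ENNReal.rpow_le_rpow h1 (one_div_pos.2 hθ).le
        rwa [← ENNReal.rpow_mul, mul_one_div_cancel hθ.ne', ENNReal.rpow_one] at h2
    _ = c ^ (1 / θ) * volume G := by simp
    _ ≤ c ^ (1 / θ) * volume (Icc a b) := by
        gcongr; exact hGS.trans sdiff_subset
    _ = _ := by rw [Real.volume_Icc, mul_comm]

lemma exists_profile {G : Set ℝ} {a b c : ℝ} (hGab : G ⊆ Icc a b) (hG : IsCompact G) (hc : 0 < c)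
    (hGc : ENNReal.ofReal c ≤ volume G) :
    ∃ ψ : ℝ → ℝ, LipschitzWith (c⁻¹).toNNReal ψ ∧ (∀ t, 0 ≤ ψ t ∧ ψ t ≤ 1) ∧
      (∀ t ≤ a, ψ t = 0) ∧ (∀ t, b ≤ t → ψ t = 1) ∧ ∀ t ∉ G, ∀ᶠ s in 𝓝 t, ψ s = ψ t := by
  have hGt : volume G ≠ ⊤ := hG.measure_lt_top.ne
  set V := (volume G).toReal with hV
  have hcV : c ≤ V := (ENNReal.ofReal_le_iff_le_toReal hGt).1 hGc
  have hV0 : 0 < V := hc.trans_le hcV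
  have hft : ∀ t, volume (G ∩ Iic t) ≠ ⊤ := fun t => measure_ne_top_of_subset inter_subset_left hGt
  have hdiff : ∀ s t, s ≤ t → (volume (G ∩ Iic t)).toReal - (volume (G ∩ Iic s)).toReal ∈
      Icc 0 (t - s) := by
    intro s t hst
    have hsub : G ∩ Iic s ⊆ G ∩ Iic t := by gcongr
    have h1 : (volume (G ∩ Iic t)).toReal ≤ (volume (G ∩ Iic s)).toReal + (t - s) := by
      have h2 : volume (G ∩ Iic t) ≤ volume (G ∩ Iic s) + ENNReal.ofReal (t - s) := by
        rw [← Real.volume_Ioc]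
        refine (measure_mono fun x hx => ?_).trans (measure_union_le _ _)
        rcases le_or_gt x s with h | h
        · exact Or.inl ⟨hx.1, h⟩
        · exact Or.inr ⟨h, hx.2⟩
      have h3 := ENNReal.toReal_mono (by finiteness [hft s]) h2
      rwa [ENNReal.toReal_add (hft s) ENNReal.ofReal_ne_top,
        ENNReal.toReal_ofReal (sub_nonneg.2 hst)] at h3
    have h2 := ENNReal.toReal_mono (hft t) (measure_mono hsub)
    constructor <;> linarith
  refine ⟨fun t => (volume (G ∩ Iic t)).toReal / V, ?_, fun t => ⟨by positivity, ?_⟩, ?_, ?_, ?_⟩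
  · refine LipschitzWith.of_dist_le_mul fun s t => ?_
    wlog hst : s ≤ t generalizing s t
    · rw [dist_comm, dist_comm s t]; exact this t s (le_of_not_ge hst)
    rw [dist_comm, dist_comm s t, Real.dist_eq, Real.dist_eq, ← sub_div, abs_div, abs_of_pos hV0,
      abs_of_nonneg (hdiff s t hst).1, abs_of_nonneg (sub_nonneg.2 hst),
      Real.coe_toNNReal _ (by positivity), div_eq_inv_mul]
    exact mul_le_mul (inv_anti₀ hc hcV) (hdiff s t hst).2 (hdiff s t hst).1 (by positivity)
  · rw [div_le_one hV0]
    exact ENNReal.toReal_mono hGt (measure_mono inter_subset_left)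
  · intro t ht
    have : volume (G ∩ Iic t) = 0 := by
      refine measure_mono_null (t := {a}) (fun x hx => ?_) (by simp)
      exact le_antisymm (hx.2.trans ht) (hGab hx.1).1
    simp [this]
  · intro t ht
    have : G ∩ Iic t = G := inter_eq_left.2 fun x hx => (hGab hx).2.trans ht
    simp only [this]
    exact div_self hV0.ne'
  · intro t ht
    obtain ⟨ε, hε, hb⟩ := Metric.isOpen_iff.1 hG.isClosed.isOpen_compl t ht
    filter_upwards [ball_mem_nhds t hε] with s hs
    have : G ∩ Iic s = G ∩ Iic t := by
      ext x
      refine and_congr_right fun hx => ?_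
      have hxb : x ∉ ball t ε := fun h => hb h hx
      rw [mem_ball, Real.dist_eq, abs_lt] at hxb hs
      constructor
      · intro (h : x ≤ s)
        by_contra hcon
        rw [mem_Iic, not_le] at hcon
        exact hxb ⟨by linarith, by linarith⟩
      · intro (h : x ≤ t)
        by_contra hcon
        rw [mem_Iic, not_le] at hcon
        exact hxb ⟨by linarith, by linarith⟩
    simp only [this]

lemma exists_two_sided_profile {M : ℝ → ℝ≥0∞} (hM : Measurable M) {c₀ ρ τ θ : ℝ}
    (hρτ : ρ < τ) (hθ : 0 < θ) {K : ℝ≥0∞} (hK : K ≠ ⊤) (hMK : ∫⁻ t, M t ^ θ ≤ K) :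
    ∃ (Ψ : ℝ → ℝ) (G : Set ℝ), MeasurableSet G ∧ LipschitzWith ((τ - ρ) / 4)⁻¹.toNNReal Ψ ∧
      (∀ t, 0 ≤ Ψ t ∧ Ψ t ≤ 1) ∧ (∀ t, |t - c₀| ≤ ρ → Ψ t = 0) ∧ (∀ t, τ ≤ |t - c₀| → Ψ t = 1) ∧
      (∀ t ∉ G, ∀ᶠ s in 𝓝 t, Ψ s = Ψ t) ∧
      ∫⁻ t in G, M t
        ≤ 2 * (ENNReal.ofReal (τ - ρ) * (2 * K / ENNReal.ofReal (τ - ρ)) ^ (1 / θ)) := by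
  have hl : 0 < (τ - ρ) / 4 := by linarith
  obtain ⟨G₁, hG₁s, hG₁c, hG₁, hI₁⟩ := exists_compact_le_of_lintegral_le hM
    (a := c₀ + ρ) (b := c₀ + τ) (by linarith) hθ hK hMK
  obtain ⟨G₂, hG₂s, hG₂c, hG₂, hI₂⟩ := exists_compact_le_of_lintegral_le hM
    (a := c₀ - τ) (b := c₀ - ρ) (by linarith) hθ hK hMK
  rw [show c₀ + τ - (c₀ + ρ) = τ - ρ by ring] at hG₁ hI₁
  rw [show c₀ - ρ - (c₀ - τ) = τ - ρ by ring] at hG₂ hI₂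
  obtain ⟨ψ₁, hl₁, hb₁, hz₁, ho₁, hc₁⟩ := exists_profile hG₁s hG₁c hl hG₁
  obtain ⟨ψ₂, hl₂, hb₂, hz₂, ho₂, hc₂⟩ := exists_profile hG₂s hG₂c hl hG₂
  refine ⟨fun t => max (ψ₁ t) (1 - ψ₂ t), G₁ ∪ G₂,
    hG₁c.measurableSet.union hG₂c.measurableSet, ?_, fun t => ?_, fun t ht => ?_, fun t ht => ?_,
    fun t ht => ?_, ?_⟩
  · simpa using hl₁.max ((LipschitzWith.const (1 : ℝ)).sub hl₂)
  · exact ⟨le_max_of_le_left (hb₁ t).1, max_le (hb₁ t).2 (by linarith [(hb₂ t).1])⟩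
  · rw [abs_le] at ht
    simp only
    rw [hz₁ t (by linarith), ho₂ t (by linarith)]
    simp
  · rcases le_abs.1 ht with h | h
    · simp only
      rw [ho₁ t (by linarith)]
      exact max_eq_left (by linarith [(hb₂ t).1])
    · simp only
      rw [hz₂ t (by linarith)]
      exact (max_eq_right (by linarith [(hb₁ t).2])).trans (by ring)
  · rw [mem_union, not_or] at ht
    filter_upwards [hc₁ t ht.1, hc₂ t ht.2] with s h1 h2
    rw [h1, h2]
  · calc ∫⁻ t in G₁ ∪ G₂, M t ≤ (∫⁻ t in G₁, M t) + ∫⁻ t in G₂, M t :=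
          lintegral_union_le _ _ _
      _ ≤ _ := by rw [two_mul]; exact add_le_add hI₁ hI₂

lemma exists_cutoff_of_slices {N : ℕ} {p q : ℝ} (hp : 0 < p) (hq : 0 < q) (x₀ : 𝔼 (N + 1))
    {ρ τ : ℝ} (hρτ : ρ < τ) {W : 𝔼 (N + 1) → ℝ≥0∞} (hW : Measurable W)
    {K : ℝ≥0∞} (hK : K ≠ ⊤)
    (hWK : ∀ i, ∫⁻ t, (∫⁻ y, W (slicePt i t y) ^ q) ^ (p / q) ≤ K) :
    ∃ ζ : 𝔼 (N + 1) → ℝ, LipschitzWith ((τ - ρ) / 4)⁻¹.toNNReal ζ ∧ (∀ x, 0 ≤ ζ x ∧ ζ x ≤ 1) ∧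
      (∀ x ∈ cube x₀ ρ, ζ x = 1) ∧ tsupport ζ ⊆ cube x₀ τ ∧
      ∫⁻ x, W x ^ q * ‖gradient ζ x‖ₑ ^ q ≤ ENNReal.ofReal ((τ - ρ) / 4)⁻¹ ^ q *
        ((N + 1) * (2 * (ENNReal.ofReal (τ - ρ) * (2 * K / ENNReal.ofReal (τ - ρ)) ^ (q / p)))) := by
  have hWs : ∀ i, Measurable fun z : ℝ × (Fin N → ℝ) => W (slicePt i z.1 z.2) ^ q := fun i =>
    (hW.comp (measurePreserving_slicePt i).measurable).pow_const q
  have hM : ∀ i, Measurable fun t => ∫⁻ y, W (slicePt i t y) ^ q := fun i =>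
    (hWs i).lintegral_prod_right'
  choose Ψ G hGm hΨl hΨb hΨ0 hΨ1 hΨc hΨI using fun i =>
    exists_two_sided_profile (hM i) (c₀ := x₀ i) hρτ (div_pos hp hq) hK (hWK i)
  set B := 2 * (ENNReal.ofReal (τ - ρ) * (2 * K / ENNReal.ofReal (τ - ρ)) ^ (q / p)) with hB
  simp only [one_div_div] at hΨI
  set ζ : 𝔼 (N + 1) → ℝ := fun x => 1 - ‖fun i => Ψ i (x i)‖ with hζ
  have hlip : LipschitzWith ((τ - ρ) / 4)⁻¹.toNNReal ζ := by
    refine LipschitzWith.of_dist_le_mul fun x y => ?_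
    have h1 : dist (ζ x) (ζ y) ≤ dist (fun i => Ψ i (x i)) (fun i => Ψ i (y i)) := by
      rw [hζ, dist_sub_left]
      simpa using lipschitzWith_one_norm.dist_le_mul (fun i => Ψ i (x i)) (fun i => Ψ i (y i))
    refine h1.trans ((dist_pi_le_iff (by positivity)).2 fun i => ?_)
    refine ((hΨl i).dist_le_mul _ _).trans (mul_le_mul_of_nonneg_left ?_ (by positivity))
    rw [Real.dist_eq, dist_eq_norm, ← PiLp.sub_apply]
    exact abs_apply_le_norm _ _
  have hbd : ∀ x, 0 ≤ ζ x ∧ ζ x ≤ 1 := by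
    refine fun x => ⟨sub_nonneg.2 ((pi_norm_le_iff_of_nonneg zero_le_one).2 fun i => ?_),
      sub_le_self _ (norm_nonneg _)⟩
    rw [Real.norm_eq_abs, abs_of_nonneg (hΨb i _).1]
    exact (hΨb i _).2
  have hone : ∀ x ∈ cube x₀ ρ, ζ x = 1 := by
    intro x hx
    have : (fun i => Ψ i (x i)) = 0 := funext fun i => hΨ0 i _ (mem_cube.1 hx i)
    simp [hζ, this]
  have hsupp : tsupport ζ ⊆ cube x₀ τ := by
    refine closure_minimal (fun x hx => ?_) isClosed_cube
    by_contra hcon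
    rw [mem_cube] at hcon
    push Not at hcon
    obtain ⟨i, hi⟩ := hcon
    refine hx (le_antisymm (sub_nonpos.2 ?_) (hbd x).1)
    calc (1 : ℝ) = ‖Ψ i (x i)‖ := by rw [hΨ1 i _ hi.le]; simp
      _ ≤ _ := norm_le_pi_norm (fun i => Ψ i (x i)) i
  refine ⟨ζ, hlip, hbd, hone, hsupp, ?_⟩
  have hgrad0 : ∀ x : 𝔼 (N + 1), (∀ i, x i ∉ G i) → gradient ζ x = 0 := by
    intro x hx
    have hev : ζ =ᶠ[𝓝 x] fun _ => ζ x := by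
      have h1 : ∀ᶠ y : 𝔼 (N + 1) in 𝓝 x, ∀ i, Ψ i (y i) = Ψ i (x i) := by
        refine eventually_all.2 fun i => ?_
        have hc : ContinuousAt (fun y : 𝔼 (N + 1) => y i) x := by fun_prop
        exact hc.eventually (hΨc i _ (hx i))
      filter_upwards [h1] with y hy
      simp [hζ, hy]
    rw [← norm_eq_zero, norm_gradient, hev.fderiv_eq]
    simp
  have hpt : ∀ x, W x ^ q * ‖gradient ζ x‖ₑ ^ q ≤ ENNReal.ofReal ((τ - ρ) / 4)⁻¹ ^ q *
      ∑ i, (G i).indicator (fun _ => W x ^ q) (x i) := by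
    intro x
    by_cases hx : ∀ i, x i ∉ G i
    · rw [hgrad0 x hx]
      simp [hq]
    · push Not at hx
      obtain ⟨i, hi⟩ := hx
      rw [mul_comm]
      refine mul_le_mul' (ENNReal.rpow_le_rpow ?_ hq.le) ?_
      · rw [← ofReal_norm]
        refine ENNReal.ofReal_le_ofReal ((norm_gradient_le hlip x).trans ?_)
        rw [Real.coe_toNNReal _ (inv_nonneg.2 (by linarith))]
      · calc W x ^ q = (G i).indicator (fun _ => W x ^ q) (x i) := by rw [indicator_of_mem hi]
          _ ≤ _ := Finset.single_le_sum (f := fun i => (G i).indicator (fun _ => W x ^ q) (x i))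
            (fun _ _ => bot_le) (Finset.mem_univ i)
  have hmeas : ∀ i, Measurable fun x : 𝔼 (N + 1) => (G i).indicator (fun _ => W x ^ q) (x i) := by
    intro i
    have : (fun x : 𝔼 (N + 1) => (G i).indicator (fun _ => W x ^ q) (x i))
        = ((fun x : 𝔼 (N + 1) => x i) ⁻¹' G i).indicator fun x => W x ^ q := rfl
    rw [this]
    refine (hW.pow_const q).indicator ((hGm i).preimage (by fun_prop))
  have hsl : ∀ i, ∫⁻ x : 𝔼 (N + 1), (G i).indicator (fun _ => W x ^ q) (x i) ≤ B := by
    intro i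
    rw [lintegral_slice i (hmeas i)]
    refine le_trans (le_of_eq ?_) (hΨI i)
    rw [← lintegral_indicator (hGm i)]
    congr 1
    ext t
    by_cases ht : t ∈ G i <;> simp [ht]
  calc _ ≤ ∫⁻ x : 𝔼 (N + 1), ENNReal.ofReal ((τ - ρ) / 4)⁻¹ ^ q *
      ∑ i, (G i).indicator (fun _ => W x ^ q) (x i) := lintegral_mono hpt
    _ = ENNReal.ofReal ((τ - ρ) / 4)⁻¹ ^ q *
        ∑ i, ∫⁻ x : 𝔼 (N + 1), (G i).indicator (fun _ => W x ^ q) (x i) := by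
      rw [lintegral_const_mul _ (Finset.measurable_sum _ fun i _ => hmeas i),
        lintegral_finsetSum _ fun i _ => hmeas i]
    _ ≤ ENNReal.ofReal ((τ - ρ) / 4)⁻¹ ^ q * ∑ i : Fin (N + 1), B :=
      mul_le_mul_right (Finset.sum_le_sum fun i _ => hsl i) _
    _ = _ := by simp

end Cutoff

section Cut

open Filter
variable {n N : ℕ}

lemma exists_linear_cutoff (x₀ : 𝔼 n) {τ σ : ℝ} (hτ : 0 ≤ τ) (hτσ : τ < σ) :
    ∃ χ : 𝔼 n → ℝ, LipschitzWith (σ - τ)⁻¹.toNNReal χ ∧ (∀ x, 0 ≤ χ x ∧ χ x ≤ 1) ∧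
      (∀ x ∈ cube x₀ τ, χ x = 1) ∧ tsupport χ ⊆ cube x₀ σ := by
  have hd : 0 < σ - τ := sub_pos.2 hτσ
  have hlip : LipschitzWith (σ - τ)⁻¹.toNNReal
      fun x : 𝔼 n => (σ - ‖WithLp.ofLp (x - x₀)‖) * (σ - τ)⁻¹ := by
    refine LipschitzWith.of_dist_le_mul fun x y => ?_
    rw [Real.dist_eq, ← sub_mul, abs_mul, abs_of_pos (inv_pos.2 hd),
      Real.coe_toNNReal _ (inv_pos.2 hd).le, mul_comm]
    refine mul_le_mul_of_nonneg_left ?_ (inv_pos.2 hd).le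
    rw [sub_sub_sub_cancel_left, abs_sub_comm]
    refine (abs_norm_sub_norm_le _ _).trans ?_
    rw [dist_eq_norm]
    refine (pi_norm_le_iff_of_nonneg (norm_nonneg _)).2 fun i => ?_
    simpa using abs_apply_le_norm (x - y) i
  refine ⟨fun x => max (min ((σ - ‖WithLp.ofLp (x - x₀)‖) * (σ - τ)⁻¹) 1) 0,
    (hlip.min_const 1).max_const 0, fun x => ⟨le_max_right _ _, max_le (min_le_right _ _) zero_le_one⟩,
    fun x hx => ?_, closure_minimal (fun x hx => ?_) isClosed_cube⟩
  · have h1 : ‖WithLp.ofLp (x - x₀)‖ ≤ τ := (pi_norm_le_iff_of_nonneg hτ).2 fun i => by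
      simpa using mem_cube.1 hx i
    have h2 : 1 ≤ (σ - ‖WithLp.ofLp (x - x₀)‖) * (σ - τ)⁻¹ := by
      rw [← div_eq_mul_inv, le_div_iff₀ hd]; linarith
    simp only
    rw [min_eq_right h2, max_eq_left zero_le_one]
  · by_contra hcon
    rw [mem_cube] at hcon
    push Not at hcon
    obtain ⟨i, hi⟩ := hcon
    refine hx (max_eq_right ((min_le_left _ _).trans ?_))
    refine mul_nonpos_of_nonpos_of_nonneg (sub_nonpos.2 (hi.le.trans ?_)) (inv_pos.2 hd).le
    simpa using norm_le_pi_norm (WithLp.ofLp (x - x₀)) i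

lemma IsSobolev.mono {K K' : Set (𝔼 n)} {v : 𝔼 n → ℝ} {dv : 𝔼 n → 𝔼 n} (h : IsSobolev K v dv)
    (hKK : K ⊆ K') : IsSobolev K' v dv where
  int := h.int
  dint := h.dint
  weak := h.weak
  eq_zero x hx := h.eq_zero x fun hx' => hx (hKK hx')
  deq_zero x hx := h.deq_zero x fun hx' => hx (hKK hx')

/-- The density `χ_{u > k} |∇u|^p + c (u - k)_+^p`. -/
def truncDens (p : ℝ) (c : ℝ≥0∞) (u : 𝔼 n → ℝ) (du : 𝔼 n → 𝔼 n) (k : ℝ) (x : 𝔼 n) : ℝ≥0∞ :=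
  (if k < u x then ‖du x‖ₑ ^ p else 0) + c * ENNReal.ofReal (u x - k) ^ p

lemma measurable_truncDens {p : ℝ} {c : ℝ≥0∞} {u : 𝔼 n → ℝ} {du : 𝔼 n → 𝔼 n} {k : ℝ}
    (hu : Measurable u) (hdu : Measurable du) : Measurable (truncDens p c u du k) :=
  (Measurable.ite (measurableSet_lt measurable_const hu) (hdu.enorm.pow_const p)
    measurable_const).add (((hu.sub_const k).ennreal_ofReal.pow_const p).const_mul c)

lemma enorm_truncGrad_rpow_le {p : ℝ} (hp : 1 ≤ p) {η u : 𝔼 n → ℝ} {du : 𝔼 n → 𝔼 n} {C : ℝ≥0}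
    (hη : LipschitzWith C η) (hη1 : ∀ x, 0 ≤ η x ∧ η x ≤ 1) (k : ℝ) (x : 𝔼 n) :
    ‖truncGrad η u du k x‖ₑ ^ p ≤ 2 ^ p * truncDens p (C ^ p) u du k x := by
  have hp0 : 0 ≤ p := by linarith
  have h1 : ‖truncGrad η u du k x‖ₑ
      ≤ (if k < u x then ‖du x‖ₑ else 0) + C * ENNReal.ofReal (u x - k) := by
    rw [← ofReal_norm]
    refine (ENNReal.ofReal_le_ofReal (norm_truncGrad_le hη hη1 k x)).trans ?_
    rw [add_comm, mul_comm]
    refine ENNReal.ofReal_add_le.trans (add_le_add ?_ ?_)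
    · split_ifs <;> simp
    · rw [ENNReal.ofReal_mul (NNReal.coe_nonneg C), ENNReal.ofReal_max]
      simp
  calc _ ≤ ((if k < u x then ‖du x‖ₑ else 0) + C * ENNReal.ofReal (u x - k)) ^ p :=
        ENNReal.rpow_le_rpow h1 hp0
    _ ≤ 2 ^ (p - 1) * ((if k < u x then ‖du x‖ₑ else 0) ^ p + (C * ENNReal.ofReal (u x - k)) ^ p) :=
      ENNReal.rpow_add_le_mul_rpow_add_rpow _ _ hp
    _ ≤ 2 ^ p * truncDens p (C ^ p) u du k x := by
      refine mul_le_mul' (ENNReal.rpow_le_rpow_of_exponent_le one_le_two (by linarith)) ?_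
      rw [truncDens, ENNReal.mul_rpow_of_nonneg _ _ hp0]
      refine add_le_add ?_ le_rfl
      split_ifs
      · rfl
      · rw [ENNReal.zero_rpow_of_pos (by linarith)]

lemma exists_cutoff (hN : 1 ≤ N) {p q : ℝ} (hp : 1 ≤ p) (hpq : p < q)
    (hε : 1 / p ≤ min (1 / q + 1 / (N : ℝ)) 1) :
    ∃ C : ℝ≥0, ∀ {Ω : Set (𝔼 (N + 1))} {u : 𝔼 (N + 1) → ℝ} {du : 𝔼 (N + 1) → 𝔼 (N + 1)},
      IsOpen Ω → IsWeakGradOn (N + 1) Ω u du → LocallyIntegrableOn u Ω → LocallyIntegrableOn du Ω →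
      Measurable u → Measurable du →
      ∀ {x₀ : 𝔼 (N + 1)} {ρ σ : ℝ}, 0 < ρ → ρ < σ → cube x₀ σ ⊆ Ω → ∀ {k : ℝ},
      ∫⁻ x in cube x₀ σ, truncDens p (ENNReal.ofReal (σ - ρ)⁻¹ ^ p) u du k x ≠ ⊤ →
      ∃ (ζ : 𝔼 (N + 1) → ℝ) (C' : ℝ≥0), LipschitzWith C' ζ ∧ (∀ x, 0 ≤ ζ x ∧ ζ x ≤ 1) ∧
        (∀ x ∈ cube x₀ ρ, ζ x = 1) ∧ tsupport ζ ⊆ cube x₀ σ ∧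
        ∫⁻ x, ENNReal.ofReal (u x - k) ^ q * ‖gradient ζ x‖ₑ ^ q ≤
          C * ENNReal.ofReal (σ - ρ) ^ (1 - q - q / p) *
          (ENNReal.ofReal σ ^ (p * (1 + N / q - N / p)) *
            ∫⁻ x in cube x₀ σ, truncDens p (ENNReal.ofReal (σ - ρ)⁻¹ ^ p) u du k x) ^ (q / p) := by
  obtain ⟨Cs, hCs⟩ := exists_slicing hN hp hpq hε
  have hp0 : 0 < p := by linarith
  have hq0 : 0 < q := by linarith
  have hqp : 0 ≤ q / p := by positivity
  refine ⟨8 ^ q * (N + 1) * (4 * Cs * 4 ^ p) ^ (q / p), ?_⟩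
  intro Ω u du hΩ hw hi hdi hum hdum x₀ ρ σ hρ hρσ hcube k hfin
  set S := ENNReal.ofReal σ ^ (p * (1 + N / q - N / p)) with hS
  set D := fun x => truncDens p (ENNReal.ofReal (σ - ρ)⁻¹ ^ p) u du k x with hD
  set I := ∫⁻ x in cube x₀ σ, D x with hI
  set τ := (ρ + σ) / 2 with hτ
  have hdpos : 0 < σ - ρ := sub_pos.2 hρσ
  obtain ⟨χ, hχl, hχb, hχ1, hχs⟩ := exists_linear_cutoff x₀
    (show 0 ≤ τ by linarith) (show τ < σ by linarith)
  have hχc : HasCompactSupport χ := isCompact_cube.of_isClosed_subset (isClosed_tsupport _) hχs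
  have hsob := (isSobolev_trunc hi hdi hχl hχc (hχs.trans hcube) k hΩ hw).mono hχs
  have hgrad : ∫⁻ x, ‖truncGrad χ u du k x‖ₑ ^ p ≤ 4 ^ p * I := by
    have hz : ∀ x, x ∉ cube x₀ σ → ‖truncGrad χ u du k x‖ₑ ^ p = 0 := fun x hx => by
      rw [hsob.deq_zero x hx, enorm_zero, ENNReal.zero_rpow_of_pos hp0]
    rw [← setLIntegral_eq_of_support_subset (s := cube x₀ σ) (fun x hx => by
      by_contra h; exact hx (hz x h)), hI,
      ← lintegral_const_mul _ (measurable_truncDens hum hdum)]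
    refine lintegral_mono fun x => (enorm_truncGrad_rpow_le hp hχl hχb k x).trans ?_
    have hc : ((σ - τ)⁻¹.toNNReal : ℝ≥0∞) = 2 * ENNReal.ofReal (σ - ρ)⁻¹ := by
      rw [← ENNReal.ofReal_ofNat 2, ← ENNReal.ofReal_mul zero_le_two]
      change ENNReal.ofReal _ = _
      rw [hτ, show σ - (ρ + σ) / 2 = (σ - ρ) / 2 by ring, inv_div, div_eq_mul_inv]
    rw [hc, show (4 : ℝ≥0∞) = 2 * 2 by norm_num,
      ENNReal.mul_rpow_of_nonneg 2 2 hp0.le, mul_assoc]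
    refine mul_le_mul_right ?_ _
    simp only [truncDens]
    rw [mul_add, ENNReal.mul_rpow_of_nonneg _ _ hp0.le, mul_assoc]
    refine add_le_add (le_mul_of_one_le_left bot_le ?_) le_rfl
    exact ENNReal.one_le_rpow one_le_two hp0
  set K := Cs * S * (4 ^ p * I) with hK
  have hKt : K ≠ ⊤ := by
    have : S ≠ ⊤ := ENNReal.rpow_ne_top_of_ne_zero (by simpa using by linarith) ENNReal.ofReal_ne_top
    have h4 : (4 : ℝ≥0∞) ^ p ≠ ⊤ := ENNReal.rpow_ne_top_of_nonneg hp0.le (by simp)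
    exact ENNReal.mul_ne_top (ENNReal.mul_ne_top (by simp) this) (ENNReal.mul_ne_top h4 hfin)
  have hWm : Measurable fun x => ‖truncFun χ u k x‖ₑ := by
    unfold truncFun
    have := hχl.continuous.measurable
    fun_prop
  obtain ⟨ζ, hζl, hζb, hζ1, hζs, hζI⟩ := exists_cutoff_of_slices hp0 hq0 x₀
    (show ρ < τ by linarith) hWm hKt fun i => (hCs x₀ σ (hρ.trans hρσ) _ _ hsob i).trans
      (mul_le_mul_right hgrad _)
  refine ⟨ζ, _, hζl, hζb, hζ1, hζs.trans (cube_mono (by linarith)), ?_⟩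
  refine (lintegral_mono fun x => ?_).trans (hζI.trans (le_of_eq ?_))
  · by_cases hx : x ∈ cube x₀ τ
    · refine mul_le_mul_left (ENNReal.rpow_le_rpow ?_ hq0.le) _
      simp only [truncFun]
      rw [hχ1 x hx, one_mul, ← ofReal_norm]
      exact ENNReal.ofReal_le_ofReal ((le_max_left _ _).trans (le_abs_self _))
    · rw [gradient_eq_zero_of_notMem_tsupport fun h => hx (hζs h)]
      simp [hq0]
  · set d := ENNReal.ofReal (σ - ρ) with hd
    have hd0 : d ≠ 0 := by simpa [hd] using hρσ
    have hdt : d ≠ ⊤ := ENNReal.ofReal_ne_top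
    have e1 : ENNReal.ofReal ((τ - ρ) / 4)⁻¹ = 8 * d⁻¹ := by
      rw [hd, ← ENNReal.ofReal_inv_of_pos hdpos, ← ENNReal.ofReal_ofNat 8,
        ← ENNReal.ofReal_mul (by norm_num)]
      rw [hτ, show ((ρ + σ) / 2 - ρ) / 4 = (σ - ρ) / 8 by ring, inv_div, div_eq_mul_inv]
    have e2 : ENNReal.ofReal (τ - ρ) = d * 2⁻¹ := by
      rw [hd, ← ENNReal.ofReal_ofNat 2, ← ENNReal.ofReal_inv_of_pos two_pos,
        ← ENNReal.ofReal_mul hdpos.le]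
      congr 1
      rw [hτ]; ring
    have e3 : 2 * K / (d * 2⁻¹) = 4 * Cs * 4 ^ p * (S * I) * d⁻¹ := by
      rw [hK, div_eq_mul_inv, ENNReal.mul_inv (by simp) (by simp), inv_inv]
      ring
    have e4 : d ^ (1 - q - q / p) = d * d⁻¹ ^ q * d⁻¹ ^ (q / p) := by
      rw [sub_eq_add_neg, sub_eq_add_neg, ENNReal.rpow_add _ _ hd0 hdt, ENNReal.rpow_add _ _ hd0 hdt,
        ENNReal.rpow_one, ENNReal.rpow_neg, ENNReal.rpow_neg, ENNReal.inv_rpow, ENNReal.inv_rpow]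
    rw [e1, e2, e3, e4, ENNReal.mul_rpow_of_nonneg _ _ hqp, ENNReal.mul_rpow_of_nonneg _ _ hqp,
      ENNReal.mul_rpow_of_nonneg _ _ hq0.le]
    push_cast
    rw [ENNReal.coe_rpow_of_nonneg _ hq0.le, ENNReal.coe_rpow_of_nonneg _ hqp]
    push_cast
    rw [ENNReal.coe_rpow_of_nonneg _ hp0.le]
    push_cast
    calc _ = 8 ^ q * d⁻¹ ^ q * ((N + 1) * ((2 * 2⁻¹) * d * ((4 * Cs * 4 ^ p) ^ (q / p) *
        (S * I) ^ (q / p) * d⁻¹ ^ (q / p)))) := by ring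
      _ = _ := by
        rw [ENNReal.mul_inv_cancel (by simp) (by simp)]
        ring

end Cut

section QuasiMin

open Filter
variable {n : ℕ}

lemma aemeasurable_caratheodory {X : Type*} [MeasurableSpace X] {ν : Measure X}
    {f : X → 𝔼 n → ℝ} (hm : ∀ z, AEMeasurable (fun x => f x z) ν)
    (hc : ∀ᵐ x ∂ν, Continuous (f x)) {V : X → 𝔼 n} (hV : Measurable V) :
    AEMeasurable (fun x => f x (V x)) ν := by
  have hsimple : ∀ s : SimpleFunc X (𝔼 n), AEMeasurable (fun x => f x (s x)) ν := by
    intro s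
    have h1 : (fun x => f x (s x))
        = fun x => ∑ z ∈ s.range, (s ⁻¹' {z}).indicator (fun x => f x z) x := by
      ext x
      rw [Finset.sum_eq_single (s x)]
      · simp
      · intro z _ hz
        rw [indicator_of_notMem]
        exact fun h => hz h.symm
      · simp
    rw [h1]
    exact Finset.aemeasurable_fun_sum _ fun z _ => (hm z).indicator (s.measurableSet_preimage _)
  have hVs := hV.stronglyMeasurable
  refine aemeasurable_of_tendsto_metrizable_ae atTop (fun j => hsimple (hVs.approx j)) ?_
  filter_upwards [hc] with x hx
  exact (hx.tendsto _).comp (hVs.tendsto_approx x)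

lemma lipschitzWith_pow {Z : 𝔼 n → ℝ} {C : ℝ≥0} (hZ : LipschitzWith C Z)
    (hb : ∀ x, 0 ≤ Z x ∧ Z x ≤ 1) (m : ℕ) : LipschitzWith (m * C) fun x => Z x ^ m := by
  refine LipschitzWith.of_dist_le_mul fun x y => ?_
  rw [Real.dist_eq]
  have h1 : max |Z x| |Z y| ^ (m - 1) ≤ 1 := by
    refine pow_le_one₀ (le_max_of_le_left (abs_nonneg _)) (max_le ?_ ?_) <;>
    rw [abs_of_nonneg (hb _).1] <;> exact (hb _).2
  calc _ ≤ |Z x - Z y| * m * max |Z x| |Z y| ^ (m - 1) := abs_pow_sub_pow_le _ _ _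
    _ ≤ |Z x - Z y| * m * 1 := by gcongr
    _ ≤ C * dist x y * m := by
      rw [mul_one, ← Real.dist_eq]
      gcongr
      exact hZ.dist_le_mul x y
    _ = _ := by push_cast; ring

lemma norm_gradient_pow {Z : 𝔼 n → ℝ} {x : 𝔼 n} (hd : DifferentiableAt ℝ Z x) (hZ : 0 ≤ Z x)
    (m : ℕ) : ‖gradient (fun x => Z x ^ m) x‖ = m * Z x ^ (m - 1) * ‖gradient Z x‖ := by
  rw [norm_gradient, norm_gradient, (hd.hasFDerivAt.pow m).fderiv, norm_smul, Real.norm_of_nonneg]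
  · simp
  · positivity

/-- Measurable data of a quasi-minimizer with the growth condition of the theorem. -/
structure IsData (n : ℕ) (Ω : Set (𝔼 n)) (p q L Q : ℝ) (H : 𝔼 n → ℝ) (f : 𝔼 n → 𝔼 n → ℝ)
    (u : 𝔼 n → ℝ) (du : 𝔼 n → 𝔼 n) : Prop where
  isOpen : IsOpen Ω
  one_le_p : 1 ≤ p
  p_lt_q : p < q
  one_le_L : 1 ≤ L
  one_le_Q : 1 ≤ Q
  H_nonneg : ∀ x, 0 ≤ H x
  H_int : IntegrableOn H Ω
  f_meas : ∀ z, AEMeasurable (fun x => f x z) (volume.restrict Ω)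
  f_cont : ∀ᵐ x ∂volume.restrict Ω, Continuous (f x)
  f_conv : ∀ᵐ x ∂volume.restrict Ω, ConvexOn ℝ univ (f x)
  growth : ∀ᵐ x ∂volume.restrict Ω, ∀ z, ‖z‖ ^ p - H x ≤ f x z ∧ f x z ≤ L * ‖z‖ ^ q + H x
  qmin : IsQMinimizer n Ω f Q u du
  u_meas : Measurable u
  du_meas : Measurable du

/-- The nonnegative energy density of `u`. -/
def energy (H : 𝔼 n → ℝ) (f : 𝔼 n → 𝔼 n → ℝ) (du : 𝔼 n → 𝔼 n) (x : 𝔼 n) : ℝ≥0∞ :=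
  ENNReal.ofReal (f x (du x) + H x)

lemma IsSobolev.isWeakGradOn {K Ω : Set (𝔼 n)} {v : 𝔼 n → ℝ} {dv : 𝔼 n → 𝔼 n}
    (h : IsSobolev K v dv) (hK : K ⊆ Ω) : IsWeakGradOn n Ω v dv := by
  intro φ h1 h2 h3 i
  have := h.weak φ h1 h2 (subset_univ _) i
  rw [setIntegral_univ, setIntegral_univ] at this
  rw [setIntegral_eq_integral_of_forall_compl_eq_zero fun x hx => by
    rw [h.eq_zero x fun h' => hx (hK h'), zero_mul],
    setIntegral_eq_integral_of_forall_compl_eq_zero fun x hx => by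
    rw [h.deq_zero x fun h' => hx (hK h')]; simp]
  exact this

/-- Convexity and growth bound the energy density of the competitor `u - η (u - k)_+`. -/
lemma competitor_le {p q L H : ℝ} (hL : 0 ≤ L) {F : 𝔼 n → ℝ} (hF : ConvexOn ℝ univ F)
    (hg : ∀ z, ‖z‖ ^ p - H ≤ F z ∧ F z ≤ L * ‖z‖ ^ q + H) (hH : 0 ≤ H) {m : ℕ} (hm : q ≤ m)
    (hm1 : 2 ≤ m) {Z : ℝ} (hZ : 0 ≤ Z ∧ Z ≤ 1) {w a : ℝ} (hw : 0 ≤ w) (ha : 0 ≤ a) {b e : 𝔼 n}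
    (he : ‖e‖ = m * Z ^ (m - 1) * a) :
    F (b + -(w • e + Z ^ m • b)) + H
      ≤ (1 - Z ^ m) * (F b + H) + (L * m ^ q * (w ^ q * a ^ q) + 2 * H) := by
  have hm0 : (0 : ℝ) ≤ m := by positivity
  have hη1 : Z ^ m ≤ 1 := pow_le_one₀ hZ.1 hZ.2
  have hR : 0 ≤ L * m ^ q * (w ^ q * a ^ q) := by positivity
  rcases hZ.1.eq_or_lt with h0 | h0
  · have : e = 0 := by
      rw [← norm_eq_zero, he, ← h0, zero_pow (by omega)]; simp
    rw [this, ← h0, zero_pow (by omega)]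
    simp only [smul_zero, zero_smul, add_zero, neg_zero, sub_zero, one_mul]
    linarith
  have hη0 : 0 < Z ^ m := by positivity
  set z := -((Z ^ m)⁻¹ * w) • e with hz
  have hcomb : b + -(w • e + Z ^ m • b) = (1 - Z ^ m) • b + Z ^ m • z := by
    rw [hz, smul_smul, mul_neg, ← mul_assoc, mul_inv_cancel₀ hη0.ne', one_mul, sub_smul, one_smul,
      neg_smul]
    abel
  have hconv := hF.2 (mem_univ b) (mem_univ z) (sub_nonneg.2 hη1) hη0.le (by ring)
  rw [← hcomb] at hconv
  simp only [smul_eq_mul] at hconv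
  have hzn : ‖z‖ = Z⁻¹ * (m * (w * a)) := by
    rw [hz, norm_smul, norm_neg, Real.norm_of_nonneg (by positivity), he]
    have : Z ^ m = Z ^ (m - 1) * Z := by rw [← pow_succ]; congr 1; omega
    rw [this]
    field_simp
  have hkey : Z ^ m * ‖z‖ ^ q ≤ m ^ q * (w ^ q * a ^ q) := by
    rw [hzn, Real.mul_rpow (by positivity) (by positivity), Real.mul_rpow (by positivity) (by positivity),
      Real.mul_rpow hw ha, ← mul_assoc, Real.inv_rpow hZ.1, ← Real.rpow_natCast, ← div_eq_mul_inv,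
      ← Real.rpow_sub h0]
    exact mul_le_of_le_one_left (by positivity) (Real.rpow_le_one hZ.1 hZ.2 (by linarith))
  have h2 := mul_le_mul_of_nonneg_left (hg z).2 hη0.le
  have h3 := mul_le_mul_of_nonneg_left hkey hL
  have h4 : Z ^ m * H ≤ H := mul_le_of_le_one_left hH hη1
  nlinarith

namespace IsData

variable {Ω : Set (𝔼 n)} {p q L Q : ℝ} {H : 𝔼 n → ℝ} {f : 𝔼 n → 𝔼 n → ℝ} {u : 𝔼 n → ℝ}
  {du : 𝔼 n → 𝔼 n}

lemma aemeasurable (D : IsData n Ω p q L Q H f u du) {V : 𝔼 n → 𝔼 n} (hV : Measurable V) :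
    AEMeasurable (fun x => f x (V x)) (volume.restrict Ω) :=
  aemeasurable_caratheodory D.f_meas D.f_cont hV

lemma enorm_rpow_le_energy (D : IsData n Ω p q L Q H f u du) :
    ∀ᵐ x ∂volume.restrict Ω, ‖du x‖ₑ ^ p ≤ energy H f du x := by
  filter_upwards [D.growth] with x hx
  rw [energy, ← ofReal_norm, ENNReal.ofReal_rpow_of_nonneg (norm_nonneg _) (by linarith [D.one_le_p])]
  exact ENNReal.ofReal_le_ofReal (by linarith [(hx (du x)).1])

lemma aemeasurable_energy (D : IsData n Ω p q L Q H f u du) :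
    AEMeasurable (energy H f du) (volume.restrict Ω) :=
  ((D.aemeasurable D.du_meas).add D.H_int.aemeasurable).ennreal_ofReal

lemma isSobolev_one {η : 𝔼 n → ℝ} {C : ℝ≥0} (hη : LipschitzWith C η) (hηc : HasCompactSupport η) :
    IsSobolev (tsupport η) (truncFun η (fun _ => 1) 0) (truncGrad η (fun _ => 1) (fun _ => 0) 0) := by
  refine isSobolev_trunc (Ω := univ) (continuous_const.locallyIntegrable.locallyIntegrableOn _)
    (continuous_const.locallyIntegrable.locallyIntegrableOn _) hη hηc (subset_univ _) 0 isOpen_univ ?_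
  intro φ h1 h2 _ i
  simp [integral_fderiv_eq_zero h1 h2]

lemma lintegral_energy_lt_top (D : IsData n Ω p q L Q H f u du) {K : Set (𝔼 n)} (hK : IsCompact K)
    (hKΩ : K ⊆ Ω) : ∫⁻ x in K, energy H f du x < ⊤ := by
  obtain ⟨η, C, hη, hηc, hηΩ, hη1, -⟩ := exists_lipschitz_cutoff D.isOpen hK hKΩ
  have hs := isSobolev_one hη hηc
  have htr : truncFun η (fun _ => 1) 0 = η := by ext x; simp [truncFun]
  rw [htr] at hs
  have h := (D.qmin.2.2.2 _ _ (hs.isWeakGradOn hηΩ) hs.int.integrableOn hs.dint.integrableOn hηc hηΩ).1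
  have hKs : K ⊆ tsupport η := fun x hx => subset_tsupport _ (by simp [hη1 x hx])
  exact ((h.mono_set hKs).add (D.H_int.mono_set hKΩ)).lintegral_lt_top

lemma quasimin_ineq (D : IsData n Ω p q L Q H f u du) {m : ℕ} (hm : q ≤ m) (hm1 : 2 ≤ m)
    {Z : 𝔼 n → ℝ} {C : ℝ≥0} (hZ : LipschitzWith C Z) (hZb : ∀ x, 0 ≤ Z x ∧ Z x ≤ 1)
    (hZc : HasCompactSupport Z) (hZΩ : tsupport Z ⊆ Ω) (k : ℝ)
    (hfin : ∫⁻ x, ENNReal.ofReal (u x - k) ^ q * ‖gradient Z x‖ₑ ^ q ≠ ⊤) :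
    ∫⁻ x in {x | Z x = 1 ∧ k < u x}, energy H f du x ≤
      ENNReal.ofReal Q * ((∫⁻ x in tsupport Z ∩ {x | u x ≤ k}, energy H f du x) +
        (∫⁻ x in tsupport Z ∩ {x | k < u x ∧ Z x < 1}, energy H f du x) +
        (ENNReal.ofReal (L * m ^ q) * (∫⁻ x, ENNReal.ofReal (u x - k) ^ q * ‖gradient Z x‖ₑ ^ q) +
        2 * ∫⁻ x in tsupport Z ∩ {x | k < u x}, ENNReal.ofReal (H x))) := by
  have hq0 : 0 < q := by linarith [D.one_le_p, D.p_lt_q]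
  have hL0 : 0 ≤ L := by linarith [D.one_le_L]
  have hQ0 : 0 ≤ Q := by linarith [D.one_le_Q]
  set η : 𝔼 n → ℝ := fun x => Z x ^ m with hη
  have hηl : LipschitzWith (m * C) η := lipschitzWith_pow hZ hZb m
  have hsub : tsupport η ⊆ tsupport Z := closure_mono fun x hx h => hx (by
    simp [hη, h, show m ≠ 0 by omega])
  have hηc : HasCompactSupport η := hZc.of_isClosed_subset (isClosed_tsupport _) hsub
  have hs := isSobolev_trunc D.qmin.2.1 D.qmin.2.2.1 hηl hηc (hsub.trans hZΩ) k D.isOpen D.qmin.1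
  set φ := -truncFun η u k with hφ
  set dφ := -truncGrad η u du k with hdφ
  set S := tsupport φ with hS
  have hSη : S ⊆ tsupport η := by
    refine closure_minimal (fun x hx => ?_) (isClosed_tsupport _)
    by_contra h
    exact hx (by simp [hφ, hs.eq_zero x h])
  have hSZ := hSη.trans hsub
  have hSΩ := hSZ.trans hZΩ
  have hSc : IsCompact S := hηc.of_isClosed_subset (isClosed_tsupport _) hSη
  have hSm : MeasurableSet S := (isClosed_tsupport _).measurableSet
  obtain ⟨hfS, hmin⟩ := D.qmin.2.2.2 φ dφ (hs.isWeakGradOn (hsub.trans hZΩ)).neg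
    hs.int.neg.integrableOn hs.dint.neg.integrableOn hSc hSΩ
  have hHS : IntegrableOn H S := D.H_int.mono_set hSΩ
  have hgm := measurable_gradient (n := n)
  have hdφm : Measurable dφ := by
    have := hηl.continuous.measurable
    have := hgm η
    have h1 := D.u_meas
    have h2 := D.du_meas
    refine Measurable.neg (Measurable.add (by fun_prop) (Measurable.fun_smul ?_ h2))
    exact Measurable.ite (measurableSet_lt measurable_const h1) ‹_› measurable_const
  set b : 𝔼 n → ℝ := fun x => f x (du x + dφ x) + H x with hb
  have hres : volume.restrict S ≤ volume.restrict Ω := Measure.restrict_mono hSΩ le_rfl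
  have hbm : AEStronglyMeasurable b (volume.restrict S) :=
    (((D.aemeasurable (D.du_meas.add hdφm)).mono_measure hres).add
      hHS.aemeasurable).aestronglyMeasurable
  have hae : ∀ {P : 𝔼 n → Prop}, (∀ᵐ x ∂volume.restrict Ω, P x) → ∀ᵐ x ∂volume.restrict S, P x :=
    fun h => ae_mono hres h
  have hb0 : 0 ≤ᵐ[volume.restrict S] b := by
    filter_upwards [hae D.growth] with x hx
    have := (hx (du x + dφ x)).1
    have h2 : 0 ≤ ‖du x + dφ x‖ ^ p := by positivity
    simp only [hb, Pi.zero_apply]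
    linarith
  set T := {x | u x ≤ k} ∪ {x | k < u x ∧ Z x < 1} with hT
  have hZm := hZ.continuous.measurable
  have hum := D.u_meas
  have hTm : MeasurableSet T := (measurableSet_le hum measurable_const).union
    ((measurableSet_lt measurable_const hum).inter (measurableSet_lt hZm measurable_const))
  set R : 𝔼 n → ℝ≥0∞ := fun x => ENNReal.ofReal (L * m ^ q) *
    (ENNReal.ofReal (u x - k) ^ q * ‖gradient Z x‖ₑ ^ q) with hR
  have hRm : Measurable R := by
    have := hgm Z
    fun_prop
  set U := {x | k < u x} with hU
  have hUm : MeasurableSet U := measurableSet_lt measurable_const hum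
  have hpt : ∀ᵐ x ∂volume.restrict S, ENNReal.ofReal (b x) ≤ T.indicator (energy H f du) x +
      (R x + 2 * U.indicator (fun x => ENNReal.ofReal (H x)) x) := by
    filter_upwards [hae D.growth, hae D.f_conv, hae (ae_restrict_of_ae hZ.ae_differentiableAt)]
      with x hx hxc hxd
    rcases le_or_gt (u x) k with hk | hk
    · have hd0 : dφ x = 0 := by
        simp [hdφ, truncGrad, max_eq_right (sub_nonpos.2 hk), not_lt.2 hk]
      simp only [hb]
      rw [hd0, add_zero, indicator_of_mem (show x ∈ T from Or.inl hk)]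
      exact le_self_add
    · have hd0 : dφ x = -((u x - k) • gradient η x + η x • du x) := by
        simp [hdφ, truncGrad, max_eq_left (sub_nonneg.2 hk.le), hk]
      have hcl := competitor_le hL0 hxc hx (D.H_nonneg x) hm hm1 (hZb x) (sub_nonneg.2 hk.le)
        (norm_nonneg (gradient Z x)) (b := du x) (norm_gradient_pow hxd (hZb x).1 m)
      rw [indicator_of_mem (show x ∈ U from hk)]
      simp only [hb, hd0]
      refine (ENNReal.ofReal_le_ofReal hcl).trans (ENNReal.ofReal_add_le.trans (add_le_add ?_ ?_))
      · have hF0 : 0 ≤ f x (du x) + H x := by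
          have := (hx (du x)).1
          have h2 : 0 ≤ ‖du x‖ ^ p := by positivity
          linarith
        rcases (hZb x).2.eq_or_lt with h1 | h1
        · rw [h1]; simp
        · rw [indicator_of_mem (show x ∈ T from Or.inr ⟨hk, h1⟩)]
          refine ENNReal.ofReal_le_ofReal (mul_le_of_le_one_left hF0 ?_)
          linarith [pow_nonneg (hZb x).1 m]
      · refine ENNReal.ofReal_add_le.trans (le_of_eq ?_)
        have hw0 := Real.rpow_nonneg (sub_nonneg.2 hk.le) q
        simp only [hR]
        rw [ENNReal.ofReal_mul (show 0 ≤ L * m ^ q by positivity), ENNReal.ofReal_mul hw0, ENNReal.ofReal_mul zero_le_two,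
          ← ENNReal.ofReal_rpow_of_nonneg (sub_nonneg.2 hk.le) hq0.le,
          ← ENNReal.ofReal_rpow_of_nonneg (norm_nonneg _) hq0.le, ofReal_norm,
          ENNReal.ofReal_ofNat]
  have hHm : AEMeasurable (fun x => ENNReal.ofReal (H x)) (volume.restrict Ω) :=
    D.H_int.aemeasurable.ennreal_ofReal
  have hint : ∫⁻ x in S, ENNReal.ofReal (b x) ≤
      (∫⁻ x in tsupport Z ∩ {x | u x ≤ k}, energy H f du x) +
        (∫⁻ x in tsupport Z ∩ {x | k < u x ∧ Z x < 1}, energy H f du x) +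
        (ENNReal.ofReal (L * m ^ q) * (∫⁻ x, ENNReal.ofReal (u x - k) ^ q * ‖gradient Z x‖ₑ ^ q) +
        2 * ∫⁻ x in tsupport Z ∩ {x | k < u x}, ENNReal.ofReal (H x)) := by
    refine (lintegral_mono_ae hpt).trans ?_
    rw [lintegral_add_left' ((D.aemeasurable_energy.mono_measure hres).indicator hTm),
      lintegral_add_left hRm, lintegral_const_mul' _ _ ENNReal.ofReal_ne_top,
      lintegral_const_mul' 2 _ (by simp), lintegral_indicator hTm,
      lintegral_indicator hUm, Measure.restrict_restrict hTm, Measure.restrict_restrict hUm]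
    refine add_le_add ?_ (add_le_add ?_ (mul_le_mul_right (lintegral_mono_set ?_) _))
    · rw [hT, union_inter_distrib_right]
      refine (lintegral_union_le _ _ _).trans (add_le_add ?_ ?_) <;>
      exact lintegral_mono_set fun x hx => ⟨hSZ hx.2, hx.1⟩
    · exact mul_le_mul_right (setLIntegral_le_lintegral _ _) _
    · exact fun x hx => ⟨hSZ hx.2, hx.1⟩
  have hEZ := D.lintegral_energy_lt_top hZc hZΩ
  have hfinb : ∫⁻ x in S, ENNReal.ofReal (b x) < ⊤ := by
    refine hint.trans_lt ?_
    have h1 := (lintegral_mono_set (μ := volume) (f := energy H f du)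
      (inter_subset_left : tsupport Z ∩ {x | u x ≤ k} ⊆ _)).trans_lt hEZ
    have h2 := (lintegral_mono_set (μ := volume) (f := energy H f du)
      (inter_subset_left : tsupport Z ∩ {x | k < u x ∧ Z x < 1} ⊆ _)).trans_lt hEZ
    have h3 := (D.H_int.mono_set ((inter_subset_left :
      tsupport Z ∩ {x | k < u x} ⊆ _).trans hZΩ)).lintegral_lt_top
    finiteness
  have hbi : Integrable b (volume.restrict S) :=
    ⟨hbm, (hasFiniteIntegral_iff_ofReal hb0).2 hfinb⟩
  have hfi : IntegrableOn (fun x => f x (du x + dφ x)) S := by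
    have := hbi.sub hHS
    refine this.congr (.of_forall fun x => ?_)
    simp [hb]
  have hmin' := hmin hfi
  have ha0 : 0 ≤ᵐ[volume.restrict S] fun x => f x (du x) + H x := by
    filter_upwards [hae D.growth] with x hx
    have := (hx (du x)).1
    have h2 : 0 ≤ ‖du x‖ ^ p := by positivity
    simp only [Pi.zero_apply]
    linarith
  have hreal : ∫ x in S, (f x (du x) + H x) ≤ Q * ∫ x in S, b x := by
    rw [hb, integral_add hfS hHS, integral_add hfi hHS]
    have : 0 ≤ ∫ x in S, H x := integral_nonneg D.H_nonneg
    nlinarith [D.one_le_Q]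
  have hfinal : ∫⁻ x in S, energy H f du x ≤ ENNReal.ofReal Q * ∫⁻ x in S, ENNReal.ofReal (b x) := by
    rw [← ofReal_integral_eq_lintegral_ofReal hbi hb0, ← ENNReal.ofReal_mul hQ0]
    refine (ofReal_integral_eq_lintegral_ofReal (hfS.add hHS) ha0).ge.trans ?_
    exact ENNReal.ofReal_le_ofReal hreal
  refine (lintegral_mono_set fun x hx => ?_).trans (hfinal.trans (mul_le_mul_right hint _))
  refine subset_tsupport _ ?_
  have h1 : max (u x - k) 0 ≠ 0 := (lt_max_of_lt_left (sub_pos.2 hx.2)).ne'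
  simpa [hφ, truncFun, hη, hx.1] using h1

end IsData

end QuasiMin

section SobolevLevel

open Filter
variable {n : ℕ}

/-- Measurable representatives of a `W^{1,1}_loc` function and its weak gradient. -/
structure IsW11 (n : ℕ) (Ω : Set (𝔼 n)) (u : 𝔼 n → ℝ) (du : 𝔼 n → 𝔼 n) : Prop where
  isOpen : IsOpen Ω
  weak : IsWeakGradOn n Ω u du
  int : LocallyIntegrableOn u Ω
  dint : LocallyIntegrableOn du Ω
  meas : Measurable u
  dmeas : Measurable du

lemma lintegral_truncGrad_le {p : ℝ} (hp : 1 ≤ p) {χ u : 𝔼 n → ℝ} {du : 𝔼 n → 𝔼 n} {C : ℝ≥0}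
    (hu : Measurable u) (hdu : Measurable du) (hχ : LipschitzWith C χ)
    (hχ1 : ∀ x, 0 ≤ χ x ∧ χ x ≤ 1) {K : Set (𝔼 n)} (hK : tsupport χ ⊆ K) (k : ℝ) :
    ∫⁻ x, ‖truncGrad χ u du k x‖ₑ ^ p ≤ 2 ^ p * ∫⁻ x in K, truncDens p (C ^ p) u du k x := by
  have hz : ∀ x, x ∉ K → ‖truncGrad χ u du k x‖ₑ ^ p = 0 := fun x hx => by
    have hx' : x ∉ tsupport χ := fun h => hx (hK h)
    rw [truncGrad, gradient_eq_zero_of_notMem_tsupport hx', image_eq_zero_of_notMem_tsupport hx']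
    simp [show 0 < p by linarith]
  rw [← setLIntegral_eq_of_support_subset (s := K) (fun x hx => by
      by_contra h; exact hx (hz x h)), ← lintegral_const_mul _ (measurable_truncDens hu hdu)]
  exact lintegral_mono fun x => enorm_truncGrad_rpow_le hp hχ hχ1 k x

lemma exists_gns_trunc {p p' : ℝ} (hp : 1 ≤ p) (hpn : p < n) (hp' : 1 / p' = 1 / p - 1 / n) :
    ∃ C : ℝ≥0, ∀ {Ω : Set (𝔼 n)} {u : 𝔼 n → ℝ} {du : 𝔼 n → 𝔼 n}, IsW11 n Ω u du →
      ∀ {x₀ : 𝔼 n} {ρ σ : ℝ}, 0 ≤ ρ → ρ < σ → cube x₀ σ ⊆ Ω → ∀ k : ℝ,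
      (∫⁻ x in cube x₀ ρ, ENNReal.ofReal (u x - k) ^ p') ^ (1 / p') ≤
        C * (∫⁻ x in cube x₀ σ, truncDens p (ENNReal.ofReal (σ - ρ)⁻¹ ^ p) u du k x) ^ (1 / p) := by
  have hp0 : 0 < p := by linarith
  have hp'0 : 0 < p' := by
    have : 0 < 1 / p' := by
      rw [hp', sub_pos]
      exact one_div_lt_one_div_of_lt hp0 hpn
    exact one_div_pos.1 this
  obtain ⟨C, hC⟩ := gns_smooth (volume : Measure (𝔼 n)) hp (by simpa using hpn)
    (p' := p') (by simpa using hp')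
  refine ⟨C * 2, fun {Ω u du} hW {x₀ ρ σ} hρ hρσ hcube k => ?_⟩
  obtain ⟨χ, hχl, hχb, hχ1, hχs⟩ := exists_linear_cutoff x₀ hρ hρσ
  have hχc : HasCompactSupport χ := isCompact_cube.of_isClosed_subset (isClosed_tsupport _) hχs
  have hsob := isSobolev_trunc hW.int hW.dint hχl hχc (hχs.trans hcube) k hW.isOpen hW.weak
  have h1 := hsob.gns hχc hp hp'0 hC
  have h2 := lintegral_truncGrad_le hp hW.meas hW.dmeas hχl hχb hχs k
  calc _ ≤ (∫⁻ x, ‖truncFun χ u k x‖ₑ ^ p') ^ (1 / p') := by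
        refine ENNReal.rpow_le_rpow (le_trans ?_ (setLIntegral_le_lintegral (cube x₀ ρ) _))
          (one_div_pos.2 hp'0).le
        refine setLIntegral_mono' isClosed_cube.measurableSet fun x hx => ?_
        refine ENNReal.rpow_le_rpow ?_ hp'0.le
        rw [truncFun, hχ1 x hx, one_mul, ← ofReal_norm]
        exact ENNReal.ofReal_le_ofReal ((le_max_left _ _).trans (le_abs_self _))
    _ ≤ _ := h1.trans ?_
  calc _ ≤ (C : ℝ≥0∞) * (2 ^ p * ∫⁻ x in cube x₀ σ,
        truncDens p (ENNReal.ofReal (σ - ρ)⁻¹ ^ p) u du k x) ^ (1 / p) :=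
        mul_le_mul_right (ENNReal.rpow_le_rpow h2 (one_div_pos.2 hp0).le) _
    _ = _ := by
      rw [ENNReal.mul_rpow_of_nonneg _ _ (one_div_pos.2 hp0).le, ← ENNReal.rpow_mul,
        mul_one_div_cancel hp0.ne', ENNReal.rpow_one]
      push_cast
      ring

variable {Ω : Set (𝔼 n)} {u : 𝔼 n → ℝ} {du : 𝔼 n → 𝔼 n}

lemma IsW11.measurableSet_level (hW : IsW11 n Ω u du) (k : ℝ) : MeasurableSet {x | k < u x} :=
  measurableSet_lt measurable_const hW.meas

/-- Sobolev and Chebyshev: measure of superlevel sets. -/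
lemma exists_volume_level_le {p p' : ℝ} (hp : 1 ≤ p) (hpn : p < n) (hp'0 : 0 < p')
    (hp' : 1 / p' = 1 / p - 1 / n) :
    ∃ C : ℝ≥0, ∀ {Ω : Set (𝔼 n)} {u : 𝔼 n → ℝ} {du : 𝔼 n → 𝔼 n}, IsW11 n Ω u du →
      ∀ {x₀ : 𝔼 n} {ρ σ : ℝ}, 0 ≤ ρ → ρ < σ → cube x₀ σ ⊆ Ω → ∀ k k' : ℝ,
      volume (cube x₀ ρ ∩ {x | k' < u x}) * ENNReal.ofReal (k' - k) ^ p' ≤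
        C * (∫⁻ x in cube x₀ σ, truncDens p (ENNReal.ofReal (σ - ρ)⁻¹ ^ p) u du k x) ^ (p' / p) := by
  obtain ⟨C, hC⟩ := exists_gns_trunc hp hpn hp'
  refine ⟨C ^ p', fun {Ω u du} hW {x₀ ρ σ} hρ hρσ hcube k k' => ?_⟩
  have h1 := ENNReal.rpow_le_rpow (hC hW hρ hρσ hcube k) hp'0.le
  rw [← ENNReal.rpow_mul, one_div_mul_cancel hp'0.ne', ENNReal.rpow_one,
    ENNReal.mul_rpow_of_nonneg _ _ hp'0.le, ← ENNReal.rpow_mul, one_div_mul_eq_div] at h1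
  rw [ENNReal.coe_rpow_of_nonneg _ hp'0.le]
  refine le_trans ?_ h1
  rw [mul_comm, ← setLIntegral_const]
  refine (setLIntegral_mono' (isClosed_cube.measurableSet.inter (hW.measurableSet_level k'))
    fun x hx => ?_).trans (lintegral_mono_set inter_subset_left)
  exact ENNReal.rpow_le_rpow (ENNReal.ofReal_le_ofReal (by have : k' < u x := hx.2; linarith))
    (by positivity)

/-- Sobolev and Hölder: `L^p` norm of truncations. -/
lemma exists_lintegral_level_le {p : ℝ} (hp : 1 ≤ p) (hpn : p < n) :
    ∃ C : ℝ≥0, ∀ {Ω : Set (𝔼 n)} {u : 𝔼 n → ℝ} {du : 𝔼 n → 𝔼 n}, IsW11 n Ω u du →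
      ∀ {x₀ : 𝔼 n} {ρ σ : ℝ}, 0 ≤ ρ → ρ < σ → cube x₀ σ ⊆ Ω → ∀ k k' : ℝ, k ≤ k' →
      ∫⁻ x in cube x₀ ρ, ENNReal.ofReal (u x - k') ^ p ≤
        C * volume (cube x₀ ρ ∩ {x | k' < u x}) ^ (p / n) *
        ∫⁻ x in cube x₀ σ, truncDens p (ENNReal.ofReal (σ - ρ)⁻¹ ^ p) u du k x := by
  have hp0 : 0 < p := by linarith
  have hn0 : (0 : ℝ) < n := by linarith
  have hinv : 0 < 1 / p - 1 / n := sub_pos.2 (one_div_lt_one_div_of_lt hp0 hpn)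
  set p' : ℝ := 1 / (1 / p - 1 / n) with hp'
  have hp'0 : 0 < p' := by positivity
  have hp'1 : 1 / p' = 1 / p - 1 / n := by rw [hp', one_div_one_div]
  have hpp' : p ≤ p' := by
    rw [← one_div_le_one_div hp'0 hp0, hp'1]
    linarith [one_div_pos.2 hn0]
  obtain ⟨C, hC⟩ := exists_gns_trunc hp hpn hp'1
  refine ⟨C ^ p, fun {Ω u du} hW {x₀ ρ σ} hρ hρσ hcube k k' hkk => ?_⟩
  set I := ∫⁻ x in cube x₀ σ, truncDens p (ENNReal.ofReal (σ - ρ)⁻¹ ^ p) u du k x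
  have hm : Measurable fun x => ENNReal.ofReal (u x - k') := by
    have := hW.meas
    fun_prop
  have h1 := setLIntegral_rpow_le_of_exponent_le (μ := volume.restrict (cube x₀ ρ)) hp0 hpp'
    (S := {x | k' < u x}) hm.aemeasurable (fun x hx => by simpa using hx)
  rw [Measure.restrict_apply (hW.measurableSet_level k'), inter_comm, hp'1, sub_sub_cancel] at h1
  have h2 : (∫⁻ x in cube x₀ ρ, ENNReal.ofReal (u x - k') ^ p') ^ (1 / p') ≤ C * I ^ (1 / p) := by
    refine le_trans (ENNReal.rpow_le_rpow (lintegral_mono fun x => ENNReal.rpow_le_rpow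
      (ENNReal.ofReal_le_ofReal ?_) hp'0.le) (one_div_pos.2 hp'0).le) (hC hW hρ hρσ hcube k)
    linarith
  rw [hp'1] at h2
  have h3 := ENNReal.rpow_le_rpow (h1.trans (mul_le_mul_left h2 _)) hp0.le
  rw [← ENNReal.rpow_mul, one_div_mul_cancel hp0.ne', ENNReal.rpow_one,
    ENNReal.mul_rpow_of_nonneg _ _ hp0.le, ENNReal.mul_rpow_of_nonneg _ _ hp0.le,
    ← ENNReal.rpow_mul, one_div_mul_cancel hp0.ne', ENNReal.rpow_one, ← ENNReal.rpow_mul,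
    one_div_mul_eq_div] at h3
  rw [ENNReal.coe_rpow_of_nonneg _ hp0.le]
  exact h3.trans (le_of_eq (by ring))

end SobolevLevel

section Blowup

open Filter
variable {n : ℕ}

lemma tendsto_zero_of_recursion {A M : ℕ → ℝ≥0∞} {C : ℝ≥0∞} {s : ℝ} (hC : C ≠ ⊤) (hs : 0 < s)
    (hA : Tendsto A atTop (𝓝 0)) (hM : ∀ l, M l ≠ ⊤)
    (h : ∀ l, M (l + 1) ≤ C * A l ^ s * (A l + M l)) : Tendsto M atTop (𝓝 0) := by
  have hθ : Tendsto (fun l => C * A l ^ s) atTop (𝓝 0) := by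
    have := ENNReal.Tendsto.const_mul (hA.ennrpow_const s) (Or.inr hC)
    simpa [hs] using this
  rw [ENNReal.tendsto_nhds_zero]
  intro ε hε
  have hε2 : 0 < ε / 2 := ENNReal.half_pos hε.ne'
  obtain ⟨l₀, hl₀⟩ := eventually_atTop.1 ((ENNReal.tendsto_nhds_zero.1 hA _ hε2).and
    (ENNReal.tendsto_nhds_zero.1 hθ 2⁻¹ (by simp)))
  have hind : ∀ j, M (l₀ + j) ≤ ε / 2 + 2⁻¹ ^ j * M l₀ := by
    intro j
    induction j with
    | zero => simp
    | succ j ih =>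
      obtain ⟨h1, h2⟩ := hl₀ (l₀ + j) (by omega)
      calc M (l₀ + j + 1) ≤ C * A (l₀ + j) ^ s * (A (l₀ + j) + M (l₀ + j)) := h _
        _ ≤ 2⁻¹ * (ε / 2 + (ε / 2 + 2⁻¹ ^ j * M l₀)) :=
          mul_le_mul' h2 (add_le_add h1 ih)
        _ = (2⁻¹ + 2⁻¹) * (ε / 2) + 2⁻¹ ^ (j + 1) * M l₀ := by rw [pow_succ]; ring
        _ = _ := by rw [ENNReal.inv_two_add_inv_two, one_mul]
  have hlim : Tendsto (fun j => 2⁻¹ ^ j * M l₀) atTop (𝓝 0) := by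
    have := ENNReal.Tendsto.mul_const (ENNReal.tendsto_pow_atTop_nhds_zero_of_lt_one
      (r := 2⁻¹) (by simp)) (Or.inr (hM l₀))
    simpa using this
  obtain ⟨j₀, hj₀⟩ := eventually_atTop.1 (ENNReal.tendsto_nhds_zero.1 hlim _ hε2)
  filter_upwards [eventually_ge_atTop (l₀ + j₀)] with l hl
  obtain ⟨j, rfl⟩ := Nat.exists_eq_add_of_le (show l₀ ≤ l by omega)
  calc _ ≤ ε / 2 + ε / 2 := (hind j).trans (add_le_add le_rfl (hj₀ j (by omega)))
    _ = ε := ENNReal.add_halves _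

lemma volume_cube' {x : 𝔼 n} {r : ℝ} (hr : 0 ≤ r) :
    volume (cube x r) = (2 * ENNReal.ofReal r) ^ n := by
  rw [volume_cube hr, ← ENNReal.ofReal_ofNat 2, ← ENNReal.ofReal_mul zero_le_two,
    ENNReal.ofReal_pow (by positivity)]

lemma tendsto_cube_average {g : 𝔼 n → ℝ≥0∞} (hn : 0 < n) (hg : AEMeasurable g) (hgi : ∫⁻ x, g x ≠ ⊤) :
    ∀ᵐ x, g x = 0 → ∀ r : ℕ → ℝ, (∀ l, 0 < r l) → Tendsto r atTop (𝓝 0) →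
      Tendsto (fun l => (∫⁻ y in cube x (r l), g y) / volume (cube x (r l))) atTop (𝓝 0) := by
  have hn0 : (0 : ℝ) < n := by exact_mod_cast hn
  filter_upwards [(IsUnifLocDoublingMeasure.vitaliFamily (volume : Measure (𝔼 n)) 1).ae_tendsto_lintegral_div
    hg hgi] with x hx hgx r hr0 hr
  have h1 := hx.comp (IsUnifLocDoublingMeasure.tendsto_closedBall_filterAt (x := x) (K := 1) volume
    (fun _ => x) (fun l => n * r l) (tendsto_nhdsWithin_iff.2 ⟨by simpa using hr.const_mul (n : ℝ),
      .of_forall fun l => mul_pos hn0 (hr0 l)⟩) (.of_forall fun l => by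
        simpa using (mul_pos hn0 (hr0 l)).le))
  rw [hgx] at h1
  set c : ℝ≥0∞ := (n / 2) ^ n * volume (ball (0 : 𝔼 n) 1) with hc
  have hct : c ≠ ⊤ := ENNReal.mul_ne_top (ENNReal.pow_ne_top (ENNReal.div_ne_top (by simp) (by simp)))
    measure_ball_lt_top.ne
  have h2 := ENNReal.Tendsto.const_mul h1 (Or.inr hct)
  rw [mul_zero] at h2
  refine tendsto_of_tendsto_of_tendsto_of_le_of_le tendsto_const_nhds h2 (fun _ => bot_le) fun l => ?_
  have hb : volume (closedBall x (n * r l)) = c * volume (cube x (r l)) := by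
    rw [Measure.addHaar_closedBall _ _ (mul_pos hn0 (hr0 l)).le, volume_cube' (hr0 l).le,
      ENNReal.ofReal_pow (mul_pos hn0 (hr0 l)).le, ENNReal.ofReal_mul hn0.le, ENNReal.ofReal_natCast,
      finrank_euclideanSpace_fin, hc, mul_right_comm, ← mul_pow, ← mul_assoc,
      ENNReal.div_mul_cancel (by simp) (by simp)]
  have hv0 : volume (cube x (r l)) ≠ 0 := by
    rw [volume_cube' (hr0 l).le]
    simpa using fun h => absurd h (not_le.2 (hr0 l))
  have hvt : volume (cube x (r l)) ≠ ⊤ := isCompact_cube.measure_lt_top.ne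
  have hc0 : c ≠ 0 := by
    intro h
    rw [h, zero_mul] at hb
    exact (measure_closedBall_pos volume x (mul_pos hn0 (hr0 l))).ne' hb
  simp only [Function.comp]
  rw [hb, div_eq_mul_inv, div_eq_mul_inv, ENNReal.mul_inv (Or.inl hc0) (Or.inl hct)]
  calc _ ≤ (∫⁻ y in closedBall x (n * r l), g y) * (volume (cube x (r l)))⁻¹ :=
        mul_le_mul_left (lintegral_mono_set cube_subset_closedBall) _
    _ = (c * c⁻¹) * ((∫⁻ y in closedBall x (n * r l), g y) * (volume (cube x (r l)))⁻¹) := by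
      rw [ENNReal.mul_inv_cancel hc0 hct, one_mul]
    _ = _ := by ring

/-- One dyadic step in the blow-up at a point of density of `{u ≤ k}`. -/
lemma exists_blowup_step {p : ℝ} (hp : 1 ≤ p) (hpn : p < n) :
    ∃ C : ℝ≥0, ∀ {Ω : Set (𝔼 n)} {u : 𝔼 n → ℝ} {du : 𝔼 n → 𝔼 n}, IsW11 n Ω u du →
      ∀ {x : 𝔼 n} {r : ℝ}, 0 < r → cube x (2 * r) ⊆ Ω → ∀ (k : ℝ) (g : 𝔼 n → ℝ≥0∞),
      (∀ y ∈ cube x (2 * r), k < u y → 1 + ‖du y‖ₑ ^ p ≤ g y) →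
      ENNReal.ofReal r⁻¹ ^ p * (∫⁻ y in cube x r, ENNReal.ofReal (u y - k) ^ p) / volume (cube x r) ≤
        C * ((∫⁻ y in cube x (2 * r), g y) / volume (cube x (2 * r))) ^ (p / n) *
        ((∫⁻ y in cube x (2 * r), g y) / volume (cube x (2 * r)) +
          ENNReal.ofReal (2 * r)⁻¹ ^ p * (∫⁻ y in cube x (2 * r), ENNReal.ofReal (u y - k) ^ p) /
            volume (cube x (2 * r))) := by
  have hp0 : 0 < p := by linarith
  have hn0 : (0 : ℝ) < n := by linarith
  obtain ⟨C, hC⟩ := exists_lintegral_level_le hp hpn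
  refine ⟨C * 4 ^ p * 2 ^ p * 2 ^ n, fun {Ω u du} hW {x r} hr hcube k g hg => ?_⟩
  have h1 := hC hW hr.le (show r < 2 * r by linarith) hcube k k le_rfl
  rw [show 2 * r - r = r by ring] at h1
  set b := ENNReal.ofReal r with hb
  have hb0 : b ≠ 0 := by simpa [hb] using hr
  have hbt : b ≠ ⊤ := ENNReal.ofReal_ne_top
  have e1 : ENNReal.ofReal r⁻¹ = b⁻¹ := ENNReal.ofReal_inv_of_pos hr
  have e2 : ENNReal.ofReal (2 * r) = 2 * b := by
    rw [ENNReal.ofReal_mul zero_le_two, ENNReal.ofReal_ofNat]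
  have e3 : ENNReal.ofReal (2 * r)⁻¹ = 2⁻¹ * b⁻¹ := by
    rw [ENNReal.ofReal_inv_of_pos (by linarith), e2, ENNReal.mul_inv (by simp) (by simp)]
  have v1 : volume (cube x r) = 2 ^ n * b ^ n := by rw [volume_cube' hr.le, mul_pow]
  have v2 : volume (cube x (2 * r)) = 2 ^ n * (2 ^ n * b ^ n) := by
    rw [volume_cube' (by linarith), e2, mul_pow, mul_pow]
  set G := ∫⁻ y in cube x (2 * r), g y with hG
  set I := ∫⁻ y in cube x (2 * r), ENNReal.ofReal (u y - k) ^ p with hI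
  set v := 2 ^ n * b ^ n with hv
  have h2t : (2 : ℝ≥0∞) ^ n ≠ ⊤ := by simp
  have h20 : (2 : ℝ≥0∞) ^ n ≠ 0 := by simp
  have hv0 : v ≠ 0 := by simp [hv, hb0]
  have hvt : v ≠ ⊤ := ENNReal.mul_ne_top h2t (ENNReal.pow_ne_top hbt)
  set w := 2 ^ n * v with hw
  have hw0 : w ≠ 0 := mul_ne_zero h20 hv0
  have hwt : w ≠ ⊤ := ENNReal.mul_ne_top h2t hvt
  set A := G / w with hA
  set M := (2⁻¹ * b⁻¹) ^ p * I / w with hM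
  have hGA : G = A * w := (ENNReal.div_mul_cancel hw0 hwt).symm
  have hIM : (2⁻¹ * b⁻¹) ^ p * I = M * w := (ENNReal.div_mul_cancel hw0 hwt).symm
  have hbI : b⁻¹ ^ p * I = 2 ^ p * (M * w) := by
    rw [← hIM, ← mul_assoc, ← ENNReal.mul_rpow_of_nonneg _ _ hp0.le, ← mul_assoc,
      ENNReal.mul_inv_cancel (by simp) (by simp), one_mul]
  have hV : volume (cube x r ∩ {y | k < u y}) ≤ A * w := by
    rw [← hGA, hG, ← setLIntegral_one]
    refine (setLIntegral_mono' (isClosed_cube.measurableSet.inter (hW.measurableSet_level k))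
      fun y hy => ?_).trans (lintegral_mono_set (inter_subset_left.trans (cube_mono (by linarith))))
    exact le_self_add.trans (hg y (cube_mono (by linarith) hy.1) hy.2)
  have hwp : w ^ (p / n) = 4 ^ p * b ^ p := by
    have : w = (4 * b) ^ (n : ℝ) := by
      rw [ENNReal.rpow_natCast, hw, hv, ← mul_assoc, ← mul_pow, ← mul_pow]
      norm_num
    rw [this, ← ENNReal.rpow_mul, mul_div_cancel₀ _ hn0.ne', ENNReal.mul_rpow_of_nonneg _ _ hp0.le]
  have hT : ∫⁻ y in cube x (2 * r), truncDens p (b⁻¹ ^ p) u du k y ≤ 2 ^ p * (w * (A + M)) := by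
    have hsplit : ∫⁻ y in cube x (2 * r), truncDens p (b⁻¹ ^ p) u du k y ≤ G + b⁻¹ ^ p * I := by
      have hm : Measurable fun y => b⁻¹ ^ p * ENNReal.ofReal (u y - k) ^ p := by
        have := hW.meas
        fun_prop
      simp only [truncDens]
      rw [lintegral_add_right _ hm]
      refine add_le_add (setLIntegral_mono' isClosed_cube.measurableSet fun y hy => ?_) (le_of_eq ?_)
      · split_ifs with h
        · exact le_add_self.trans (hg y hy h)
        · exact bot_le
      · refine lintegral_const_mul _ ?_
        have := hW.meas
        fun_prop
    refine hsplit.trans ?_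
    rw [hbI, hGA, mul_add, mul_add, mul_comm A w, mul_comm M w]
    exact add_le_add (le_mul_of_one_le_left bot_le (ENNReal.one_le_rpow one_le_two hp0)) le_rfl
  rw [e1] at h1 ⊢
  rw [e3, v1, v2]
  have h2 : ∫⁻ y in cube x r, ENNReal.ofReal (u y - k) ^ p ≤
      C * (A ^ (p / n) * (4 ^ p * b ^ p)) * (2 ^ p * (w * (A + M))) := by
    refine h1.trans (mul_le_mul' (mul_le_mul_right ?_ _) hT)
    rw [← hwp, ← ENNReal.mul_rpow_of_nonneg _ _ (by positivity)]
    exact ENNReal.rpow_le_rpow hV (by positivity)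
  calc _ ≤ b⁻¹ ^ p * (C * (A ^ (p / n) * (4 ^ p * b ^ p)) * (2 ^ p * (w * (A + M)))) / v :=
        ENNReal.div_le_div_right (mul_le_mul_right h2 _) _
    _ = (b⁻¹ * b) ^ p * (v * v⁻¹) * (C * 4 ^ p * 2 ^ p * 2 ^ n * A ^ (p / n) * (A + M)) := by
      rw [ENNReal.mul_rpow_of_nonneg _ _ hp0.le, hw, div_eq_mul_inv]
      ring
    _ = _ := by
      rw [ENNReal.inv_mul_cancel hb0 hbt, ENNReal.mul_inv_cancel hv0 hvt, ENNReal.one_rpow, one_mul,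
        one_mul]
      push_cast
      rw [ENNReal.coe_rpow_of_nonneg _ hp0.le, ENNReal.coe_rpow_of_nonneg _ hp0.le]
      push_cast
      rfl

end Blowup

section GoodCubes

open Filter
variable {n : ℕ}

lemma setLIntegral_truncDens_le {p : ℝ} {c : ℝ≥0∞} {S : Set (𝔼 n)} {u : 𝔼 n → ℝ} {du : 𝔼 n → 𝔼 n}
    {k : ℝ} {g : 𝔼 n → ℝ≥0∞} (hS : MeasurableSet S) (hu : Measurable u)
    (hg : ∀ y ∈ S, k < u y → ‖du y‖ₑ ^ p ≤ g y) :
    ∫⁻ y in S, truncDens p c u du k y ≤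
      (∫⁻ y in S, g y) + c * ∫⁻ y in S, ENNReal.ofReal (u y - k) ^ p := by
  have hm : Measurable fun y => c * ENNReal.ofReal (u y - k) ^ p := by fun_prop
  simp only [truncDens]
  rw [lintegral_add_right _ hm]
  refine add_le_add (setLIntegral_mono' hS fun y hy => ?_) (le_of_eq ?_)
  · split_ifs with h
    · exact hg y hy h
    · exact bot_le
  · exact lintegral_const_mul _ (by fun_prop)

lemma ae_exists_good_cube {p : ℝ} (hp : 1 ≤ p) (hpn : p < n) {Ω : Set (𝔼 n)} {u : 𝔼 n → ℝ}
    {du : 𝔼 n → 𝔼 n} (hW : IsW11 n Ω u du) {K : Set (𝔼 n)} (hK : IsCompact K) (hKΩ : K ⊆ Ω)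
    (hd : ∫⁻ x in K, ‖du x‖ₑ ^ p ≠ ⊤) (hu : ∫⁻ x in K, ‖u x‖ₑ ^ p ≠ ⊤) (k : ℝ) :
    ∀ᵐ x, x ∈ interior K → u x ≤ k → ∀ ε : ℝ≥0∞, ε ≠ 0 → ∀ R : ℝ, 0 < R →
      ∃ r, 0 < r ∧ r < R ∧ cube x r ⊆ K ∧
        volume (cube x r ∩ {y | k < u y}) ≤ ε * volume (cube x r) ∧
        ∫⁻ y in cube x r, truncDens p (ENNReal.ofReal r⁻¹ ^ p) u du k y ≤ ε * volume (cube x r) := by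
  have hp0 : 0 < p := by linarith
  have hn0 : (0 : ℝ) < n := by linarith
  have hum := hW.meas
  have hdum := hW.dmeas
  set g : 𝔼 n → ℝ≥0∞ := K.indicator fun y => if k < u y then 1 + ‖du y‖ₑ ^ p else 0 with hg
  have hgm : Measurable g := by
    refine Measurable.indicator ?_ hK.measurableSet
    exact Measurable.ite (hW.measurableSet_level k) (by fun_prop) measurable_const
  have hgi : ∫⁻ x, g x ≠ ⊤ := by
    rw [hg, lintegral_indicator hK.measurableSet]
    refine ne_top_of_le_ne_top (b := volume K + ∫⁻ x in K, ‖du x‖ₑ ^ p)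
      (ENNReal.add_ne_top.2 ⟨hK.measure_lt_top.ne, hd⟩) ?_
    rw [← setLIntegral_one, ← lintegral_add_left measurable_const]
    refine lintegral_mono fun y => ?_
    simp only
    split_ifs
    · exact le_rfl
    · exact bot_le
  obtain ⟨C, hC⟩ := exists_blowup_step hp hpn
  filter_upwards [tendsto_cube_average (by exact_mod_cast hn0) hgm.aemeasurable hgi] with x hx hxK hxk
    ε hε R hR
  have hgx : g x = 0 := by simp [hg, not_lt.2 hxk]
  obtain ⟨r₀, hr₀, hball⟩ := Metric.mem_nhds_iff.1 (mem_interior_iff_mem_nhds.1 hxK)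
  set r : ℕ → ℝ := fun l => r₀ / (2 * n) * 2⁻¹ ^ l with hr
  have hrpos : ∀ l, 0 < r l := fun l => by positivity
  have hr2 : ∀ l, 2 * r (l + 1) = r l := fun l => by simp only [hr, pow_succ]; ring
  have hrlim : Tendsto r atTop (𝓝 0) := by
    have := (tendsto_pow_atTop_nhds_zero_of_lt_one (r := (2⁻¹ : ℝ)) (by norm_num)
      (by norm_num)).const_mul (r₀ / (2 * n))
    rwa [mul_zero] at this
  have hcube : ∀ l, cube x (r l) ⊆ K := fun l => by
    refine cube_subset_closedBall.trans ((closedBall_subset_ball ?_).trans hball)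
    have h1 : (2⁻¹ : ℝ) ^ l ≤ 1 := pow_le_one₀ (by norm_num) (by norm_num)
    calc n * r l = r₀ / 2 * 2⁻¹ ^ l := by simp only [hr]; field_simp
      _ ≤ r₀ / 2 * 1 := by gcongr
      _ < r₀ := by linarith
  have hA := hx hgx r hrpos hrlim
  set A : ℕ → ℝ≥0∞ := fun l => (∫⁻ y in cube x (r l), g y) / volume (cube x (r l)) with hAdef
  set M : ℕ → ℝ≥0∞ := fun l => ENNReal.ofReal (r l)⁻¹ ^ p *
    (∫⁻ y in cube x (r l), ENNReal.ofReal (u y - k) ^ p) / volume (cube x (r l)) with hMdef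
  have hv0 : ∀ l, volume (cube x (r l)) ≠ 0 := fun l => by
    rw [volume_cube' (hrpos l).le]
    simpa using fun h => absurd h (not_le.2 (hrpos l))
  have hvt : ∀ l, volume (cube x (r l)) ≠ ⊤ := fun l => isCompact_cube.measure_lt_top.ne
  have huk : ∀ l, ∫⁻ y in cube x (r l), ENNReal.ofReal (u y - k) ^ p ≠ ⊤ := by
    intro l
    refine ne_top_of_le_ne_top (b := ∫⁻ y in K, 2 ^ (p - 1) * (‖u y‖ₑ ^ p + ‖k‖ₑ ^ p)) ?_ ?_
    · rw [lintegral_const_mul _ (by fun_prop), lintegral_add_right _ measurable_const,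
        setLIntegral_const]
      exact ENNReal.mul_ne_top (by simp) (ENNReal.add_ne_top.2 ⟨hu, ENNReal.mul_ne_top
        (by simp [hp0.le]) hK.measure_lt_top.ne⟩)
    · refine (lintegral_mono_set (hcube l)).trans (lintegral_mono fun y => ?_)
      refine (ENNReal.rpow_le_rpow ?_ hp0.le).trans (ENNReal.rpow_add_le_mul_rpow_add_rpow _ _ hp)
      calc ENNReal.ofReal (u y - k) ≤ ‖u y - k‖ₑ := Real.ofReal_le_enorm _
        _ ≤ _ := enorm_sub_le
  have hMlim : Tendsto M atTop (𝓝 0) := by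
    refine tendsto_zero_of_recursion (A := A) (C := C) (s := p / n) (by simp) (by positivity) hA
      (fun l => ENNReal.div_ne_top (ENNReal.mul_ne_top (by simp [hp0.le]) (huk l)) (hv0 l)) fun l => ?_
    have := hC hW (hrpos (l + 1)) (by rw [hr2]; exact (hcube l).trans hKΩ) k g (fun y hy hyk => by
      rw [hr2] at hy
      simp [hg, hcube l hy, hyk])
    rwa [hr2] at this
  have hε2 : 0 < ε / 2 := ENNReal.half_pos hε
  obtain ⟨l, hlA, hlM, hlR⟩ := ((ENNReal.tendsto_nhds_zero.1 hA _ hε2).and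
    ((ENNReal.tendsto_nhds_zero.1 hMlim _ hε2).and (hrlim.eventually (gt_mem_nhds hR)))).exists
  have hlA' : ∫⁻ y in cube x (r l), g y ≤ ε / 2 * volume (cube x (r l)) :=
    (ENNReal.div_le_iff (hv0 l) (hvt l)).1 hlA
  have hlM' := (ENNReal.div_le_iff (hv0 l) (hvt l)).1 hlM
  refine ⟨r l, hrpos l, hlR, hcube l, ?_, ?_⟩
  · refine le_trans ?_ (hlA'.trans (mul_le_mul_left ENNReal.half_le_self _))
    rw [← setLIntegral_one]
    refine (setLIntegral_mono' (isClosed_cube.measurableSet.inter (hW.measurableSet_level k))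
      fun y hy => ?_).trans (lintegral_mono_set inter_subset_left)
    have h1 : y ∈ K := hcube l hy.1
    have h2 : k < u y := hy.2
    simp [hg, h1, h2]
  · refine (setLIntegral_truncDens_le isClosed_cube.measurableSet hum (g := g) fun y hy hyk => ?_).trans ?_
    · simp [hg, hcube l hy, hyk]
    · refine (add_le_add hlA' hlM').trans (le_of_eq ?_)
      rw [← add_mul, ENNReal.add_halves]

end GoodCubes

section Cutout

open Filter
variable {n N : ℕ}

lemma truncDens_mul_le {p : ℝ} {a c : ℝ≥0∞} (h : 1 ≤ a) (u : 𝔼 n → ℝ) (du : 𝔼 n → 𝔼 n) (k : ℝ)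
    (x : 𝔼 n) : truncDens p (a * c) u du k x ≤ a * truncDens p c u du k x := by
  simp only [truncDens, mul_add, ← mul_assoc]
  exact add_le_add (le_mul_of_one_le_left bot_le h) le_rfl

lemma cube_subset_interior_cube {x : 𝔼 n} {r s : ℝ} (h : r < s) : cube x r ⊆ interior (cube x s) := by
  refine fun y hy => mem_interior_iff_mem_nhds.2 (mem_of_superset (closedBall_mem_nhds y (sub_pos.2 h)) ?_)
  intro z hz i
  have h1 := (abs_apply_le_norm (z - y) i).trans (by simpa [dist_eq_norm] using hz)
  have h2 := hy i
  simp only [PiLp.sub_apply] at h1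
  calc |z i - x i| = |(z i - y i) + (y i - x i)| := by ring_nf
    _ ≤ _ := (abs_add_le _ _).trans (by linarith)

lemma exists_cutoff_of_small (hN : 1 ≤ N) {p q : ℝ} (hp : 1 ≤ p) (hpq : p < q)
    (hε : 1 / p ≤ min (1 / q + 1 / (N : ℝ)) 1) {s : ℝ} (hs0 : 0 < s) (hs1 : s < 1) :
    ∃ C : ℝ≥0∞, C ≠ ⊤ ∧ ∀ {Ω : Set (𝔼 (N + 1))} {u : 𝔼 (N + 1) → ℝ} {du : 𝔼 (N + 1) → 𝔼 (N + 1)},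
      IsW11 (N + 1) Ω u du → ∀ {x : 𝔼 (N + 1)} {r : ℝ}, 0 < r → cube x r ⊆ Ω →
      ∀ {k : ℝ} {ε : ℝ≥0∞}, ε ≠ ⊤ →
      ∫⁻ y in cube x r, truncDens p (ENNReal.ofReal r⁻¹ ^ p) u du k y ≤ ε * volume (cube x r) →
      ∃ (ζ : 𝔼 (N + 1) → ℝ) (C' : ℝ≥0), LipschitzWith C' ζ ∧ (∀ x, 0 ≤ ζ x ∧ ζ x ≤ 1) ∧
        (∀ y ∈ cube x (s * r), ζ y = 1) ∧ tsupport ζ ⊆ cube x r ∧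
        ∫⁻ y, ENNReal.ofReal (u y - k) ^ q * ‖gradient ζ y‖ₑ ^ q ≤
          C * ε ^ (q / p) * volume (cube x r) := by
  obtain ⟨C, hC⟩ := exists_cutoff hN hp hpq hε
  have hp0 : 0 < p := by linarith
  have hq0 : 0 < q := by linarith
  have hqp : 0 ≤ q / p := by positivity
  set a := ENNReal.ofReal (1 - s) with ha
  have ha0 : a ≠ 0 := by simpa [ha] using hs1
  have hat : a ≠ ⊤ := ENNReal.ofReal_ne_top
  have ha1 : a ≤ 1 := by
    rw [ha, ← ENNReal.ofReal_one]
    exact ENNReal.ofReal_le_ofReal (by linarith)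
  refine ⟨C * a ^ (1 - q - q / p) * (a⁻¹ ^ p * 2 ^ (N + 1)) ^ (q / p), ?_, ?_⟩
  · refine ENNReal.mul_ne_top (ENNReal.mul_ne_top (by simp) (ENNReal.rpow_ne_top_of_ne_zero ha0 hat)) ?_
    exact ENNReal.rpow_ne_top_of_nonneg hqp (ENNReal.mul_ne_top
      (ENNReal.rpow_ne_top_of_nonneg hp0.le (ENNReal.inv_ne_top.2 ha0)) (by simp))
  intro Ω u du hW x r hr hcube k ε hεt hsmall
  set b := ENNReal.ofReal r with hb
  have hb0 : b ≠ 0 := by simpa [hb] using hr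
  have hbt : b ≠ ⊤ := ENNReal.ofReal_ne_top
  have hbinv : ENNReal.ofReal r⁻¹ = b⁻¹ := ENNReal.ofReal_inv_of_pos hr
  have hd : ENNReal.ofReal (r - s * r) = a * b := by
    rw [ha, hb, ← ENNReal.ofReal_mul (by linarith)]
    ring_nf
  have hdinv : ENNReal.ofReal (r - s * r)⁻¹ = a⁻¹ * b⁻¹ := by
    rw [ENNReal.ofReal_inv_of_pos (by nlinarith), hd, ENNReal.mul_inv (Or.inl ha0) (Or.inl hat)]
  have hv : volume (cube x r) = 2 ^ (N + 1) * b ^ (N + 1) := by rw [volume_cube' hr.le, mul_pow]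
  have hT : ∫⁻ y in cube x r, truncDens p (ENNReal.ofReal (r - s * r)⁻¹ ^ p) u du k y ≤
      a⁻¹ ^ p * (ε * (2 ^ (N + 1) * b ^ (N + 1))) := by
    rw [hdinv, ENNReal.mul_rpow_of_nonneg _ _ hp0.le, ← hv]
    refine le_trans ?_ (mul_le_mul_right hsmall _)
    rw [← lintegral_const_mul _ (measurable_truncDens hW.meas hW.dmeas), hbinv]
    exact lintegral_mono fun y => truncDens_mul_le
      (ENNReal.one_le_rpow (ENNReal.one_le_inv.2 ha1) hp0) _ _ _ _
  have hTt : a⁻¹ ^ p * (ε * (2 ^ (N + 1) * b ^ (N + 1))) ≠ ⊤ :=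
    ENNReal.mul_ne_top (ENNReal.rpow_ne_top_of_nonneg hp0.le (ENNReal.inv_ne_top.2 ha0))
      (ENNReal.mul_ne_top hεt (ENNReal.mul_ne_top (by simp) (ENNReal.pow_ne_top hbt)))
  obtain ⟨ζ, C', h1, h2, h3, h4, h5⟩ := hC hW.isOpen hW.weak hW.int hW.dint hW.meas hW.dmeas
    (mul_pos hs0 hr) (show s * r < r by nlinarith) hcube (k := k) (ne_top_of_le_ne_top hTt hT)
  refine ⟨ζ, C', h1, h2, h3, h4, h5.trans ?_⟩
  calc _ ≤ C * (a * b) ^ (1 - q - q / p) * (b ^ (p * (1 + N / q - N / p)) *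
        (a⁻¹ ^ p * (ε * (2 ^ (N + 1) * b ^ (N + 1))))) ^ (q / p) := by
        rw [hd]
        exact mul_le_mul_right (ENNReal.rpow_le_rpow (mul_le_mul_right hT _) hqp) _
    _ = C * a ^ (1 - q - q / p) * (a⁻¹ ^ p * 2 ^ (N + 1)) ^ (q / p) * ε ^ (q / p) *
        (b ^ (1 - q - q / p) * ((b ^ (p * (1 + N / q - N / p))) ^ (q / p) *
          (b ^ ((N + 1 : ℕ) : ℝ)) ^ (q / p))) := by
      rw [ENNReal.mul_rpow_of_ne_zero ha0 hb0,
        show b ^ (p * (1 + N / q - N / p)) * (a⁻¹ ^ p * (ε * (2 ^ (N + 1) * b ^ (N + 1)))) =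
          (a⁻¹ ^ p * 2 ^ (N + 1)) * ε * (b ^ (p * (1 + N / q - N / p)) * b ^ (N + 1)) by ring,
        ENNReal.mul_rpow_of_nonneg _ _ hqp, ENNReal.mul_rpow_of_nonneg _ ε hqp,
        ENNReal.mul_rpow_of_nonneg _ (b ^ (N + 1)) hqp, ENNReal.rpow_natCast]
      ring
    _ = C * a ^ (1 - q - q / p) * (a⁻¹ ^ p * 2 ^ (N + 1)) ^ (q / p) * ε ^ (q / p) * b ^ (N + 1) := by
      rw [← ENNReal.rpow_mul, ← ENNReal.rpow_mul, ← ENNReal.rpow_add _ _ hb0 hbt,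
        ← ENNReal.rpow_add _ _ hb0 hbt, ← ENNReal.rpow_natCast b]
      congr 2
      push_cast
      field_simp
      ring
    _ ≤ _ := by
      rw [hv]
      exact mul_le_mul_right (le_mul_of_one_le_left bot_le (one_le_pow₀ one_le_two)) _

lemma sum_eventuallyEq_of_disjoint_tsupport {ι : Type*} {J : Finset ι} {ζ : ι → 𝔼 n → ℝ}
    (h : ∀ a ∈ J, ∀ b ∈ J, a ≠ b → Disjoint (tsupport (ζ a)) (tsupport (ζ b))) (x : 𝔼 n) :
    (fun y => ∑ a ∈ J, ζ a y) =ᶠ[𝓝 x] 0 ∨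
      ∃ a ∈ J, x ∈ tsupport (ζ a) ∧ (fun y => ∑ a ∈ J, ζ a y) =ᶠ[𝓝 x] ζ a := by
  by_cases hx : ∃ a ∈ J, x ∈ tsupport (ζ a)
  · obtain ⟨a, ha, hxa⟩ := hx
    refine Or.inr ⟨a, ha, hxa, ?_⟩
    have : ∀ᶠ y in 𝓝 x, ∀ b ∈ J, b ≠ a → ζ b y = 0 := by
      rw [eventually_all_finset]
      intro b hb
      by_cases hba : b = a
      · simp [hba]
      · have hxb : x ∉ tsupport (ζ b) := disjoint_left.1 (h a ha b hb (Ne.symm hba)) hxa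
        filter_upwards [notMem_tsupport_iff_eventuallyEq.1 hxb] with y hy _ using hy
    filter_upwards [this] with y hy
    exact Finset.sum_eq_single a hy (fun h => absurd ha h)
  · push Not at hx
    left
    have : ∀ᶠ y in 𝓝 x, ∀ b ∈ J, ζ b y = 0 := by
      rw [eventually_all_finset]
      exact fun b hb => notMem_tsupport_iff_eventuallyEq.1 (hx b hb)
    filter_upwards [this] with y hy
    exact Finset.sum_eq_zero hy

lemma exists_lipschitzWith_sum {ι : Type*} (J : Finset ι) {ζ : ι → 𝔼 n → ℝ}
    (h : ∀ a ∈ J, ∃ C, LipschitzWith C (ζ a)) : ∃ C, LipschitzWith C fun y => ∑ a ∈ J, ζ a y := by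
  classical
  induction J using Finset.induction_on with
  | empty => exact ⟨0, by simp⟩
  | insert a J ha ih =>
    obtain ⟨C₁, h₁⟩ := h a (Finset.mem_insert_self _ _)
    obtain ⟨C₂, h₂⟩ := ih fun b hb => h b (Finset.mem_insert_of_mem hb)
    exact ⟨C₁ + C₂, by simpa only [Finset.sum_insert ha] using h₁.add h₂⟩

lemma enorm_gradient_sum_rpow_le {ι : Type*} {J : Finset ι} {ζ : ι → 𝔼 n → ℝ} {q : ℝ} (hq : 0 < q)
    (h : ∀ a ∈ J, ∀ b ∈ J, a ≠ b → Disjoint (tsupport (ζ a)) (tsupport (ζ b))) (x : 𝔼 n) :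
    ‖gradient (fun y => ∑ a ∈ J, ζ a y) x‖ₑ ^ q ≤ ∑ a ∈ J, ‖gradient (ζ a) x‖ₑ ^ q := by
  rcases sum_eventuallyEq_of_disjoint_tsupport h x with h0 | ⟨a, ha, -, ha'⟩
  · rw [h0.gradient_eq]
    have : gradient (0 : 𝔼 n → ℝ) x = 0 := gradient_fun_const x 0
    simp [this, hq]
  · rw [ha'.gradient_eq]
    exact Finset.single_le_sum (f := fun a => ‖gradient (ζ a) x‖ₑ ^ q) (fun _ _ => bot_le) ha

lemma exists_finset_disjoint_cubes (hn : 0 < n) {K B : Set (𝔼 n)} (hK : IsCompact K)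
    {T : Set ((𝔼 n) × ℝ)} (hT : ∀ a ∈ T, 0 < a.2 ∧ cube a.1 a.2 ⊆ K)
    (hB : ∀ x ∈ B, ∀ R : ℝ, 0 < R → ∃ r < R, (x, r) ∈ T) {δ : ℝ≥0∞} (hδ : δ ≠ 0) :
    ∃ J : Finset ((𝔼 n) × ℝ), (∀ a ∈ J, a ∈ T) ∧
      (∀ a ∈ J, ∀ b ∈ J, a ≠ b → Disjoint (cube a.1 a.2) (cube b.1 b.2)) ∧
      volume (B \ ⋃ a ∈ J, cube a.1 a.2) ≤ δ := by
  have hn0 : (0 : ℝ) < n := by exact_mod_cast hn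
  obtain ⟨U, hUT, hUc, hUd, hU0⟩ := Vitali.exists_disjoint_covering_ae volume B T
    ((3 * n) ^ n) (fun a => n * a.2) Prod.fst (fun a => cube a.1 a.2)
    (fun a _ => cube_subset_closedBall) (fun a ha => by
      have := (hT a ha).1
      refine (measure_mono closedBall_subset_cube).trans (le_of_eq ?_)
      rw [volume_cube' (by positivity), volume_cube' this.le, ← mul_assoc 3,
        ENNReal.ofReal_mul (by positivity), ENNReal.ofReal_mul (by positivity)]
      push_cast
      rw [← mul_pow]
      simp
      ring)
    (fun a ha => ⟨a.1, by
      have := cube_subset_interior_cube (x := a.1) (hT a ha).1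
      exact this fun i => by simp⟩)
    (fun a _ => isClosed_cube) (fun x hx ε hε => by
      obtain ⟨r, hr, hrT⟩ := hB x hx (ε / n) (by positivity)
      refine ⟨(x, r), hrT, ?_, rfl⟩
      have := (lt_div_iff₀ hn0).1 hr
      simp only
      linarith)
  have hc : Countable U := hUc.to_subtype
  have hsum : ∑' a : U, volume (cube a.1.1 a.1.2) ≠ ⊤ := by
    rw [← measure_iUnion (f := fun a : U => cube a.1.1 a.1.2)
      (fun a b hab => hUd a.2 b.2 (fun h => hab (Subtype.ext h)))
      (fun a => isClosed_cube.measurableSet)]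
    exact ne_top_of_le_ne_top hK.measure_lt_top.ne
      (measure_mono (iUnion_subset fun a => (hT a (hUT a.2)).2))
  obtain ⟨J, hJ⟩ := ((ENNReal.tendsto_nhds_zero.1 (ENNReal.tendsto_tsum_compl_atTop_zero hsum))
    δ (pos_iff_ne_zero.2 hδ)).exists
  refine ⟨J.map (Function.Embedding.subtype _), ?_, ?_, ?_⟩
  · intro a ha
    obtain ⟨b, _, rfl⟩ := Finset.mem_map.1 ha
    exact hUT b.2
  · intro a ha b hb hab
    obtain ⟨a, _, rfl⟩ := Finset.mem_map.1 ha
    obtain ⟨b, _, rfl⟩ := Finset.mem_map.1 hb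
    exact hUd a.2 b.2 hab
  · calc _ ≤ volume ((B \ ⋃ a ∈ U, cube a.1 a.2) ∪ ⋃ a : {a : U // a ∉ J}, cube a.1.1.1 a.1.1.2) := by
          refine measure_mono fun x hx => ?_
          by_cases hxU : x ∈ ⋃ a ∈ U, cube a.1 a.2
          · obtain ⟨a, haU, hxa⟩ := mem_iUnion₂.1 hxU
            refine Or.inr (mem_iUnion.2 ⟨⟨⟨a, haU⟩, fun haJ => hx.2 ?_⟩, hxa⟩)
            exact mem_iUnion₂.2 ⟨a, Finset.mem_map.2 ⟨⟨a, haU⟩, haJ, rfl⟩, hxa⟩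
          · exact Or.inl ⟨hx.1, hxU⟩
      _ ≤ 0 + ∑' a : {a : U // a ∉ J}, volume (cube a.1.1.1 a.1.1.2) :=
        (measure_union_le _ _).trans (add_le_add hU0.le (measure_iUnion_le _))
      _ ≤ δ := by rw [zero_add]; exact hJ

/-- Cutting out most of `{u ≤ k}` at an arbitrarily small energy cost. -/
lemma exists_cutout (hN : 1 ≤ N) {p q : ℝ} (hp : 1 ≤ p) (hpq : p < q)
    (hε : 1 / p ≤ min (1 / q + 1 / (N : ℝ)) 1) (hpn : p < (N + 1 : ℕ))
    {Ω : Set (𝔼 (N + 1))} {u : 𝔼 (N + 1) → ℝ} {du : 𝔼 (N + 1) → 𝔼 (N + 1)}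
    (hW : IsW11 (N + 1) Ω u du) {K S : Set (𝔼 (N + 1))} (hK : IsCompact K) (hKΩ : K ⊆ Ω)
    (hSK : S ⊆ interior K)
    (hd : ∫⁻ x in K, ‖du x‖ₑ ^ p ≠ ⊤) (hu : ∫⁻ x in K, ‖u x‖ₑ ^ p ≠ ⊤) (k : ℝ)
    {δ : ℝ≥0∞} (hδ : δ ≠ 0) :
    ∃ (η : 𝔼 (N + 1) → ℝ) (C' : ℝ≥0) (E : Set (𝔼 (N + 1))), LipschitzWith C' η ∧
      (∀ x, 0 ≤ η x ∧ η x ≤ 1) ∧ MeasurableSet E ∧ (∀ x, x ∉ E → η x = 0) ∧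
      volume (E ∩ {x | k < u x}) ≤ δ ∧
      volume ((S ∩ {x | u x ≤ k}) \ interior {x | η x = 1}) ≤ δ ∧
      ∫⁻ x, ENNReal.ofReal (u x - k) ^ q * ‖gradient η x‖ₑ ^ q ≤ δ := by
  have hp0 : 0 < p := by linarith
  have hq0 : 0 < q := by linarith
  have hqp : 0 < q / p := by positivity
  have hδ2 : δ / 2 ≠ 0 := (ENNReal.half_pos hδ).ne'
  have hKt : volume K ≠ ⊤ := hK.measure_lt_top.ne
  have hsmall : ∀ {c : ℝ≥0∞} {δ' : ℝ≥0∞}, c ≠ ⊤ → δ' ≠ 0 → ∀ {α : ℝ}, 0 < α →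
      ∀ᶠ t in 𝓝 (0 : ℝ≥0∞), c * t ^ α ≤ δ' := by
    intro c δ' hc hδ' α hα
    have h1 : Tendsto (fun t : ℝ≥0∞ => c * t ^ α) (𝓝 0) (𝓝 0) := by
      have := ENNReal.Tendsto.const_mul ((ENNReal.continuous_rpow_const (y := α)).tendsto 0)
        (Or.inr hc)
      simpa [hα] using this
    exact ENNReal.tendsto_nhds_zero.1 h1 δ' (pos_iff_ne_zero.2 hδ')
  obtain ⟨s, hs0, hs1, hs⟩ : ∃ s : ℝ, 0 < s ∧ s < 1 ∧
      ENNReal.ofReal (1 - s ^ (N + 1)) * volume K ≤ δ / 2 := by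
    have h1 : Tendsto (fun s : ℝ => ENNReal.ofReal (1 - s ^ (N + 1)) * volume K) (𝓝[<] 1) (𝓝 0) := by
      have h2 : Tendsto (fun s : ℝ => ENNReal.ofReal (1 - s ^ (N + 1))) (𝓝[<] 1) (𝓝 0) := by
        have : Continuous fun s : ℝ => ENNReal.ofReal (1 - s ^ (N + 1)) :=
          ENNReal.continuous_ofReal.comp (by fun_prop)
        have := this.tendsto 1
        simp only [one_pow, sub_self, ENNReal.ofReal_zero] at this
        exact this.mono_left nhdsWithin_le_nhds
      simpa using ENNReal.Tendsto.mul_const h2 (Or.inr hKt)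
    have h3 := ENNReal.tendsto_nhds_zero.1 h1 (δ / 2) (pos_iff_ne_zero.2 hδ2)
    have h4 : ∀ᶠ s : ℝ in 𝓝[<] 1, 0 < s ∧ s < 1 :=
      (eventually_nhdsWithin_of_eventually_nhds (lt_mem_nhds one_pos)).and self_mem_nhdsWithin
    obtain ⟨s, h5, h6, h7⟩ := (h3.and h4).exists
    exact ⟨s, h6, h7, h5⟩
  obtain ⟨C, hCt, hC⟩ := exists_cutoff_of_small hN hp hpq hε (s := (1 + s) / 2) (by linarith) (by linarith)
  obtain ⟨ε, hε1, hε2, hε0, hεt⟩ : ∃ ε : ℝ≥0∞, volume K * ε ≤ δ ∧ (C * volume K) * ε ^ (q / p) ≤ δ ∧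
      ε ≠ 0 ∧ ε ≠ ⊤ := by
    have h1 := (hsmall hKt hδ one_pos).and (hsmall (ENNReal.mul_ne_top hCt hKt) hδ hqp)
    have h2 : Tendsto (fun j : ℕ => (2⁻¹ : ℝ≥0∞) ^ j) atTop (𝓝 0) :=
      ENNReal.tendsto_pow_atTop_nhds_zero_of_lt_one (by simp)
    obtain ⟨j, h3, h4⟩ := (h2.eventually h1).exists
    rw [ENNReal.rpow_one] at h3
    exact ⟨_, h3, h4, by simp, ENNReal.pow_ne_top (by simp)⟩
  set T : Set ((𝔼 (N + 1)) × ℝ) := {a | 0 < a.2 ∧ cube a.1 a.2 ⊆ K ∧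
    volume (cube a.1 a.2 ∩ {y | k < u y}) ≤ ε * volume (cube a.1 a.2) ∧
    ∫⁻ y in cube a.1 a.2, truncDens p (ENNReal.ofReal a.2⁻¹ ^ p) u du k y ≤
      ε * volume (cube a.1 a.2)} with hT
  set B : Set (𝔼 (N + 1)) := {x | ∀ R : ℝ, 0 < R → ∃ r < R, (x, r) ∈ T} with hB
  have hSB : volume ((S ∩ {x | u x ≤ k}) \ B) = 0 := by
    refine measure_mono_null ?_ (ae_iff.1 (ae_exists_good_cube hp hpn hW hK hKΩ hd hu k))
    intro x hx hgood
    refine hx.2 fun R hR => ?_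
    obtain ⟨r, h1, h2, h3⟩ := hgood (hSK hx.1.1) hx.1.2 ε hε0 R hR
    exact ⟨r, h2, h1, h3⟩
  obtain ⟨J, hJT, hJd, hJB⟩ := exists_finset_disjoint_cubes (Nat.succ_pos N) hK (T := T) (B := B)
    (fun a ha => ⟨ha.1, ha.2.1⟩) (fun x hx => hx) hδ2
  have hζ : ∀ a : (𝔼 (N + 1)) × ℝ, ∃ ζ : 𝔼 (N + 1) → ℝ, a ∈ J →
      (∃ C', LipschitzWith C' ζ) ∧ (∀ x, 0 ≤ ζ x ∧ ζ x ≤ 1) ∧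
      (∀ y ∈ cube a.1 ((1 + s) / 2 * a.2), ζ y = 1) ∧ tsupport ζ ⊆ cube a.1 a.2 ∧
      ∫⁻ y, ENNReal.ofReal (u y - k) ^ q * ‖gradient ζ y‖ₑ ^ q ≤
        C * ε ^ (q / p) * volume (cube a.1 a.2) := by
    intro a
    by_cases ha : a ∈ J
    · obtain ⟨h1, h2, h3, h4⟩ := hJT a ha
      obtain ⟨ζ, C', h5, h6, h7, h8, h9⟩ := hC hW h1 (h2.trans hKΩ) hεt h4
      exact ⟨ζ, fun _ => ⟨⟨C', h5⟩, h6, h7, h8, h9⟩⟩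
    · exact ⟨0, fun h => absurd h ha⟩
  choose ζ hζ using hζ
  have hdisj : ∀ a ∈ J, ∀ b ∈ J, a ≠ b → Disjoint (tsupport (ζ a)) (tsupport (ζ b)) :=
    fun a ha b hb hab => (hJd a ha b hb hab).mono (hζ a ha).2.2.2.1 (hζ b hb).2.2.2.1
  obtain ⟨C', hC'⟩ := exists_lipschitzWith_sum J (fun a ha => (hζ a ha).1)
  have hvJ : ∑ a ∈ J, volume (cube a.1 a.2) ≤ volume K := by
    rw [← measure_biUnion_finset (fun a ha b hb hab => hJd a ha b hb hab)
      (fun a _ => isClosed_cube.measurableSet)]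
    exact measure_mono (iUnion₂_subset fun a ha => (hJT a ha).2.1)
  refine ⟨fun x => ∑ a ∈ J, ζ a x, C', ⋃ a ∈ J, cube a.1 a.2, hC', ?_, ?_, ?_, ?_, ?_, ?_⟩
  · intro x
    rcases sum_eventuallyEq_of_disjoint_tsupport hdisj x with h | ⟨a, ha, -, h⟩
    · have := h.self_of_nhds
      simp only [Pi.zero_apply] at this
      simp only [this]
      norm_num
    · have := h.self_of_nhds
      simp only at this
      simp only [this]
      exact (hζ a ha).2.1 x
  · exact J.measurableSet_biUnion fun a _ => isClosed_cube.measurableSet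
  · intro x hx
    refine Finset.sum_eq_zero fun a ha => image_eq_zero_of_notMem_tsupport fun h => hx ?_
    exact mem_iUnion₂.2 ⟨a, ha, (hζ a ha).2.2.2.1 h⟩
  · rw [iUnion₂_inter]
    calc _ ≤ ∑ a ∈ J, volume (cube a.1 a.2 ∩ {x | k < u x}) := measure_biUnion_finset_le _ _
      _ ≤ ∑ a ∈ J, ε * volume (cube a.1 a.2) := Finset.sum_le_sum fun a ha => (hJT a ha).2.2.1
      _ ≤ δ := by
        rw [← Finset.mul_sum]
        refine (mul_le_mul_right hvJ _).trans ?_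
        rwa [mul_comm]
  · have hsub : (S ∩ {x | u x ≤ k}) \ interior {x | ∑ a ∈ J, ζ a x = 1} ⊆
        ((S ∩ {x | u x ≤ k}) \ B) ∪ ((B \ ⋃ a ∈ J, cube a.1 a.2) ∪
          ⋃ a ∈ J, (cube a.1 a.2 \ cube a.1 (s * a.2))) := by
      intro x hx
      by_cases hxB : x ∈ B
      swap
      · exact Or.inl ⟨hx.1, hxB⟩
      refine Or.inr ?_
      by_cases hxJ : x ∈ ⋃ a ∈ J, cube a.1 a.2
      swap
      · exact Or.inl ⟨hxB, hxJ⟩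
      refine Or.inr ?_
      obtain ⟨a, ha, hxa⟩ := mem_iUnion₂.1 hxJ
      refine mem_iUnion₂.2 ⟨a, ha, hxa, fun hxs => hx.2 ?_⟩
      have ha0 := (hJT a ha).1
      refine interior_mono ?_ (cube_subset_interior_cube
        (show s * a.2 < (1 + s) / 2 * a.2 by nlinarith) hxs)
      intro y hy
      rw [mem_ofPred_eq, Finset.sum_eq_single a (fun b hb hba => ?_) (fun h => absurd ha h)]
      · exact (hζ a ha).2.2.1 y hy
      · refine image_eq_zero_of_notMem_tsupport fun h => ?_
        have hya : y ∈ cube a.1 a.2 := cube_mono (by nlinarith) hy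
        exact disjoint_left.1 (hJd a ha b hb (Ne.symm hba)) hya ((hζ b hb).2.2.2.1 h)
    refine (measure_mono hsub).trans ((measure_union_le _ _).trans ?_)
    rw [hSB, zero_add]
    refine (measure_union_le _ _).trans ((add_le_add hJB ?_).trans (ENNReal.add_halves δ).le)
    refine (measure_biUnion_finset_le _ _).trans (le_trans ?_ hs)
    refine le_trans ?_ (mul_le_mul_right hvJ _)
    rw [Finset.mul_sum]
    refine Finset.sum_le_sum fun a ha => ?_
    have ha0 := (hJT a ha).1
    rw [measure_sdiff (cube_mono (by nlinarith)) isClosed_cube.measurableSet.nullMeasurableSet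
      isCompact_cube.measure_lt_top.ne, volume_cube ha0.le, volume_cube (by positivity),
      ← ENNReal.ofReal_sub _ (by positivity), ← ENNReal.ofReal_mul]
    · refine ENNReal.ofReal_le_ofReal (le_of_eq ?_)
      rw [mul_left_comm, mul_pow s]
      ring
    · exact sub_nonneg.2 (pow_le_one₀ hs0.le hs1.le)
  · have hm : ∀ a, Measurable fun x => ENNReal.ofReal (u x - k) ^ q * ‖gradient (ζ a) x‖ₑ ^ q := by
      intro a
      have := hW.meas
      have := measurable_gradient (ζ a)
      fun_prop
    calc _ ≤ ∫⁻ x, ∑ a ∈ J, ENNReal.ofReal (u x - k) ^ q * ‖gradient (ζ a) x‖ₑ ^ q := by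
          refine lintegral_mono fun x => ?_
          rw [← Finset.mul_sum]
          exact mul_le_mul_right (enorm_gradient_sum_rpow_le hq0 hdisj x) _
      _ = ∑ a ∈ J, ∫⁻ x, ENNReal.ofReal (u x - k) ^ q * ‖gradient (ζ a) x‖ₑ ^ q :=
        lintegral_finsetSum _ fun a _ => hm a
      _ ≤ ∑ a ∈ J, C * ε ^ (q / p) * volume (cube a.1 a.2) :=
        Finset.sum_le_sum fun a ha => (hζ a ha).2.2.2.2
      _ ≤ δ := by
        rw [← Finset.mul_sum]
        refine (mul_le_mul_right hvJ _).trans ?_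
        rwa [mul_right_comm]

end Cutout

section Caccioppoli

open Filter
variable {n N : ℕ} {Ω : Set (𝔼 n)} {p q L Q : ℝ} {H : 𝔼 n → ℝ} {f : 𝔼 n → 𝔼 n → ℝ}
  {u : 𝔼 n → ℝ} {du : 𝔼 n → 𝔼 n}

lemma IsData.isW11 (D : IsData n Ω p q L Q H f u du) : IsW11 n Ω u du :=
  ⟨D.isOpen, D.qmin.1, D.qmin.2.1, D.qmin.2.2.1, D.u_meas, D.du_meas⟩

lemma IsData.lintegral_du_lt_top (D : IsData n Ω p q L Q H f u du) {K : Set (𝔼 n)}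
    (hK : IsCompact K) (hKΩ : K ⊆ Ω) : ∫⁻ x in K, ‖du x‖ₑ ^ p < ⊤ :=
  (lintegral_mono_ae (ae_restrict_of_ae_restrict_of_subset hKΩ D.enorm_rpow_le_energy)).trans_lt
    (D.lintegral_energy_lt_top hK hKΩ)

lemma IsData.lintegral_u_lt_top (D : IsData n Ω p q L Q H f u du) (hpn : p < n) {K : Set (𝔼 n)}
    (hK : IsCompact K) (hKΩ : K ⊆ Ω) : ∫⁻ x in K, ‖u x‖ₑ ^ p < ⊤ := by
  have hp0 : 0 < p := by linarith [D.one_le_p]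
  have := memLp_of_isWeakGradOn D.isOpen D.qmin.2.1 D.qmin.2.2.1 D.qmin.1 D.one_le_p hpn
    (fun K hK hKΩ => (memLp_ofReal_iff hp0 D.du_meas.aestronglyMeasurable).2
      (D.lintegral_du_lt_top hK hKΩ)) hK hKΩ
  exact (memLp_ofReal_iff hp0 D.u_meas.aestronglyMeasurable).1 this

lemma lipschitzWith_mul {a b : 𝔼 n → ℝ} {A B : ℝ≥0} (ha : LipschitzWith A a) (hb : LipschitzWith B b)
    (ha1 : ∀ x, |a x| ≤ 1) (hb1 : ∀ x, |b x| ≤ 1) : LipschitzWith (A + B) fun x => a x * b x := by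
  refine LipschitzWith.of_dist_le_mul fun x y => ?_
  have h1 := ha.dist_le_mul x y
  have h2 := hb.dist_le_mul x y
  rw [Real.dist_eq] at h1 h2 ⊢
  calc |a x * b x - a y * b y| = |(a x - a y) * b x + a y * (b x - b y)| := by ring_nf
    _ ≤ |a x - a y| * |b x| + |a y| * |b x - b y| := by
      rw [← abs_mul, ← abs_mul]; exact abs_add_le _ _
    _ ≤ A * dist x y * 1 + 1 * (B * dist x y) := by
      gcongr
      · exact hb1 x
      · exact ha1 y
    _ = _ := by push_cast; ring

lemma enorm_gradient_mul_one_sub_le {a b : 𝔼 n → ℝ} {x : 𝔼 n} (ha : DifferentiableAt ℝ a x)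
    (hb : DifferentiableAt ℝ b x) (ha1 : |a x| ≤ 1) (hb1 : |1 - b x| ≤ 1) :
    ‖gradient (fun x => a x * (1 - b x)) x‖ₑ ≤ ‖gradient a x‖ₑ + ‖gradient b x‖ₑ := by
  rw [← ofReal_norm, ← ofReal_norm, ← ofReal_norm, ← ENNReal.ofReal_add (norm_nonneg _) (norm_nonneg _)]
  refine ENNReal.ofReal_le_ofReal ?_
  rw [norm_gradient, norm_gradient, norm_gradient]
  have := (ha.hasFDerivAt.mul ((hasFDerivAt_const (1 : ℝ) x).sub hb.hasFDerivAt)).fderiv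
  simp only [zero_sub] at this
  rw [show (fun x => a x * (1 - b x)) = a * ((fun _ => 1) - b) from rfl, this]
  refine (norm_add_le _ _).trans ?_
  rw [norm_smul, norm_smul, norm_neg, add_comm]
  refine add_le_add ?_ ?_
  · exact mul_le_of_le_one_left (norm_nonneg _) (by simpa using hb1)
  · exact mul_le_of_le_one_left (norm_nonneg _) (by simpa using ha1)

lemma exists_abs_cont {F : 𝔼 n → ℝ≥0∞} {K : Set (𝔼 n)} (hK : MeasurableSet K)
    (hF : ∫⁻ x in K, F x ≠ ⊤) {ε : ℝ≥0∞} (hε : ε ≠ 0) :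
    ∃ δ ≠ 0, ∀ S ⊆ K, volume S ≤ δ → ∫⁻ x in S, F x ≤ ε := by
  rw [← lintegral_indicator hK] at hF
  obtain ⟨δ, hδ, h⟩ := exists_pos_setLIntegral_lt_of_measure_lt hF hε
  obtain ⟨δ', hδ', hδ'δ⟩ := exists_between hδ
  refine ⟨δ', hδ'.ne', fun S hS hv => ?_⟩
  have := (h S (hv.trans_lt hδ'δ)).le
  rwa [setLIntegral_indicator hK, inter_eq_right.2 hS] at this

/-- The Caccioppoli inequality before hole filling. -/
lemma caccioppoli_step {Ω : Set (𝔼 (N + 1))} {H : 𝔼 (N + 1) → ℝ} {f : 𝔼 (N + 1) → 𝔼 (N + 1) → ℝ}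
    {u : 𝔼 (N + 1) → ℝ} {du : 𝔼 (N + 1) → 𝔼 (N + 1)} (D : IsData (N + 1) Ω p q L Q H f u du)
    (hN : 1 ≤ N) (hε : 1 / p ≤ min (1 / q + 1 / (N : ℝ)) 1) (hpn : p < (N + 1 : ℕ))
    {m : ℕ} (hm : q ≤ m) (hm1 : 2 ≤ m) {x₀ : 𝔼 (N + 1)} {ρ σ : ℝ} (hcube : cube x₀ σ ⊆ Ω) (k : ℝ)
    {ζ : 𝔼 (N + 1) → ℝ} {C : ℝ≥0} (hζ : LipschitzWith C ζ) (hζb : ∀ x, 0 ≤ ζ x ∧ ζ x ≤ 1)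
    (hζ1 : ∀ x ∈ cube x₀ ρ, ζ x = 1) (hζs : tsupport ζ ⊆ cube x₀ σ) (hρσ : ρ ≤ σ) :
    ∫⁻ x in cube x₀ ρ ∩ {x | k < u x}, energy H f du x ≤
      ENNReal.ofReal Q * ((∫⁻ x in (cube x₀ σ \ cube x₀ ρ) ∩ {x | k < u x}, energy H f du x) +
        (ENNReal.ofReal (L * m ^ q) * (2 ^ (q - 1) *
          ∫⁻ x, ENNReal.ofReal (u x - k) ^ q * ‖gradient ζ x‖ₑ ^ q) +
        2 * ∫⁻ x in cube x₀ σ ∩ {x | k < u x}, ENNReal.ofReal (H x))) := by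
  have hp := D.one_le_p
  have hpq := D.p_lt_q
  have hq0 : 0 < q := by linarith
  have hL0 : 0 ≤ L := by linarith [D.one_le_L]
  have hQ0 : 0 < Q := by linarith [D.one_le_Q]
  have hum := D.u_meas
  set F := energy H f du with hF
  set c := ENNReal.ofReal (L * m ^ q) with hc
  have hc0 : c ≠ 0 := by
    have : 0 < L * (m : ℝ) ^ q := by
      have h1 := D.one_le_L
      have h2 : (0 : ℝ) < m := by exact_mod_cast (by omega : 0 < m)
      positivity
    simpa [hc] using this
  set I := ∫⁻ x, ENNReal.ofReal (u x - k) ^ q * ‖gradient ζ x‖ₑ ^ q with hI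
  by_cases hIt : I = ⊤
  · have h2 : (2 : ℝ≥0∞) ^ (q - 1) ≠ 0 := by simp
    rw [hIt, ENNReal.mul_top h2, ENNReal.mul_top hc0, top_add, add_top, ENNReal.mul_top (by simpa using hQ0)]
    exact le_top
  set X := ∫⁻ x in (cube x₀ σ \ cube x₀ ρ) ∩ {x | k < u x}, F x with hX
  set Y := ∫⁻ x in cube x₀ σ ∩ {x | k < u x}, ENNReal.ofReal (H x) with hY
  obtain ⟨K, hK, hKΩ, hσK, hball⟩ := exists_compact_nhd isCompact_cube D.isOpen hcube
  have hσK' : cube x₀ σ ⊆ interior K := by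
    obtain ⟨l, hl⟩ := hball.exists
    exact fun x hx => mem_interior_iff_mem_nhds.2
      (mem_of_superset (closedBall_mem_nhds x (by positivity)) (hl x hx))
  have hFK := (D.lintegral_energy_lt_top hK hKΩ).ne
  have hkm : MeasurableSet {x | k < u x} := measurableSet_lt measurable_const hum
  have main : ∀ δ₀ : ℝ≥0∞, δ₀ ≠ 0 → δ₀ ≠ ⊤ →
      ∫⁻ x in cube x₀ ρ ∩ {x | k < u x}, F x ≤
        ENNReal.ofReal Q * (X + (c * (2 ^ (q - 1) * I) + 2 * Y)) +
          (1 + ENNReal.ofReal Q * (2 + c * 2 ^ (q - 1))) * δ₀ := by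
    intro δ₀ hδ₀ hδ₀t
    obtain ⟨δ₁, hδ₁, habs⟩ := exists_abs_cont hK.measurableSet hFK hδ₀
    set δ := min δ₁ δ₀ with hδ
    have hδ0 : δ ≠ 0 := by
      rw [hδ]; rcases min_choice δ₁ δ₀ with h | h <;> rw [h] <;> assumption
    obtain ⟨η, C', E, hηl, hηb, hEm, hηE, hEv, hSv, hηI⟩ := exists_cutout hN hp hpq hε hpn D.isW11 hK hKΩ
      hσK' (D.lintegral_du_lt_top hK hKΩ).ne (D.lintegral_u_lt_top hpn hK hKΩ).ne k hδ0
    set Z : 𝔼 (N + 1) → ℝ := fun x => ζ x * (1 - η x) with hZ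
    have hη1 : ∀ x, |1 - η x| ≤ 1 := fun x => by
      rw [abs_of_nonneg (by linarith [hηb x])]; linarith [hηb x]
    have hζa : ∀ x, |ζ x| ≤ 1 := fun x => by rw [abs_of_nonneg (hζb x).1]; exact (hζb x).2
    have hZl : LipschitzWith (C + (0 + C')) Z :=
      lipschitzWith_mul hζ ((LipschitzWith.const (1 : ℝ)).sub hηl) hζa hη1
    have hZb : ∀ x, 0 ≤ Z x ∧ Z x ≤ 1 := fun x => by
      have h1 := hζb x; have h2 := hηb x
      exact ⟨mul_nonneg h1.1 (by linarith), mul_le_one₀ h1.2 (by linarith) (by linarith)⟩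
    have hZσ : tsupport Z ⊆ cube x₀ σ := by
      have : tsupport Z ⊆ tsupport ζ := closure_mono fun x hx h => hx (by simp [hZ, h])
      exact this.trans hζs
    have hZc : HasCompactSupport Z := isCompact_cube.of_isClosed_subset (isClosed_tsupport _) hZσ
    have hZI : ∫⁻ x, ENNReal.ofReal (u x - k) ^ q * ‖gradient Z x‖ₑ ^ q ≤ 2 ^ (q - 1) * (I + δ₀) := by
      have hm1 : Measurable fun x => ENNReal.ofReal (u x - k) ^ q * ‖gradient ζ x‖ₑ ^ q := by
        have := measurable_gradient ζ
        fun_prop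
      have hm2 : Measurable fun x => ENNReal.ofReal (u x - k) ^ q * ‖gradient η x‖ₑ ^ q := by
        have := measurable_gradient η
        fun_prop
      calc _ ≤ ∫⁻ x, 2 ^ (q - 1) * (ENNReal.ofReal (u x - k) ^ q * ‖gradient ζ x‖ₑ ^ q +
            ENNReal.ofReal (u x - k) ^ q * ‖gradient η x‖ₑ ^ q) := by
            refine lintegral_mono_ae ?_
            filter_upwards [hζ.ae_differentiableAt (μ := volume), hηl.ae_differentiableAt (μ := volume)]
              with x h1 h2
            calc _ ≤ ENNReal.ofReal (u x - k) ^ q *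
                  (2 ^ (q - 1) * (‖gradient ζ x‖ₑ ^ q + ‖gradient η x‖ₑ ^ q)) := by
                  refine mul_le_mul_right ((ENNReal.rpow_le_rpow (enorm_gradient_mul_one_sub_le h1 h2
                    (hζa x) (hη1 x)) hq0.le).trans ?_) _
                  exact ENNReal.rpow_add_le_mul_rpow_add_rpow _ _ (by linarith)
              _ = _ := by ring
        _ = 2 ^ (q - 1) * (I + ∫⁻ x, ENNReal.ofReal (u x - k) ^ q * ‖gradient η x‖ₑ ^ q) := by
          rw [lintegral_const_mul' _ _ (by simp), lintegral_add_left hm1]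
        _ ≤ _ := mul_le_mul_right (add_le_add le_rfl (hηI.trans (min_le_right _ _))) _
    have hZt : ∫⁻ x, ENNReal.ofReal (u x - k) ^ q * ‖gradient Z x‖ₑ ^ q ≠ ⊤ :=
      ne_top_of_le_ne_top (ENNReal.mul_ne_top (by simp) (ENNReal.add_ne_top.2 ⟨hIt, hδ₀t⟩)) hZI
    have hqm := D.quasimin_ineq hm hm1 hZl hZb hZc (hZσ.trans hcube) k hZt
    rw [← hF, ← hc] at hqm
    have hEδ : ∫⁻ x in E ∩ {x | k < u x} ∩ K, F x ≤ δ₀ :=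
      habs _ inter_subset_right ((measure_mono inter_subset_left).trans (hEv.trans (min_le_left _ _)))
    have hone : ∀ x ∈ cube x₀ ρ, x ∉ E → Z x = 1 := fun x hx hxE => by
      simp [hZ, hζ1 x hx, hηE x hxE]
    have b1 : ∫⁻ x in cube x₀ ρ ∩ {x | k < u x}, F x ≤
        (∫⁻ x in {x | Z x = 1 ∧ k < u x}, F x) + δ₀ := by
      refine le_trans (lintegral_mono_set (t := {x | Z x = 1 ∧ k < u x} ∪ (E ∩ {x | k < u x} ∩ K)) ?_)
        ((lintegral_union_le _ _ _).trans (add_le_add le_rfl hEδ))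
      intro x hx
      by_cases hxE : x ∈ E
      · exact Or.inr ⟨⟨hxE, hx.2⟩, hσK (cube_mono hρσ hx.1)⟩
      · exact Or.inl ⟨hone x hx.1 hxE, hx.2⟩
    have b2 : ∫⁻ x in tsupport Z ∩ {x | u x ≤ k}, F x ≤ δ₀ := by
      refine habs _ (inter_subset_left.trans (hZσ.trans hσK)) ?_
      refine le_trans (measure_mono fun x hx => ?_) (hSv.trans (min_le_left _ _))
      refine ⟨⟨hZσ hx.1, hx.2⟩, fun hint => ?_⟩
      refine notMem_tsupport_iff_eventuallyEq.2 ?_ hx.1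
      filter_upwards [mem_interior_iff_mem_nhds.1 hint] with y hy
      have : η y = 1 := hy
      simp [hZ, this]
    have b3 : ∫⁻ x in tsupport Z ∩ {x | k < u x ∧ Z x < 1}, F x ≤ X + δ₀ := by
      refine le_trans (lintegral_mono_set (t := ((cube x₀ σ \ cube x₀ ρ) ∩ {x | k < u x}) ∪
        (E ∩ {x | k < u x} ∩ K)) ?_) ((lintegral_union_le _ _ _).trans (add_le_add le_rfl hEδ))
      intro x hx
      have hxσ := hZσ hx.1
      by_cases hxE : x ∈ E
      · exact Or.inr ⟨⟨hxE, hx.2.1⟩, hσK hxσ⟩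
      · exact Or.inl ⟨⟨hxσ, fun h => (hone x h hxE).not_lt hx.2.2⟩, hx.2.1⟩
    have b4 : ∫⁻ x in tsupport Z ∩ {x | k < u x}, ENNReal.ofReal (H x) ≤ Y :=
      lintegral_mono_set (inter_subset_inter_left _ hZσ)
    calc _ ≤ ENNReal.ofReal Q * (δ₀ + (X + δ₀) + (c * (2 ^ (q - 1) * (I + δ₀)) + 2 * Y)) + δ₀ := by
          refine b1.trans (add_le_add (hqm.trans (mul_le_mul_right ?_ _)) le_rfl)
          exact add_le_add (add_le_add b2 b3)
            (add_le_add (mul_le_mul_right hZI _) (mul_le_mul_right b4 _))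
      _ = _ := by ring
  have hlim : Tendsto (fun j : ℕ => ENNReal.ofReal Q * (X + (c * (2 ^ (q - 1) * I) + 2 * Y)) +
      (1 + ENNReal.ofReal Q * (2 + c * 2 ^ (q - 1))) * 2⁻¹ ^ j) atTop
      (𝓝 (ENNReal.ofReal Q * (X + (c * (2 ^ (q - 1) * I) + 2 * Y)))) := by
    have h1 := ENNReal.Tendsto.const_mul (a := 1 + ENNReal.ofReal Q * (2 + c * 2 ^ (q - 1)))
      (ENNReal.tendsto_pow_atTop_nhds_zero_of_lt_one (r := 2⁻¹) (by simp))
      (Or.inr (ENNReal.add_ne_top.2 ⟨ENNReal.one_ne_top, ENNReal.mul_ne_top (by simp)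
        (ENNReal.add_ne_top.2 ⟨by simp, ENNReal.mul_ne_top (by simp [hc]) (by simp)⟩)⟩))
    have h2 := (tendsto_const_nhds (x := ENNReal.ofReal Q * (X + (c * (2 ^ (q - 1) * I) + 2 * Y)))).add h1
    simpa using h2
  exact ge_of_tendsto' hlim fun j => main _ (by simp) (ENNReal.pow_ne_top (by simp))

end Caccioppoli

section HoleFilling

open Filter
variable {n N : ℕ} {p q L Q : ℝ}

lemma exists_absorption {θ : ℝ≥0∞} (hθ : θ < 1) {γ : ℝ} (hγ : 0 ≤ γ) :
    ∃ C : ℝ≥0∞, C ≠ ⊤ ∧ ∀ {φ : ℝ → ℝ≥0∞} {ρ σ : ℝ}, ρ < σ → ∀ {M : ℝ≥0∞}, M ≠ ⊤ →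
      (∀ t, ρ ≤ t → t ≤ σ → φ t ≤ M) → ∀ {A B : ℝ≥0∞},
      (∀ s t, ρ ≤ s → s < t → t ≤ σ → φ s ≤ θ * φ t + (A * ENNReal.ofReal (t - s) ^ (-γ) + B)) →
      φ ρ ≤ C * (A * ENNReal.ofReal (σ - ρ) ^ (-γ) + B) := by
  obtain ⟨l, hl0, hl1, hl⟩ : ∃ l : ℝ, 0 < l ∧ l < 1 ∧ θ * ENNReal.ofReal l ^ (-γ) < 1 := by
    have h1 : Tendsto (fun l : ℝ => θ * ENNReal.ofReal l ^ (-γ)) (𝓝[<] 1) (𝓝 θ) := by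
      have h2 : Tendsto (fun l : ℝ => ENNReal.ofReal l ^ (-γ)) (𝓝 1) (𝓝 1) := by
        have := (ENNReal.continuous_rpow_const (y := -γ)).tendsto 1
        have h3 := ENNReal.continuous_ofReal.tendsto 1
        rw [ENNReal.ofReal_one] at h3
        have h := this.comp h3
        rw [ENNReal.one_rpow] at h
        exact h
      have := ENNReal.Tendsto.const_mul (a := θ) (h2.mono_left (nhdsWithin_le_nhds (s := Iio 1)))
        (Or.inr (ne_top_of_lt hθ))
      simpa using this
    have h4 : ∀ᶠ s : ℝ in 𝓝[<] 1, 0 < s ∧ s < 1 :=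
      (eventually_nhdsWithin_of_eventually_nhds (lt_mem_nhds one_pos)).and self_mem_nhdsWithin
    obtain ⟨s, h5, h6, h7⟩ := ((h1.eventually (gt_mem_nhds hθ)).and h4).exists
    exact ⟨s, h6, h7, h5⟩
  set a := ENNReal.ofReal l with ha
  set b := ENNReal.ofReal (1 - l) with hb
  set κ := θ * a ^ (-γ) with hκ
  have ha0 : a ≠ 0 := by simpa [ha] using hl0
  have hat : a ≠ ⊤ := ENNReal.ofReal_ne_top
  have ha1 : a ≤ 1 := by rw [ha, ← ENNReal.ofReal_one]; exact ENNReal.ofReal_le_ofReal hl1.le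
  have hb0 : b ≠ 0 := by simpa [hb] using hl1
  have hbt : b ≠ ⊤ := ENNReal.ofReal_ne_top
  have hb1 : b ≤ 1 := by
    rw [hb, ← ENNReal.ofReal_one]; exact ENNReal.ofReal_le_ofReal (by linarith)
  have hinv : ∀ {c : ℝ≥0∞}, c ≤ 1 → 1 ≤ c ^ (-γ) := fun {c} hc => by
    rw [ENNReal.rpow_neg]
    exact ENNReal.one_le_inv.2 (ENNReal.rpow_le_one hc hγ)
  refine ⟨b ^ (-γ) * (1 - κ)⁻¹, ENNReal.mul_ne_top (ENNReal.rpow_ne_top_of_ne_zero hb0 hbt)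
    (ENNReal.inv_ne_top.2 (tsub_pos_of_lt hl).ne'), ?_⟩
  intro φ ρ σ hρσ M hM hφ A B h
  set d := ENNReal.ofReal (σ - ρ) with hd
  have hd0 : d ≠ 0 := by simpa [hd] using hρσ
  set E := b ^ (-γ) * (A * d ^ (-γ) + B) with hE
  set t : ℕ → ℝ := fun i => ρ + (1 - l ^ i) * (σ - ρ) with ht
  have hli : ∀ i : ℕ, 0 < l ^ i ∧ l ^ i ≤ 1 := fun i => ⟨by positivity, pow_le_one₀ hl0.le hl1.le⟩
  have ht1 : ∀ i, ρ ≤ t i := fun i => by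
    have := mul_nonneg (sub_nonneg.2 (hli i).2) (sub_nonneg.2 hρσ.le)
    simp only [ht]; linarith
  have ht2 : ∀ i, t i ≤ σ := fun i => by
    have := mul_nonneg (hli i).1.le (sub_nonneg.2 hρσ.le)
    simp only [ht]; linarith
  have htd : ∀ i, t (i + 1) - t i = (1 - l) * (l ^ i * (σ - ρ)) := fun i => by
    simp only [ht, pow_succ]; ring
  have hind : ∀ i : ℕ, φ ρ ≤ θ ^ i * φ (t i) + E * ∑ j ∈ Finset.range i, κ ^ j := by
    intro i
    induction i with
    | zero => simp [ht]
    | succ i ih =>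
      have hpos : 0 < t (i + 1) - t i := by
        rw [htd]; exact mul_pos (sub_pos.2 hl1) (mul_pos (hli i).1 (sub_pos.2 hρσ))
      have h1 := h (t i) (t (i + 1)) (ht1 i) (by linarith) (ht2 _)
      have h2 : ENNReal.ofReal (t (i + 1) - t i) ^ (-γ) = b ^ (-γ) * ((a ^ (-γ)) ^ i * d ^ (-γ)) := by
        rw [htd, ENNReal.ofReal_mul (by linarith), ENNReal.ofReal_mul (hli i).1.le,
          ENNReal.ofReal_pow hl0.le, ENNReal.mul_rpow_of_ne_zero hb0 (mul_ne_zero (pow_ne_zero _ ha0) hd0),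
          ENNReal.mul_rpow_of_ne_zero (pow_ne_zero _ ha0) hd0, ← ENNReal.rpow_natCast, ← ENNReal.rpow_natCast,
          ← ENNReal.rpow_mul, ← ENNReal.rpow_mul, mul_comm (i : ℝ)]
      calc φ ρ ≤ θ ^ i * φ (t i) + E * ∑ j ∈ Finset.range i, κ ^ j := ih
        _ ≤ θ ^ i * (θ * φ (t (i + 1)) + (A * (b ^ (-γ) * ((a ^ (-γ)) ^ i * d ^ (-γ))) + B)) +
            E * ∑ j ∈ Finset.range i, κ ^ j := by
          rw [← h2]
          exact add_le_add (mul_le_mul_right h1 _) le_rfl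
        _ = θ ^ (i + 1) * φ (t (i + 1)) + ((b ^ (-γ) * (A * d ^ (-γ))) * κ ^ i + θ ^ i * B) +
            E * ∑ j ∈ Finset.range i, κ ^ j := by
          rw [hκ, mul_pow, pow_succ]; ring
        _ ≤ θ ^ (i + 1) * φ (t (i + 1)) + ((b ^ (-γ) * (A * d ^ (-γ))) * κ ^ i +
            (b ^ (-γ) * B) * κ ^ i) + E * ∑ j ∈ Finset.range i, κ ^ j := by
          refine add_le_add (add_le_add le_rfl (add_le_add le_rfl ?_)) le_rfl
          rw [mul_comm]
          refine mul_le_mul' (le_mul_of_one_le_left bot_le (hinv hb1)) ?_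
          exact pow_le_pow_left' (le_mul_of_one_le_right bot_le (hinv ha1)) i
        _ = _ := by
          rw [Finset.sum_range_succ, hE]; ring
  have hlim : Tendsto (fun i : ℕ => θ ^ i * M + E * (1 - κ)⁻¹) atTop (𝓝 (0 * M + E * (1 - κ)⁻¹)) :=
    (ENNReal.Tendsto.mul_const (ENNReal.tendsto_pow_atTop_nhds_zero_of_lt_one hθ) (Or.inr hM)).add
      tendsto_const_nhds
  rw [zero_mul, zero_add] at hlim
  refine (ge_of_tendsto' hlim fun i => (hind i).trans ?_).trans (le_of_eq (by rw [hE]; ring))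
  refine add_le_add (mul_le_mul_right (hφ _ (ht1 i) (ht2 i)) _) (mul_le_mul_right ?_ _)
  rw [← ENNReal.tsum_geometric]
  exact ENNReal.sum_le_tsum _

lemma IsData.exists_caccioppoli {Ω : Set (𝔼 (N + 1))} {H : 𝔼 (N + 1) → ℝ}
    {f : 𝔼 (N + 1) → 𝔼 (N + 1) → ℝ} {u : 𝔼 (N + 1) → ℝ} {du : 𝔼 (N + 1) → 𝔼 (N + 1)}
    (D : IsData (N + 1) Ω p q L Q H f u du)
    (hN : 1 ≤ N) (hε : 1 / p ≤ min (1 / q + 1 / (N : ℝ)) 1) (hpn : p < (N + 1 : ℕ)) :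
    ∃ C : ℝ≥0∞, C ≠ ⊤ ∧ ∀ {x₀ : 𝔼 (N + 1)} {ρ σ : ℝ}, 0 < ρ → ρ < σ → σ ≤ 1 → cube x₀ σ ⊆ Ω →
      ∀ k, ∫⁻ x in cube x₀ ρ ∩ {x | k < u x}, energy H f du x ≤
        C * ((∫⁻ x in cube x₀ σ, truncDens p 1 u du k x) ^ (q / p) *
            ENNReal.ofReal (σ - ρ) ^ (-(2 * q + q / p - 1)) +
          ∫⁻ x in cube x₀ σ ∩ {x | k < u x}, ENNReal.ofReal (H x)) := by
  have hp := D.one_le_p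
  have hpq := D.p_lt_q
  have hp0 : 0 < p := by linarith
  have hq0 : 0 < q := by linarith
  have hqp : 0 < q / p := by positivity
  have hum := D.u_meas
  have hQ0 : 0 < Q := by linarith [D.one_le_Q]
  obtain ⟨C₀, hC₀⟩ := exists_cutoff hN hp hpq hε
  obtain ⟨m, hm⟩ : ∃ m : ℕ, max q 2 ≤ m := ⟨_, Nat.le_ceil _⟩
  have hmq : q ≤ m := (le_max_left _ _).trans hm
  have hm2 : 2 ≤ m := by exact_mod_cast (le_max_right _ _).trans hm
  set θ := ENNReal.ofReal Q * (1 + ENNReal.ofReal Q)⁻¹ with hθ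
  have hQt : (1 + ENNReal.ofReal Q) ≠ ⊤ := by simp
  have hθ1 : θ < 1 := by
    rw [hθ, ← div_eq_mul_inv]
    refine (ENNReal.div_lt_iff (Or.inl (by simp)) (Or.inl hQt)).2 ?_
    rw [one_mul, add_comm]
    exact ENNReal.lt_add_right ENNReal.ofReal_ne_top one_ne_zero
  obtain ⟨C₁, hC₁t, hC₁⟩ := exists_absorption hθ1 (γ := 2 * q + q / p - 1) (by nlinarith)
  set c := ENNReal.ofReal (L * m ^ q) * 2 ^ (q - 1) * C₀ + 2 with hc
  have hct : c ≠ ⊤ := by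
    rw [hc]
    exact ENNReal.add_ne_top.2 ⟨ENNReal.mul_ne_top (ENNReal.mul_ne_top (by simp) (by simp)) (by simp),
      by simp⟩
  refine ⟨C₁ * c, ENNReal.mul_ne_top hC₁t hct, ?_⟩
  intro x₀ ρ σ hρ hρσ hσ1 hcube k
  set F := energy H f du with hF
  set Y := ∫⁻ x in cube x₀ σ, truncDens p 1 u du k x with hY
  set G := ∫⁻ x in cube x₀ σ ∩ {x | k < u x}, ENNReal.ofReal (H x) with hG
  have hYt : Y ≠ ⊤ := by
    refine ne_top_of_le_ne_top ?_ (setLIntegral_truncDens_le (g := fun y => ‖du y‖ₑ ^ p)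
      isClosed_cube.measurableSet hum fun y _ _ => le_rfl)
    refine ENNReal.add_ne_top.2 ⟨(D.lintegral_du_lt_top isCompact_cube hcube).ne, ?_⟩
    rw [one_mul]
    refine ne_top_of_le_ne_top (b := ∫⁻ y in cube x₀ σ, 2 ^ (p - 1) * (‖u y‖ₑ ^ p + ‖k‖ₑ ^ p)) ?_ ?_
    · rw [lintegral_const_mul _ (by fun_prop), lintegral_add_right _ measurable_const,
        setLIntegral_const]
      exact ENNReal.mul_ne_top (by simp) (ENNReal.add_ne_top.2
        ⟨(D.lintegral_u_lt_top hpn isCompact_cube hcube).ne, ENNReal.mul_ne_top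
        (by simp [hp0.le]) isCompact_cube.measure_lt_top.ne⟩)
    · refine lintegral_mono fun y => ?_
      refine (ENNReal.rpow_le_rpow ?_ hp0.le).trans (ENNReal.rpow_add_le_mul_rpow_add_rpow _ _ hp)
      calc ENNReal.ofReal (u y - k) ≤ ‖u y - k‖ₑ := Real.ofReal_le_enorm _
        _ ≤ _ := enorm_sub_le
  have hβ : 0 ≤ p * (1 + N / q - N / p) := by
    have hN0 : (0 : ℝ) < N := by exact_mod_cast hN
    have h1 : N * (1 / p) ≤ N * (1 / q + 1 / (N : ℝ)) :=
      mul_le_mul_of_nonneg_left (hε.trans (min_le_left _ _)) hN0.le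
    have h2 : (N : ℝ) * (1 / q + 1 / (N : ℝ)) = N / q + 1 := by field_simp
    have h3 : (N : ℝ) * (1 / p) = N / p := by ring
    exact mul_nonneg hp0.le (by linarith)
  have hkm : MeasurableSet {x | k < u x} := measurableSet_lt measurable_const hum
  have hstep : ∀ s t, ρ ≤ s → s < t → t ≤ σ →
      ∫⁻ x in cube x₀ s ∩ {x | k < u x}, F x ≤ θ * (∫⁻ x in cube x₀ t ∩ {x | k < u x}, F x) +
        (c * Y ^ (q / p) * ENNReal.ofReal (t - s) ^ (-(2 * q + q / p - 1)) + c * G) := by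
    intro s t hs hst ht
    have hts : cube x₀ t ⊆ cube x₀ σ := cube_mono ht
    set e := ENNReal.ofReal (t - s) with he
    have he0 : e ≠ 0 := by simpa [he] using hst
    have het : e ≠ ⊤ := ENNReal.ofReal_ne_top
    have he1 : e ≤ 1 := by
      rw [he, ← ENNReal.ofReal_one]; exact ENNReal.ofReal_le_ofReal (by linarith)
    have hei : ENNReal.ofReal (t - s)⁻¹ = e⁻¹ := ENNReal.ofReal_inv_of_pos (by linarith)
    have hT : ∫⁻ x in cube x₀ t, truncDens p (ENNReal.ofReal (t - s)⁻¹ ^ p) u du k x ≤ e⁻¹ ^ p * Y := by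
      rw [hei, hY, ← lintegral_const_mul _ (measurable_truncDens hum D.du_meas)]
      refine (lintegral_mono_set hts).trans (lintegral_mono fun y => ?_)
      have := truncDens_mul_le (p := p) (c := 1) (ENNReal.one_le_rpow (ENNReal.one_le_inv.2 he1) hp0) u du k y
      rwa [mul_one] at this
    have heY : e⁻¹ ^ p * Y ≠ ⊤ := ENNReal.mul_ne_top
      (ENNReal.rpow_ne_top_of_nonneg hp0.le (ENNReal.inv_ne_top.2 he0)) hYt
    obtain ⟨ζ, C', h1, h2, h3, h4, h5⟩ := hC₀ D.isOpen D.qmin.1 D.qmin.2.1 D.qmin.2.2.1 hum D.du_meas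
      (show 0 < s by linarith) hst (hts.trans hcube) (k := k) (ne_top_of_le_ne_top heY hT)
    have hcost : ∫⁻ x, ENNReal.ofReal (u x - k) ^ q * ‖gradient ζ x‖ₑ ^ q ≤
        C₀ * (Y ^ (q / p) * e ^ (-(2 * q + q / p - 1))) := by
      refine h5.trans ?_
      rw [mul_assoc]
      refine mul_le_mul_right ?_ _
      have ht1 : ENNReal.ofReal t ^ (p * (1 + N / q - N / p)) ≤ 1 := by
        refine ENNReal.rpow_le_one ?_ hβ
        rw [← ENNReal.ofReal_one]; exact ENNReal.ofReal_le_ofReal (by linarith)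
      calc _ ≤ e ^ (1 - q - q / p) * (1 * (e⁻¹ ^ p * Y)) ^ (q / p) :=
            mul_le_mul_right (ENNReal.rpow_le_rpow (mul_le_mul' ht1 hT) hqp.le) _
        _ = Y ^ (q / p) * (e ^ (1 - q - q / p) * e ^ (-(p * (q / p)))) := by
          rw [one_mul, ENNReal.mul_rpow_of_nonneg _ _ hqp.le, ENNReal.inv_rpow, ← ENNReal.rpow_neg,
            ← ENNReal.rpow_mul, neg_mul]
          ring
        _ = _ := by
          rw [← ENNReal.rpow_add _ _ he0 het]
          congr 2
          field_simp
          ring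
    have hcac := caccioppoli_step D hN hε hpn hmq hm2 (hts.trans hcube) k h1 h2 h3 h4 hst.le
    rw [← hF] at hcac
    set Ss := ∫⁻ x in cube x₀ s ∩ {x | k < u x}, F x with hSs
    set St := ∫⁻ x in cube x₀ t ∩ {x | k < u x}, F x with hSt
    set X := ∫⁻ x in (cube x₀ t \ cube x₀ s) ∩ {x | k < u x}, F x with hX
    have hadd : X + Ss = St := by
      have hd : Disjoint ((cube x₀ t \ cube x₀ s) ∩ {x | k < u x}) (cube x₀ s ∩ {x | k < u x}) :=
        disjoint_sdiff_left.mono inter_subset_left inter_subset_left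
      rw [hX, hSs, ← lintegral_union (isClosed_cube.measurableSet.inter hkm) hd, ← union_inter_distrib_right,
        sdiff_union_of_subset (cube_mono hst.le)]
    have hStt : St ≠ ⊤ := ne_top_of_le_ne_top (D.lintegral_energy_lt_top isCompact_cube hcube).ne
      (lintegral_mono_set (inter_subset_left.trans hts))
    set q' := ENNReal.ofReal Q with hq'
    have hGt : ∫⁻ x in cube x₀ t ∩ {x | k < u x}, ENNReal.ofReal (H x) ≤ G :=
      lintegral_mono_set (inter_subset_inter_left _ hts)
    set W := c * Y ^ (q / p) * e ^ (-(2 * q + q / p - 1)) + c * G with hW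
    have hcW : ENNReal.ofReal (L * m ^ q) * (2 ^ (q - 1) *
        ∫⁻ x, ENNReal.ofReal (u x - k) ^ q * ‖gradient ζ x‖ₑ ^ q) +
        2 * ∫⁻ x in cube x₀ t ∩ {x | k < u x}, ENNReal.ofReal (H x) ≤ W := by
      refine add_le_add ?_ ?_
      · refine (mul_le_mul_right (mul_le_mul_right hcost _) _).trans ?_
        rw [← mul_assoc, ← mul_assoc, mul_assoc c]
        exact mul_le_mul_left le_self_add _
      · exact mul_le_mul' le_add_self hGt
    have h6 : (1 + q') * Ss ≤ q' * (St + W) := by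
      calc (1 + q') * Ss = Ss + q' * Ss := by ring
        _ ≤ q' * (X + W) + q' * Ss :=
          add_le_add (hcac.trans (mul_le_mul_right (add_le_add le_rfl hcW) _)) le_rfl
        _ = q' * (X + Ss + W) := by ring
        _ = _ := by rw [hadd]
    have h7 : Ss ≤ θ * (St + W) := by
      calc Ss = (1 + q')⁻¹ * ((1 + q') * Ss) := by
            rw [← mul_assoc, ENNReal.inv_mul_cancel (by simp) hQt, one_mul]
        _ ≤ (1 + q')⁻¹ * (q' * (St + W)) := mul_le_mul_right h6 _
        _ = θ * (St + W) := by rw [hθ]; ring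
    refine h7.trans ?_
    rw [mul_add]
    exact add_le_add le_rfl (mul_le_of_le_one_left bot_le hθ1.le)
  have := hC₁ (φ := fun s => ∫⁻ x in cube x₀ s ∩ {x | k < u x}, F x) hρσ
    (D.lintegral_energy_lt_top isCompact_cube hcube).ne
    (fun t _ ht => lintegral_mono_set (inter_subset_left.trans (cube_mono ht))) hstep
  refine this.trans (le_of_eq ?_)
  ring

end HoleFilling

section DeGiorgi

open Filter

lemma eventually_mul_rpow_le {c δ : ℝ≥0∞} (hc : c ≠ ⊤) (hδ : δ ≠ 0) {α : ℝ} (hα : 0 < α) :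
    ∀ᶠ t in 𝓝 (0 : ℝ≥0∞), c * t ^ α ≤ δ := by
  have h1 : Tendsto (fun t : ℝ≥0∞ => c * t ^ α) (𝓝 0) (𝓝 0) := by
    have := ENNReal.Tendsto.const_mul ((ENNReal.continuous_rpow_const (y := α)).tendsto 0) (Or.inr hc)
    simpa [hα] using this
  exact ENNReal.tendsto_nhds_zero.1 h1 δ (pos_iff_ne_zero.2 hδ)

lemma exists_ne_zero_of_eventually {P : ℝ≥0∞ → Prop} (h : ∀ᶠ t in 𝓝 (0 : ℝ≥0∞), P t) :
    ∃ t, t ≠ 0 ∧ t < 1 ∧ P t := by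
  have h2 : Tendsto (fun j : ℕ => (2⁻¹ : ℝ≥0∞) ^ (j + 1)) atTop (𝓝 0) :=
    (ENNReal.tendsto_pow_atTop_nhds_zero_of_lt_one (by simp)).comp (tendsto_add_atTop_nat 1)
  obtain ⟨j, hj⟩ := (h2.eventually h).exists
  exact ⟨_, by simp, pow_lt_one₀ bot_le (by simp) (by omega), hj⟩

/-- One step of De Giorgi's iteration. -/
lemma level_step {J W M G : ℝ → ℝ → ℝ≥0∞} {p q τ ν γ R : ℝ} {C : ℝ≥0∞} (hp : 1 ≤ p)
    (hpq : p < q) (hτ : 0 < τ) (hν : 0 < ν) (hC : C ≠ ⊤) (hC1 : 1 ≤ C)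
    (Jmono : ∀ k k' ρ σ, k ≤ k' → ρ ≤ σ → J k' ρ ≤ J k σ)
    (Wmono : ∀ k k' ρ σ, k ≤ k' → ρ ≤ σ → W k' ρ ≤ W k σ)
    (ha : ∀ k ρ σ, R ≤ ρ → ρ < σ → σ ≤ 2 * R →
      J k ρ ≤ C * ((J k σ + W k σ) ^ (q / p) * ENNReal.ofReal (σ - ρ) ^ (-γ) + G k σ))
    (hb : ∀ k k' ρ σ, R ≤ ρ → ρ < σ → σ ≤ 2 * R → k ≤ k' →
      M k' ρ * ENNReal.ofReal (k' - k) ^ (1 / τ) ≤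
        C * (J k σ + ENNReal.ofReal (σ - ρ)⁻¹ ^ p * W k σ) ^ (1 / (τ * p)))
    (hc : ∀ k k' ρ σ, R ≤ ρ → ρ < σ → σ ≤ 2 * R → k ≤ k' →
      W k' ρ ≤ C * M k' ρ ^ ν * (J k σ + ENNReal.ofReal (σ - ρ)⁻¹ ^ p * W k σ))
    {θ s b e : ℝ≥0∞} {k d δ σ : ℝ} (hθ0 : θ ≠ 0) (hθt : θ ≠ ⊤) (hb0 : b ≠ 0) (hbt : b ≠ ⊤)
    (hd0 : 0 ≤ d) (hd : ENNReal.ofReal d ^ (1 / τ) = C * b ^ (1 / τ) * θ⁻¹)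
    (hδ : 0 < δ) (hδ1 : δ ≤ 1) (hRσ : R ≤ σ - 2 * δ) (hσ : σ ≤ 2 * R)
    (hA : J k σ + ENNReal.ofReal δ⁻¹ ^ p * W k σ ≤ (b * s ^ τ) ^ p)
    (hG : M (k + d) (σ - δ) ≤ s * θ → G (k + d) (σ - δ) ≤ (e * (s * θ) ^ τ) ^ p)
    (hη : C * ENNReal.ofReal δ ^ (-γ) * (b * s ^ τ) ^ (q - p) +
      ENNReal.ofReal (δ / 2)⁻¹ ^ p * C * (s * θ) ^ ν ≤ (2⁻¹ * θ ^ τ) ^ p) :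
    M (k + d) (σ - δ) ≤ s * θ ∧
      J (k + d) (σ - 2 * δ) + ENNReal.ofReal (δ / 2)⁻¹ ^ p * W (k + d) (σ - 2 * δ) ≤
        ((b / 2 + C * e) * (s * θ) ^ τ) ^ p := by
  have hp0 : 0 < p := by linarith
  have hC0 : C ≠ 0 := (zero_lt_one.trans_le hC1).ne'
  have hb' : b ^ (1 / τ) ≠ 0 := by simp [hb0, hbt]
  have hbt' : b ^ (1 / τ) ≠ ⊤ := ENNReal.rpow_ne_top_of_nonneg (by positivity) hbt
  set A := J k σ + ENNReal.ofReal δ⁻¹ ^ p * W k σ with hAdef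
  set x := b * s ^ τ with hx
  have hk : k ≤ k + d := by linarith
  have hM : M (k + d) (σ - δ) ≤ s * θ := by
    have h1 := hb k (k + d) (σ - δ) σ (by linarith) (by linarith) hσ hk
    rw [show k + d - k = d by ring, show σ - (σ - δ) = δ by ring, hd, ← hAdef] at h1
    have h2 : A ^ (1 / (τ * p)) ≤ b ^ (1 / τ) * s := by
      calc A ^ (1 / (τ * p)) ≤ (x ^ p) ^ (1 / (τ * p)) := ENNReal.rpow_le_rpow hA (by positivity)
        _ = x ^ (1 / τ) := by
          rw [← ENNReal.rpow_mul]; congr 1; field_simp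
        _ = _ := by
          rw [hx, ENNReal.mul_rpow_of_nonneg _ _ (by positivity), ← ENNReal.rpow_mul,
            mul_one_div_cancel hτ.ne', ENNReal.rpow_one]
    have h3 : C * b ^ (1 / τ) * θ⁻¹ * M (k + d) (σ - δ) ≤ C * b ^ (1 / τ) * θ⁻¹ * (s * θ) := by
      calc _ = M (k + d) (σ - δ) * (C * b ^ (1 / τ) * θ⁻¹) := mul_comm _ _
        _ ≤ C * A ^ (1 / (τ * p)) := h1
        _ ≤ C * (b ^ (1 / τ) * s) := mul_le_mul_right h2 _
        _ = C * b ^ (1 / τ) * s * (θ⁻¹ * θ) := by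
          rw [ENNReal.inv_mul_cancel hθ0 hθt, mul_one, mul_assoc]
        _ = _ := by ring
    refine (ENNReal.mul_le_mul_iff_right (mul_ne_zero (mul_ne_zero hC0 hb') ?_)
      (ENNReal.mul_ne_top (ENNReal.mul_ne_top hC hbt') ?_)).1 h3
    · exact ENNReal.inv_ne_zero.2 hθt
    · exact ENNReal.inv_ne_top.2 hθ0
  refine ⟨hM, ?_⟩
  have hW : W (k + d) (σ - δ) ≤ C * (s * θ) ^ ν * x ^ p := by
    have h1 := hc k (k + d) (σ - δ) σ (by linarith) (by linarith) hσ hk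
    rw [show σ - (σ - δ) = δ by ring, ← hAdef] at h1
    exact h1.trans (mul_le_mul' (mul_le_mul_right (ENNReal.rpow_le_rpow hM hν.le) _) hA)
  have hω : 1 ≤ ENNReal.ofReal δ⁻¹ ^ p := by
    refine ENNReal.one_le_rpow ?_ hp0
    rw [← ENNReal.ofReal_one]
    exact ENNReal.ofReal_le_ofReal ((one_le_inv₀ hδ).2 hδ1)
  have hJW : J (k + d) (σ - δ) + W (k + d) (σ - δ) ≤ x ^ p :=
    calc _ ≤ J k σ + 1 * W k σ := by
          rw [one_mul]
          exact add_le_add (Jmono _ _ _ _ hk (by linarith)) (Wmono _ _ _ _ hk (by linarith))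
      _ ≤ A := add_le_add le_rfl (mul_le_mul_left hω _)
      _ ≤ _ := hA
  have hJ : J (k + d) (σ - 2 * δ) ≤ C * (x ^ (q - p) * x ^ p * ENNReal.ofReal δ ^ (-γ)
      + (e * (s * θ) ^ τ) ^ p) := by
    have h1 := ha (k + d) (σ - 2 * δ) (σ - δ) hRσ (by linarith) (by linarith)
    rw [show σ - δ - (σ - 2 * δ) = δ by ring] at h1
    refine h1.trans (mul_le_mul_right (add_le_add (mul_le_mul_left ?_ _) (hG hM)) _)
    calc _ ≤ (x ^ p) ^ (q / p) := ENNReal.rpow_le_rpow hJW (by have := hp0.trans hpq; positivity)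
      _ = x ^ ((q - p) + p) := by
        rw [← ENNReal.rpow_mul]; congr 1; field_simp; ring
      _ = _ := ENNReal.rpow_add_of_nonneg _ _ (by linarith) hp0.le
  have hC' : C ≤ C ^ p := by
    conv_lhs => rw [← ENNReal.rpow_one C]
    exact ENNReal.rpow_le_rpow_of_exponent_le hC1 hp
  calc _ ≤ C * (x ^ (q - p) * x ^ p * ENNReal.ofReal δ ^ (-γ) + (e * (s * θ) ^ τ) ^ p) +
        ENNReal.ofReal (δ / 2)⁻¹ ^ p * (C * (s * θ) ^ ν * x ^ p) :=
      add_le_add hJ (mul_le_mul_right ((Wmono _ _ _ _ le_rfl (by linarith)).trans hW) _)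
    _ = (C * ENNReal.ofReal δ ^ (-γ) * x ^ (q - p) +
        ENNReal.ofReal (δ / 2)⁻¹ ^ p * C * (s * θ) ^ ν) * x ^ p + C * (e * (s * θ) ^ τ) ^ p := by ring
    _ ≤ (2⁻¹ * θ ^ τ) ^ p * x ^ p + C ^ p * (e * (s * θ) ^ τ) ^ p :=
      add_le_add (mul_le_mul_left hη _) (mul_le_mul_left hC' _)
    _ = (2⁻¹ * θ ^ τ * x) ^ p + (C * (e * (s * θ) ^ τ)) ^ p := by
      rw [ENNReal.mul_rpow_of_nonneg _ x hp0.le, ENNReal.mul_rpow_of_nonneg C _ hp0.le]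
    _ ≤ (2⁻¹ * θ ^ τ * x + C * (e * (s * θ) ^ τ)) ^ p := ENNReal.add_rpow_le_rpow_add _ _ hp
    _ = _ := by
      congr 1
      rw [hx, ENNReal.mul_rpow_of_nonneg _ _ hτ.le, div_eq_mul_inv]
      ring

/-- A sequence halved at each step up to a summable perturbation. -/
def halving (a : ℕ → ℝ≥0∞) : ℕ → ℝ≥0∞
  | 0 => 1
  | i + 1 => halving a i / 2 + a (i + 1)

lemma halving_ne_zero (a : ℕ → ℝ≥0∞) (i : ℕ) : halving a i ≠ 0 := by
  induction i with
  | zero => simp [halving]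
  | succ i ih => simp [halving, ih]

lemma sum_halving_le (a : ℕ → ℝ≥0∞) (i : ℕ) :
    ∑ j ∈ Finset.range i, halving a j + 2 * halving a i ≤ 2 + 2 * ∑' j, a j := by
  have h : ∑ j ∈ Finset.range i, halving a j + 2 * halving a i ≤
      2 + 2 * ∑ j ∈ Finset.range (i + 1), a j := by
    induction i with
    | zero => simp [halving]
    | succ i ih =>
      rw [Finset.sum_range_succ, Finset.sum_range_succ a (i + 1)]
      calc _ = ∑ j ∈ Finset.range i, halving a j + halving a i +
            (2 * (halving a i / 2) + 2 * a (i + 1)) := by rw [halving, mul_add]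
        _ = ∑ j ∈ Finset.range i, halving a j + 2 * halving a i + 2 * a (i + 1) := by
          rw [ENNReal.mul_div_cancel (by simp) (by simp)]; ring
        _ ≤ 2 + 2 * ∑ j ∈ Finset.range (i + 1), a j + 2 * a (i + 1) := by gcongr
        _ = _ := by ring
  exact h.trans (by gcongr; exact ENNReal.sum_le_tsum _)

/-- De Giorgi's iteration with a right-hand side summable along a geometric sequence of levels. -/
lemma exists_level_eq_zero {J W M G : ℝ → ℝ → ℝ≥0∞} {p q τ ν γ R : ℝ} {C : ℝ≥0∞} (hp : 1 ≤ p)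
    (hpq : p < q) (hτ : 0 < τ) (hν : 0 < ν) (hR : 0 < R) (hR1 : R ≤ 1) (hC : C ≠ ⊤)
    (hC1 : 1 ≤ C)
    (Jmono : ∀ k k' ρ σ, k ≤ k' → ρ ≤ σ → J k' ρ ≤ J k σ)
    (Wmono : ∀ k k' ρ σ, k ≤ k' → ρ ≤ σ → W k' ρ ≤ W k σ)
    (Mmono : ∀ k k' ρ σ, k ≤ k' → ρ ≤ σ → M k' ρ ≤ M k σ)
    (ha : ∀ k ρ σ, R ≤ ρ → ρ < σ → σ ≤ 2 * R →
      J k ρ ≤ C * ((J k σ + W k σ) ^ (q / p) * ENNReal.ofReal (σ - ρ) ^ (-γ) + G k σ))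
    (hb : ∀ k k' ρ σ, R ≤ ρ → ρ < σ → σ ≤ 2 * R → k ≤ k' → M k' ρ * ENNReal.ofReal (k' - k) ^ (1 / τ) ≤
      C * (J k σ + ENNReal.ofReal (σ - ρ)⁻¹ ^ p * W k σ) ^ (1 / (τ * p)))
    (hc : ∀ k k' ρ σ, R ≤ ρ → ρ < σ → σ ≤ 2 * R → k ≤ k' →
      W k' ρ ≤ C * M k' ρ ^ ν * (J k σ + ENNReal.ofReal (σ - ρ)⁻¹ ^ p * W k σ))
    (hd : ∀ θ : ℝ≥0∞, θ ≠ 0 → θ < 1 → ∃ E : ℝ≥0∞, E ≠ ⊤ ∧ ∀ S₀ : ℝ≥0∞, S₀ ≠ 0 → ∃ S ≠ 0, S ≤ S₀ ∧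
      ∃ e : ℕ → ℝ≥0∞, ∑' i, e i ≤ E ∧ ∀ i k ρ, R ≤ ρ → ρ ≤ 2 * R → M k ρ ≤ S * θ ^ i →
        G k ρ ≤ (e i * (S * θ ^ i) ^ τ) ^ p)
    (he : ∀ ε : ℝ≥0∞, ε ≠ 0 → ∃ k, J k (2 * R) + W k (2 * R) ≤ ε) :
    ∃ k, M k R = 0 := by
  have hp0 : 0 < p := by linarith
  have hq0 : 0 < q := by linarith
  have hqp : 0 < q - p := by linarith
  have hC0 : C ≠ 0 := (zero_lt_one.trans_le hC1).ne'
  obtain ⟨θ, hθ0, hθ1, hθa, hθb⟩ := exists_ne_zero_of_eventually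
    ((eventually_mul_rpow_le (c := 2 ^ γ) (ENNReal.rpow_ne_top_of_ne_zero (by simp) (by simp))
      one_ne_zero (mul_pos hτ hqp)).and
    (eventually_mul_rpow_le (c := 2 ^ p) (by simp) one_ne_zero hν))
  have hθt : θ ≠ ⊤ := ne_top_of_lt hθ1
  obtain ⟨E, hE, hd⟩ := hd θ hθ0 hθ1
  set B := 2 + 2 * C * E with hB
  have hBt : B ≠ ⊤ := ENNReal.add_ne_top.2 ⟨by simp, ENNReal.mul_ne_top (ENNReal.mul_ne_top (by simp) hC) hE⟩
  set r := ENNReal.ofReal (R / 4) with hr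
  have hr0 : r ≠ 0 := by simpa [hr] using hR
  have hrt : r ≠ ⊤ := ENNReal.ofReal_ne_top
  set η := (2⁻¹ * θ ^ τ) ^ p with hη
  have hη0 : η ≠ 0 := by
    have h1 : 2⁻¹ * θ ^ τ ≠ 0 := mul_ne_zero (by simp) (by simp [hθ0, hθt])
    have h2 : 2⁻¹ * θ ^ τ ≠ ⊤ := ENNReal.mul_ne_top (by simp) (ENNReal.rpow_ne_top_of_nonneg hτ.le hθt)
    simp [hη, h1, h2]
  have hη2 : η / 2 ≠ 0 := (ENNReal.half_pos hη0).ne'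
  obtain ⟨S₀, hS₀0, hS₀1, hS₀⟩ := exists_ne_zero_of_eventually
    ((eventually_mul_rpow_le (ENNReal.mul_ne_top (ENNReal.mul_ne_top hC
        (ENNReal.rpow_ne_top_of_ne_zero hr0 hrt)) (ENNReal.rpow_ne_top_of_nonneg hqp.le hBt)) hη2
          (mul_pos hτ hqp)).and
        (eventually_mul_rpow_le (ENNReal.mul_ne_top (ENNReal.rpow_ne_top_of_nonneg hp0.le
          (ENNReal.inv_ne_top.2 hr0)) hC) hη2 hν))
  obtain ⟨S, hS0, hSS, e, heE, hG⟩ := hd S₀ hS₀0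
  have hSt : S ≠ ⊤ := ne_top_of_le_ne_top (ne_top_of_lt hS₀1) hSS
  set a : ℕ → ℝ≥0∞ := fun i => C * e i with hadef
  set b := halving a with hbdef
  have hsum : ∀ i, ∑ j ∈ Finset.range i, b j + 2 * b i ≤ B := fun i => by
    refine (sum_halving_le a i).trans ?_
    rw [ENNReal.tsum_mul_left, hB, ← mul_assoc]
    gcongr
  have hbB : ∀ i, b i ≤ B := fun i => by
    refine le_trans ?_ (hsum i)
    rw [two_mul, ← add_assoc]
    exact le_add_self
  have hb0 : ∀ i, b i ≠ 0 := halving_ne_zero a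
  have hbt : ∀ i, b i ≠ ⊤ := fun i => ne_top_of_le_ne_top hBt (hbB i)
  have hbsum : ∑' i, b i ≤ B := ENNReal.tsum_le_of_sum_range_le fun i =>
    le_trans le_self_add (hsum i)
  set D : ℕ → ℝ≥0∞ := fun i => (C * b i ^ (1 / τ) * θ⁻¹) ^ τ with hDdef
  have hDeq : ∀ i, D i = C ^ τ * θ⁻¹ ^ τ * b i := fun i => by
    simp only [hDdef]
    rw [ENNReal.mul_rpow_of_nonneg _ _ hτ.le, ENNReal.mul_rpow_of_nonneg _ _ hτ.le,
      ← ENNReal.rpow_mul, one_div_mul_cancel hτ.ne', ENNReal.rpow_one]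
    ring
  have hDsum : ∑' i, D i ≠ ⊤ := by
    simp only [hDeq]
    rw [ENNReal.tsum_mul_left]
    exact ENNReal.mul_ne_top (ENNReal.mul_ne_top (ENNReal.rpow_ne_top_of_nonneg hτ.le hC)
      (ENNReal.rpow_ne_top_of_nonneg hτ.le (ENNReal.inv_ne_top.2 hθ0)))
      (ne_top_of_le_ne_top hBt hbsum)
  set d : ℕ → ℝ := fun i => (D i).toReal with hddef
  have hd0 : ∀ i, 0 ≤ d i := fun i => ENNReal.toReal_nonneg
  have hdsum : Summable d := ENNReal.summable_toReal hDsum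
  have hdD : ∀ i, ENNReal.ofReal (d i) ^ (1 / τ) = C * b i ^ (1 / τ) * θ⁻¹ := fun i => by
    rw [hddef, ENNReal.ofReal_toReal (ENNReal.ne_top_of_tsum_ne_top hDsum i), hDdef,
      ← ENNReal.rpow_mul, mul_one_div_cancel hτ.ne', ENNReal.rpow_one]
  set δ : ℕ → ℝ := fun i => R / 4 * (1 / 2) ^ i with hδdef
  have hδ0 : ∀ i, 0 < δ i := fun i => by positivity
  have hδr : ∀ i, ENNReal.ofReal (δ i) = r * 2⁻¹ ^ i := fun i => by
    rw [hδdef, ENNReal.ofReal_mul (by positivity), ENNReal.ofReal_pow (by norm_num), one_div,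
      ENNReal.ofReal_inv_of_pos two_pos]
    simp [hr]
  have hδs : ∀ i, δ (i + 1) = δ i / 2 := fun i => by simp only [hδdef, pow_succ]; ring
  have hδle : ∀ i, 4 * δ i ≤ R := fun i => by
    have : ((1 : ℝ) / 2) ^ i ≤ 1 := pow_le_one₀ (by norm_num) (by norm_num)
    simp only [hδdef]; nlinarith
  have hω : ∀ i, ENNReal.ofReal (δ i)⁻¹ ^ p = r⁻¹ ^ p * (2 ^ p) ^ i := fun i => by
    rw [ENNReal.ofReal_inv_of_pos (hδ0 i), hδr, ENNReal.mul_inv (Or.inl hr0) (Or.inl hrt),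
      ENNReal.mul_rpow_of_nonneg _ _ hp0.le, ENNReal.inv_pow, inv_inv, ← ENNReal.rpow_natCast,
      ← ENNReal.rpow_natCast, ← ENNReal.rpow_mul, ← ENNReal.rpow_mul, mul_comm p]
  have hγ : ∀ i, ENNReal.ofReal (δ i) ^ (-γ) = r ^ (-γ) * (2 ^ γ) ^ i := fun i => by
    rw [hδr, ENNReal.mul_rpow_of_ne_zero hr0 (by simp), ← ENNReal.rpow_natCast,
      ← ENNReal.rpow_natCast, ← ENNReal.rpow_mul, ← ENNReal.rpow_mul, ENNReal.inv_rpow,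
      ← ENNReal.rpow_neg, mul_neg, neg_neg, mul_comm γ]
  have hsp : ∀ (α : ℝ), 0 ≤ α → ∀ i : ℕ, (S * θ ^ i) ^ α = S ^ α * (θ ^ α) ^ i := fun α hα i => by
    rw [ENNReal.mul_rpow_of_nonneg _ _ hα, ← ENNReal.rpow_natCast, ← ENNReal.rpow_natCast,
      ← ENNReal.rpow_mul, ← ENNReal.rpow_mul, mul_comm α]
  have hηi : ∀ i, C * ENNReal.ofReal (δ i) ^ (-γ) * (b i * (S * θ ^ i) ^ τ) ^ (q - p) +
      ENNReal.ofReal (δ i / 2)⁻¹ ^ p * C * (S * θ ^ i * θ) ^ ν ≤ η := fun i => by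
    rw [← ENNReal.add_halves η]
    refine add_le_add ?_ ?_
    · rw [hγ, ENNReal.mul_rpow_of_nonneg _ _ hqp.le, ← ENNReal.rpow_mul,
        hsp _ (mul_pos hτ hqp).le]
      calc _ = C * r ^ (-γ) * b i ^ (q - p) * S ^ (τ * (q - p)) *
            (2 ^ γ * θ ^ (τ * (q - p))) ^ i := by rw [mul_pow]; ring
        _ ≤ C * r ^ (-γ) * B ^ (q - p) * S₀ ^ (τ * (q - p)) * 1 :=
          mul_le_mul' (mul_le_mul' (mul_le_mul_right (ENNReal.rpow_le_rpow (hbB i) hqp.le) _)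
            (ENNReal.rpow_le_rpow hSS (mul_pos hτ hqp).le)) (pow_le_one' hθa i)
        _ ≤ _ := by rw [mul_one]; exact hS₀.1
    · rw [← hδs, hω, mul_assoc S, ← pow_succ, hsp _ hν.le]
      calc _ = r⁻¹ ^ p * C * S ^ ν * (2 ^ p * θ ^ ν) ^ (i + 1) := by rw [mul_pow]; ring
        _ ≤ r⁻¹ ^ p * C * S₀ ^ ν * 1 :=
          mul_le_mul' (mul_le_mul_right (ENNReal.rpow_le_rpow hSS hν.le) _)
            (pow_le_one' hθb _)
        _ ≤ _ := by rw [mul_one]; exact hS₀.2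
  have hω0 : ENNReal.ofReal (δ 0)⁻¹ ^ p ≠ ⊤ := ENNReal.rpow_ne_top_of_nonneg hp0.le (by simp)
  have hω1 : 1 ≤ ENNReal.ofReal (δ 0)⁻¹ ^ p := by
    refine ENNReal.one_le_rpow ?_ hp0
    rw [← ENNReal.ofReal_one]
    exact ENNReal.ofReal_le_ofReal ((one_le_inv₀ (hδ0 0)).2 (by have := hδle 0; have := hδ0 0; linarith))
  have hSτ : (S ^ τ) ^ p ≠ 0 := by
    rw [← ENNReal.rpow_mul]
    simp [hS0, hSt]
  obtain ⟨k₀, hk₀⟩ := he ((ENNReal.ofReal (δ 0)⁻¹ ^ p)⁻¹ * (S ^ τ) ^ p)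
    (mul_ne_zero (ENNReal.inv_ne_zero.2 hω0) hSτ)
  set k : ℕ → ℝ := fun i => k₀ + ∑ j ∈ Finset.range i, d j with hkdef
  have hks : ∀ i, k (i + 1) = k i + d i := fun i => by
    simp only [hkdef, Finset.sum_range_succ]; ring
  set σ : ℕ → ℝ := fun i => R + 4 * δ i with hσdef
  have hσs : ∀ i, σ (i + 1) = σ i - 2 * δ i := fun i => by simp only [hσdef, hδs]; ring
  have hstep : ∀ i, J (k i) (σ i) + ENNReal.ofReal (δ i)⁻¹ ^ p * W (k i) (σ i) ≤
      (b i * (S * θ ^ i) ^ τ) ^ p → M (k (i + 1)) (σ i - δ i) ≤ S * θ ^ (i + 1) ∧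
      J (k (i + 1)) (σ (i + 1)) + ENNReal.ofReal (δ (i + 1))⁻¹ ^ p * W (k (i + 1)) (σ (i + 1)) ≤
      (b (i + 1) * (S * θ ^ (i + 1)) ^ τ) ^ p := fun i hi => by
    have h1 : b (i + 1) = b i / 2 + C * e (i + 1) := rfl
    rw [h1, hδs, hσs, hks, pow_succ, ← mul_assoc S]
    have h2 := hδ0 i
    have h3 := hδle i
    refine level_step hp hpq hτ hν hC hC1 Jmono Wmono ha hb hc hθ0 hθt (hb0 i) (hbt i) (hd0 i)
      (hdD i) h2 (by linarith) ?_ ?_ hi ?_ (hηi i)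
    · simp only [hσdef]; linarith
    · simp only [hσdef]; linarith
    · intro h
      have := hG (i + 1) (k i + d i) (σ i - δ i) (by simp only [hσdef]; linarith)
        (by simp only [hσdef]; linarith)
      rw [pow_succ, ← mul_assoc S] at this
      exact this h
  have hind : ∀ i, J (k i) (σ i) + ENNReal.ofReal (δ i)⁻¹ ^ p * W (k i) (σ i) ≤
      (b i * (S * θ ^ i) ^ τ) ^ p := by
    intro i
    induction i with
    | zero =>
      have h1 : σ 0 = 2 * R := by simp only [hσdef, hδdef]; ring
      have h2 : b 0 = 1 := rfl
      have h3 : k 0 = k₀ := by simp [hkdef]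
      rw [h1, h2, h3, one_mul, pow_zero, mul_one]
      calc _ ≤ ENNReal.ofReal (δ 0)⁻¹ ^ p * (J k₀ (2 * R) + W k₀ (2 * R)) := by
            rw [mul_add]
            refine add_le_add ?_ le_rfl
            calc _ = 1 * J k₀ (2 * R) := (one_mul _).symm
              _ ≤ _ := mul_le_mul_left hω1 _
        _ ≤ ENNReal.ofReal (δ 0)⁻¹ ^ p * ((ENNReal.ofReal (δ 0)⁻¹ ^ p)⁻¹ * (S ^ τ) ^ p) :=
          mul_le_mul_right hk₀ _
        _ = _ := by
          rw [← mul_assoc, ENNReal.mul_inv_cancel (zero_lt_one.trans_le hω1).ne' hω0, one_mul]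
    | succ i ih => exact (hstep i ih).2
  refine ⟨k₀ + ∑' i, d i, ?_⟩
  have hlim : Tendsto (fun i => S * θ ^ (i + 1)) atTop (𝓝 0) := by
    have := ENNReal.Tendsto.const_mul (a := S) ((ENNReal.tendsto_pow_atTop_nhds_zero_of_lt_one
      hθ1).comp (tendsto_add_atTop_nat 1)) (Or.inr hSt)
    simpa using this
  refine le_antisymm (ge_of_tendsto' hlim fun i => ?_) bot_le
  refine le_trans (Mmono _ _ _ _ ?_ ?_) (hstep i (hind i)).1
  · simp only [hkdef]
    gcongr
    exact hdsum.sum_le_tsum _ fun j _ => hd0 j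
  · have := hδ0 i
    simp only [hσdef]; linarith

end DeGiorgi

section Rearrangement

open Filter
variable {n : ℕ} {v : 𝔼 n → ℝ}

lemma bddBelow_rearr (t : ℝ) :
    BddBelow {σ : ℝ | 0 < σ ∧ volume {x | σ < |v x|} ≤ ENNReal.ofReal t} :=
  ⟨0, fun _ h => h.1.le⟩

lemma rearr_nonneg (t : ℝ) : 0 ≤ rearr n v t := Real.sInf_nonneg fun _ h => h.1.le

lemma rearr_nonempty (hv : Measurable v) {T : Set (𝔼 n)} (hT : volume T ≠ ⊤)
    (hvT : ∀ x, x ∉ T → v x = 0) {t : ℝ} (ht : 0 < t) :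
    {σ : ℝ | 0 < σ ∧ volume {x | σ < |v x|} ≤ ENNReal.ofReal t}.Nonempty := by
  have h1 := tendsto_measure_iInter_atTop (μ := (volume : Measure (𝔼 n)))
    (s := fun i : ℕ => {x | (i : ℝ) < |v x|})
    (fun i => (measurableSet_lt measurable_const hv.abs).nullMeasurableSet)
    (fun i j hij x (hx : (j : ℝ) < |v x|) =>
      show (i : ℝ) < |v x| from lt_of_le_of_lt (Nat.cast_le.2 hij) hx)
    ⟨0, ne_top_of_le_ne_top hT (measure_mono fun x hx => by
      by_contra h
      simp [hvT x h] at hx)⟩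
  have h2 : ⋂ i : ℕ, {x | (i : ℝ) < |v x|} = ∅ := by
    refine eq_empty_of_forall_notMem fun x hx => ?_
    obtain ⟨i, hi⟩ := exists_nat_gt |v x|
    exact lt_asymm hi (mem_iInter.1 hx i)
  rw [h2, measure_empty] at h1
  obtain ⟨i, hi1, hi2⟩ := ((h1.eventually (gt_mem_nhds (ENNReal.ofReal_pos.2 ht))).and
    (eventually_ge_atTop 1)).exists
  exact ⟨i, by exact_mod_cast hi2, hi1.le⟩

lemma rearr_anti (hv : Measurable v) {T : Set (𝔼 n)} (hT : volume T ≠ ⊤)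
    (hvT : ∀ x, x ∉ T → v x = 0) {s t : ℝ} (hs : 0 < s) (hst : s ≤ t) :
    rearr n v t ≤ rearr n v s :=
  csInf_le_csInf (bddBelow_rearr t) (rearr_nonempty hv hT hvT hs) fun _ h =>
    ⟨h.1, h.2.trans (ENNReal.ofReal_le_ofReal hst)⟩

lemma volume_rearr_lt_le (hv : Measurable v) {T : Set (𝔼 n)} (hT : volume T ≠ ⊤)
    (hvT : ∀ x, x ∉ T → v x = 0) {t : ℝ} (ht : 0 < t) :
    volume {x | rearr n v t < |v x|} ≤ ENNReal.ofReal t := by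
  have h1 : {x | rearr n v t < |v x|} = ⋃ i : ℕ, {x | rearr n v t + 1 / (i + 1 : ℝ) < |v x|} := by
    ext x
    simp only [mem_iUnion, mem_ofPred_eq]
    constructor
    · intro h
      obtain ⟨i, hi⟩ := exists_nat_one_div_lt (sub_pos.2 h)
      exact ⟨i, by linarith⟩
    · rintro ⟨i, hi⟩
      have : (0 : ℝ) < 1 / (i + 1 : ℝ) := by positivity
      linarith
  rw [h1, Monotone.measure_iUnion]
  · refine iSup_le fun i => ?_
    obtain ⟨σ, hσ, hlt⟩ := exists_lt_of_csInf_lt (rearr_nonempty hv hT hvT ht)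
      (show sInf _ < rearr n v t + 1 / (i + 1 : ℝ) from lt_add_of_pos_right _ (by positivity))
    exact (measure_mono fun x hx => hlt.trans hx).trans hσ.2
  · intro i j hij x (hx : rearr n v t + 1 / (i + 1 : ℝ) < |v x|)
    refine lt_of_le_of_lt (b := rearr n v t + 1 / (i + 1 : ℝ)) ?_ hx
    gcongr

lemma tsum_rpow_le {p : ℝ} (hp : 1 ≤ p) (a : ℕ → ℝ≥0∞) : ∑' i, a i ^ p ≤ (∑' i, a i) ^ p := by
  refine ENNReal.tsum_le_of_sum_range_le fun N => ?_
  refine le_trans ?_ (ENNReal.rpow_le_rpow (ENNReal.sum_le_tsum (Finset.range N)) (by linarith))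
  induction N with
  | zero => simp
  | succ N ih =>
    rw [Finset.sum_range_succ, Finset.sum_range_succ]
    exact (add_le_add ih le_rfl).trans (ENNReal.add_rpow_le_rpow_add _ _ hp)

/-- Layering a set of small measure along the levels of the rearrangement. -/
lemma lintegral_rpow_le_tsum_rearr (hv : Measurable v) {T : Set (𝔼 n)} (hT : volume T ≠ ⊤)
    (hvT : ∀ x, x ∉ T → v x = 0) {p : ℝ} (hp : 1 ≤ p) {s : ℕ → ℝ} (hs : ∀ i, 0 < s i)
    (hs0 : Tendsto s atTop (𝓝 0)) {A : Set (𝔼 n)} (hA : MeasurableSet A)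
    (hAs : volume A ≤ ENNReal.ofReal (s 0)) :
    ∫⁻ x in A, ENNReal.ofReal |v x| ^ p ≤
      (∑' m, ENNReal.ofReal (rearr n v (s (m + 1))) * ENNReal.ofReal (s m) ^ (1 / p)) ^ p := by
  have hp0 : 0 < p := by linarith
  set τ : ℕ → Set (𝔼 n) := fun m => {x | rearr n v (s m) < |v x|} with hτ
  have hτm : ∀ m, MeasurableSet (τ m) := fun m => measurableSet_lt measurable_const hv.abs
  set B : ℕ → Set (𝔼 n) := fun m => if m = 0 then A else τ m with hB
  have hBm : ∀ m, MeasurableSet (B m) := fun m => by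
    by_cases h : m = 0
    · simp only [hB, h, if_true]; exact hA
    · simp only [hB, h, if_false]; exact hτm m
  have hBs : ∀ m, volume (B m) ≤ ENNReal.ofReal (s m) := fun m => by
    by_cases h : m = 0
    · simp only [hB, h, if_true]; exact hAs
    · simp only [hB, h, if_false]; exact volume_rearr_lt_le hv hT hvT (hs m)
  have hnull : ∀ᵐ x, ∃ m, x ∉ τ (m + 1) := by
    rw [ae_iff]
    refine le_antisymm ?_ bot_le
    have h1 : Tendsto (fun m => ENNReal.ofReal (s (m + 1))) atTop (𝓝 0) := by
      have := ENNReal.tendsto_ofReal (hs0.comp (tendsto_add_atTop_nat 1))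
      simpa using this
    refine ge_of_tendsto' h1 fun m => ?_
    refine (measure_mono fun x hx => ?_).trans (volume_rearr_lt_le hv hT hvT (hs (m + 1)))
    simp only [mem_ofPred_eq, not_exists, not_not] at hx
    exact hx m
  have hpt : ∀ᵐ x ∂volume.restrict A, ENNReal.ofReal |v x| ^ p ≤
      ∑' m, (B m).indicator (fun _ => ENNReal.ofReal (rearr n v (s (m + 1))) ^ p) x := by
    filter_upwards [ae_restrict_of_ae hnull, ae_restrict_mem hA] with x hx hxA
    classical
    have h1 := Nat.find_spec hx
    have h2 : x ∈ B (Nat.find hx) := by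
      by_cases h : Nat.find hx = 0
      · simp only [hB, h, if_true]; exact hxA
      · simp only [hB, h, if_false]
        have h3 := Nat.find_min hx (Nat.sub_one_lt h)
        rw [not_not, Nat.sub_one_add_one h] at h3
        exact h3
    refine le_trans ?_ (ENNReal.le_tsum (Nat.find hx))
    rw [indicator_of_mem h2]
    exact ENNReal.rpow_le_rpow (ENNReal.ofReal_le_ofReal (not_lt.1 h1)) hp0.le
  calc _ ≤ ∫⁻ x in A, ∑' m, (B m).indicator
        (fun _ => ENNReal.ofReal (rearr n v (s (m + 1))) ^ p) x := lintegral_mono_ae hpt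
    _ ≤ ∫⁻ x, ∑' m, (B m).indicator
        (fun _ => ENNReal.ofReal (rearr n v (s (m + 1))) ^ p) x := setLIntegral_le_lintegral _ _
    _ = ∑' m, ENNReal.ofReal (rearr n v (s (m + 1))) ^ p * volume (B m) := by
      rw [lintegral_tsum fun m => (measurable_const.indicator (hBm m)).aemeasurable]
      congr 1 with m
      rw [lintegral_indicator_const (hBm m)]
    _ ≤ ∑' m, (ENNReal.ofReal (rearr n v (s (m + 1))) * ENNReal.ofReal (s m) ^ (1 / p)) ^ p := by
      refine ENNReal.tsum_le_tsum fun m => ?_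
      rw [ENNReal.mul_rpow_of_nonneg _ _ hp0.le, ← ENNReal.rpow_mul, one_div_mul_cancel hp0.ne',
        ENNReal.rpow_one]
      exact mul_le_mul_right (hBs m) _
    _ ≤ _ := tsum_rpow_le hp _

/-- The Lorentz norm controls the geometric sum of the rearrangement. -/
lemma exists_tsum_rearr_le {θ : ℝ} (hθ0 : 0 < θ) (hθ1 : θ < 1) (n : ℕ) :
    ∃ c : ℝ≥0∞, c ≠ ⊤ ∧ ∀ {v : 𝔼 n → ℝ}, Measurable v → ∀ {T : Set (𝔼 n)}, volume T ≠ ⊤ →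
      (∀ x, x ∉ T → v x = 0) → ∀ {S : ℝ}, 0 < S → ENNReal.ofReal S ≤ volume T →
      ∑' j : ℕ, ENNReal.ofReal (rearr n v (S * θ ^ (j + 1))) *
        ENNReal.ofReal (S * θ ^ j) ^ (1 / (n : ℝ)) ≤
      c * ∫⁻ t in Ioo (0 : ℝ) (volume T).toReal,
        ENNReal.ofReal (t ^ (1 / (n : ℝ)) * rearr n v t / t) := by
  set a := θ ^ (2 * (1 / (n : ℝ))) * (1 - θ) with ha
  have ha0 : 0 < a := mul_pos (Real.rpow_pos_of_pos hθ0 _) (by linarith)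
  refine ⟨ENNReal.ofReal a⁻¹, ENNReal.ofReal_ne_top, ?_⟩
  intro v hv T hT hvT S hS hST
  set s : ℕ → ℝ := fun j => S * θ ^ j with hs
  have hs0 : ∀ j, 0 < s j := fun j => by positivity
  have hss : ∀ j, s (j + 1) = θ * s j := fun j => by simp only [hs, pow_succ]; ring
  have hanti : Antitone s := antitone_nat_of_succ_le fun j => by
    rw [hss]; nlinarith [hs0 j]
  have hdisj : Pairwise (Function.onFun Disjoint fun j : ℕ => Ioo (s (j + 2)) (s (j + 1))) := by
    have h1 : Antitone fun j => s (j + 1) := fun i j hij => hanti (by omega)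
    exact h1.pairwise_disjoint_on_Ioo_succ
  have hone : ∀ j, ENNReal.ofReal (rearr n v (s (j + 1))) * ENNReal.ofReal (s j) ^ (1 / (n : ℝ)) ≤
      ENNReal.ofReal a⁻¹ * ∫⁻ t in Ioo (s (j + 2)) (s (j + 1)),
        ENNReal.ofReal (t ^ (1 / (n : ℝ)) * rearr n v t / t) := fun j => by
    have h2 : s (j + 2) = θ * (θ * s j) := by rw [hss, hss]
    have h1 : ENNReal.ofReal (s (j + 2) ^ (1 / (n : ℝ)) * rearr n v (s (j + 1)) / s (j + 1)) *
        ENNReal.ofReal (s (j + 1) - s (j + 2)) ≤ ∫⁻ t in Ioo (s (j + 2)) (s (j + 1)),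
        ENNReal.ofReal (t ^ (1 / (n : ℝ)) * rearr n v t / t) := by
      rw [← Real.volume_Ioo, ← setLIntegral_const]
      refine setLIntegral_mono' measurableSet_Ioo fun t ht => ENNReal.ofReal_le_ofReal ?_
      have ht0 : 0 < t := (hs0 _).trans ht.1
      have h3 := rearr_anti hv hT hvT ht0 ht.2.le
      have h4 := rearr_nonneg (v := v) (s (j + 1))
      have h5 := (hs0 (j + 2)).le
      have h6 := ht.1.le
      have h7 := ht.2.le
      have h8 := mul_nonneg (Real.rpow_nonneg ht0.le (1 / (n : ℝ))) (h4.trans h3)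
      gcongr
    refine le_trans (le_of_eq ?_) (mul_le_mul_right h1 _)
    have h4 := rearr_nonneg (v := v) (s (j + 1))
    have h5 := hs0 j
    rw [← ENNReal.ofReal_mul (by have := hs0 (j + 2); have := hs0 (j + 1); positivity),
      ← ENNReal.ofReal_mul (by positivity), ENNReal.ofReal_rpow_of_nonneg h5.le (by positivity),
      ← ENNReal.ofReal_mul h4]
    congr 1
    have h8 : s (j + 2) ^ (1 / (n : ℝ)) = θ ^ (2 * (1 / (n : ℝ))) * s j ^ (1 / (n : ℝ)) := by
      rw [h2, ← mul_assoc, Real.mul_rpow (by positivity) h5.le, Real.rpow_mul hθ0.le]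
      congr 2
      norm_cast
      ring
    rw [h8, h2, hss, ha]
    have h9 : (1 - θ) ≠ 0 := by linarith
    have h10 : θ ^ (2 * (1 / (n : ℝ))) ≠ 0 := (Real.rpow_pos_of_pos hθ0 _).ne'
    generalize θ ^ (2 * (1 / (n : ℝ))) = y at *
    field_simp
  calc _ ≤ ∑' j, ENNReal.ofReal a⁻¹ * ∫⁻ t in Ioo (s (j + 2)) (s (j + 1)),
        ENNReal.ofReal (t ^ (1 / (n : ℝ)) * rearr n v t / t) := ENNReal.tsum_le_tsum hone
    _ = ENNReal.ofReal a⁻¹ * ∫⁻ t in ⋃ j, Ioo (s (j + 2)) (s (j + 1)),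
        ENNReal.ofReal (t ^ (1 / (n : ℝ)) * rearr n v t / t) := by
      rw [ENNReal.tsum_mul_left, lintegral_iUnion (fun _ => measurableSet_Ioo) hdisj]
    _ ≤ _ := by
      refine mul_le_mul_right (lintegral_mono_set (iUnion_subset fun j t ht => ?_)) _
      refine ⟨(hs0 _).trans ht.1, ht.2.trans_le ((hanti (Nat.zero_le _)).trans ?_)⟩
      simp only [hs, pow_zero, mul_one]
      exact (ENNReal.ofReal_le_iff_le_toReal hT).1 hST

/-- Membership in `L^{n,1}` makes the excess of `h ^ p` over sets of geometrically small measure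
summable. -/
lemma exists_summable_excess {Ω : Set (𝔼 n)} (hΩ : MeasurableSet Ω) (hΩt : volume Ω ≠ ⊤)
    (hΩ0 : volume Ω ≠ 0) {h : 𝔼 n → ℝ} (hh : Measurable h) (hh0 : ∀ x, 0 ≤ h x) {p : ℝ}
    (hp : 1 ≤ p) (hpn : p < n) (hL : lorentzN1 n Ω h ≠ ⊤) {θ : ℝ≥0∞} (hθ0 : θ ≠ 0)
    (hθ1 : θ < 1) :
    ∃ E : ℝ≥0∞, E ≠ ⊤ ∧ ∀ S₀ : ℝ≥0∞, S₀ ≠ 0 → ∃ S ≠ 0, S ≤ S₀ ∧ ∃ e : ℕ → ℝ≥0∞, ∑' i, e i ≤ E ∧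
      ∀ i, ∀ A ⊆ Ω, MeasurableSet A → volume A ≤ S * θ ^ i →
        ∫⁻ x in A, ENNReal.ofReal (h x) ^ p ≤ (e i * (S * θ ^ i) ^ (1 / p - 1 / (n : ℝ))) ^ p := by
  have hp0 : 0 < p := by linarith
  have hτ : 0 < 1 / p - 1 / (n : ℝ) := sub_pos.2 (one_div_lt_one_div_of_lt hp0 hpn)
  set τ := 1 / p - 1 / (n : ℝ) with hτdef
  have hθt : θ ≠ ⊤ := ne_top_of_lt hθ1
  have hθr0 : 0 < θ.toReal := ENNReal.toReal_pos hθ0 hθt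
  have hθr1 : θ.toReal < 1 := by
    rw [← ENNReal.toReal_one]; exact ENNReal.toReal_strict_mono (by simp) hθ1
  obtain ⟨c, hc, hcb⟩ := exists_tsum_rearr_le hθr0 hθr1 n
  have hθτ : θ ^ τ < 1 := ENNReal.rpow_lt_one hθ1 hτ
  refine ⟨(1 - θ ^ τ)⁻¹ * (c * lorentzN1 n Ω h), ENNReal.mul_ne_top
    (ENNReal.inv_ne_top.2 (tsub_pos_of_lt hθτ).ne') (ENNReal.mul_ne_top hc hL), ?_⟩
  intro S₀ hS₀
  set S := min S₀ (volume Ω) with hSdef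
  have hS0 : S ≠ 0 := (lt_min (pos_iff_ne_zero.2 hS₀) (pos_iff_ne_zero.2 hΩ0)).ne'
  have hSt : S ≠ ⊤ := ne_top_of_le_ne_top hΩt (min_le_right _ _)
  have hSr : 0 < S.toReal := ENNReal.toReal_pos hS0 hSt
  set v := Ω.indicator h with hv
  have hvm : Measurable v := hh.indicator hΩ
  have hvT : ∀ x, x ∉ Ω → v x = 0 := fun x hx => indicator_of_notMem hx _
  have hsr : ∀ j : ℕ, ENNReal.ofReal (S.toReal * θ.toReal ^ j) = S * θ ^ j := fun j => by
    rw [ENNReal.ofReal_mul ENNReal.toReal_nonneg, ENNReal.ofReal_pow ENNReal.toReal_nonneg,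
      ENNReal.ofReal_toReal hSt, ENNReal.ofReal_toReal hθt]
  set a : ℕ → ℝ≥0∞ := fun i => ∑' m, ENNReal.ofReal (rearr n v (S.toReal * θ.toReal ^ (i + m + 1)))
    * (S * θ ^ (i + m)) ^ (1 / p) with ha
  have hs0 : ∀ j : ℕ, S * θ ^ j ≠ 0 := fun j => mul_ne_zero hS0 (pow_ne_zero _ hθ0)
  have hst : ∀ j : ℕ, S * θ ^ j ≠ ⊤ := fun j => ENNReal.mul_ne_top hSt (ENNReal.pow_ne_top hθt)
  refine ⟨S, hS0, min_le_left _ _, fun i => a i * (S * θ ^ i) ^ (-τ), ?_, ?_⟩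
  · set w : ℕ → ℝ≥0∞ := fun j => ENNReal.ofReal (rearr n v (S.toReal * θ.toReal ^ (j + 1))) *
      (S * θ ^ j) ^ (1 / (n : ℝ)) with hw
    have hwsum : ∑' j, w j ≤ c * lorentzN1 n Ω h := by
      have := hcb hvm hΩt hvT hSr (by rw [ENNReal.ofReal_toReal hSt]; exact min_le_right _ _)
      simp only [hsr] at this
      exact this
    have hterm : ∀ i, a i * (S * θ ^ i) ^ (-τ) = ∑' m, (θ ^ τ) ^ m * w (i + m) := fun i => by
      rw [ha, ← ENNReal.tsum_mul_right]
      congr 1 with m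
      have h1 : (S * θ ^ (i + m)) ^ (1 / p) * (S * θ ^ i) ^ (-τ) =
          (θ ^ τ) ^ m * (S * θ ^ (i + m)) ^ (1 / (n : ℝ)) := by
        have h2 : 1 / p = τ + 1 / (n : ℝ) := by rw [hτdef]; ring
        have h3 : (S * θ ^ (i + m)) ^ τ = (S * θ ^ i) ^ τ * (θ ^ τ) ^ m := by
          rw [pow_add, ← mul_assoc, ENNReal.mul_rpow_of_nonneg _ _ hτ.le, ← ENNReal.rpow_natCast θ m,
            ← ENNReal.rpow_natCast (θ ^ τ) m, ← ENNReal.rpow_mul, ← ENNReal.rpow_mul, mul_comm τ]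
        rw [h2, ENNReal.rpow_add _ _ (hs0 _) (hst _), h3]
        calc _ = (S * θ ^ i) ^ τ * (S * θ ^ i) ^ (-τ) *
              ((θ ^ τ) ^ m * (S * θ ^ (i + m)) ^ (1 / (n : ℝ))) := by ring
          _ = _ := by
            rw [← ENNReal.rpow_add _ _ (hs0 _) (hst _), add_neg_cancel, ENNReal.rpow_zero, one_mul]
      rw [mul_assoc, h1, hw]
      ring
    simp only [hterm]
    rw [ENNReal.tsum_comm]
    simp only [ENNReal.tsum_mul_left]
    calc _ ≤ ∑' m : ℕ, (θ ^ τ) ^ m * (c * lorentzN1 n Ω h) :=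
          ENNReal.tsum_le_tsum fun m => mul_le_mul_right
            ((ENNReal.tsum_comp_le_tsum_of_injective (add_left_injective m) w).trans hwsum) _
      _ = _ := by rw [ENNReal.tsum_mul_right, ENNReal.tsum_geometric]
  · intro i A hA hAm hAs
    have h1 : a i * (S * θ ^ i) ^ (-τ) * (S * θ ^ i) ^ τ = a i := by
      rw [mul_assoc, ← ENNReal.rpow_add _ _ (hs0 _) (hst _), neg_add_cancel, ENNReal.rpow_zero,
        mul_one]
    simp only [h1]
    have h2 := lintegral_rpow_le_tsum_rearr hvm hΩt hvT hp
      (s := fun m => S.toReal * θ.toReal ^ (i + m)) (fun m => by positivity) ?_ hAm ?_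
    · refine le_trans (le_of_eq (setLIntegral_congr_fun hAm fun x hx => ?_)) (h2.trans (le_of_eq ?_))
      · simp only [hv]
        rw [indicator_of_mem (hA hx), abs_of_nonneg (hh0 x)]
      · simp only [hsr, ha, add_assoc]
    · have h3 := (tendsto_pow_atTop_nhds_zero_of_lt_one hθr0.le hθr1).const_mul
        (S.toReal * θ.toReal ^ i)
      rw [mul_zero] at h3
      refine h3.congr fun m => ?_
      rw [pow_add, mul_assoc]
    · simp only [hsr, add_zero]
      exact hAs

end Rearrangement

section OneSided

open Filter
variable {n N : ℕ} {p q L Q : ℝ}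

lemma IsData.lintegral_truncDens_le {Ω : Set (𝔼 n)} {H : 𝔼 n → ℝ} {f : 𝔼 n → 𝔼 n → ℝ}
    {u : 𝔼 n → ℝ} {du : 𝔼 n → 𝔼 n} (D : IsData n Ω p q L Q H f u du) {S : Set (𝔼 n)}
    (hSΩ : S ⊆ Ω) (c : ℝ≥0∞) (k : ℝ) :
    ∫⁻ x in S, truncDens p c u du k x ≤
      (∫⁻ x in S ∩ {x | k < u x}, energy H f du x) + c * ∫⁻ x in S, ENNReal.ofReal (u x - k) ^ p := by
  have hu := D.u_meas
  have hm : Measurable fun y => c * ENNReal.ofReal (u y - k) ^ p := by fun_prop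
  simp only [truncDens]
  rw [lintegral_add_right _ hm]
  refine add_le_add ?_ (le_of_eq (lintegral_const_mul _ (by fun_prop)))
  calc _ ≤ ∫⁻ x in S, {x | k < u x}.indicator (energy H f du) x := by
        refine lintegral_mono_ae ?_
        filter_upwards [ae_restrict_of_ae_restrict_of_subset hSΩ D.enorm_rpow_le_energy] with x hx
        by_cases h : k < u x
        · rw [if_pos h, indicator_of_mem (show x ∈ {x | k < u x} from h)]
          exact hx
        · rw [if_neg h]; exact bot_le
    _ = _ := by
      rw [lintegral_indicator (measurableSet_lt measurable_const hu),
        Measure.restrict_restrict (measurableSet_lt measurable_const hu), inter_comm]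

lemma IsData.exists_level_le {Ω : Set (𝔼 n)} {H : 𝔼 n → ℝ} {f : 𝔼 n → 𝔼 n → ℝ} {u : 𝔼 n → ℝ}
    {du : 𝔼 n → 𝔼 n} (D : IsData n Ω p q L Q H f u du) (hpn : p < n) {K : Set (𝔼 n)}
    (hK : IsCompact K) (hKΩ : K ⊆ Ω) {ε : ℝ≥0∞} (hε : ε ≠ 0) :
    ∃ k, (∫⁻ x in K ∩ {x | k < u x}, energy H f du x) + ∫⁻ x in K, ENNReal.ofReal (u x - k) ^ p ≤ ε := by
  have hp0 : 0 < p := by linarith [D.one_le_p]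
  have hu := D.u_meas
  have hmE : AEMeasurable (energy H f du) (volume.restrict K) :=
    D.aemeasurable_energy.mono_measure (Measure.restrict_mono hKΩ le_rfl)
  have hS : ∀ i : ℕ, MeasurableSet {x | (i : ℝ) < u x} := fun i => measurableSet_lt measurable_const hu
  have hev : ∀ x, ∀ᶠ i : ℕ in atTop, u x ≤ i := fun x => by
    obtain ⟨i, hi⟩ := exists_nat_ge (u x)
    filter_upwards [eventually_ge_atTop i] with j hj
    exact hi.trans (Nat.cast_le.2 hj)
  have h1 : Tendsto (fun i : ℕ => ∫⁻ x in K, {x | (i : ℝ) < u x}.indicator (energy H f du) x) atTop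
      (𝓝 (∫⁻ x in K, (0 : 𝔼 n → ℝ≥0∞) x)) := by
    refine tendsto_lintegral_of_dominated_convergence' (energy H f du) (fun i => hmE.indicator (hS i))
      (fun i => ae_of_all _ fun x => indicator_le_self _ _ x) (D.lintegral_energy_lt_top hK hKΩ).ne
      (ae_of_all _ fun x => tendsto_const_nhds.congr' ?_)
    filter_upwards [hev x] with i hi
    rw [indicator_of_notMem (by simpa using hi)]
    rfl
  have h2 : Tendsto (fun i : ℕ => ∫⁻ x in K, ENNReal.ofReal (u x - i) ^ p) atTop
      (𝓝 (∫⁻ x in K, (0 : 𝔼 n → ℝ≥0∞) x)) := by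
    refine tendsto_lintegral_of_dominated_convergence (fun x => ‖u x‖ₑ ^ p) (fun i => by fun_prop)
      (fun i => ae_of_all _ fun x => ENNReal.rpow_le_rpow ?_ hp0.le)
      (D.lintegral_u_lt_top hpn hK hKΩ).ne (ae_of_all _ fun x => tendsto_const_nhds.congr' ?_)
    · rw [← ofReal_norm]
      refine ENNReal.ofReal_le_ofReal ?_
      rw [Real.norm_eq_abs]
      linarith [le_abs_self (u x), (Nat.cast_nonneg i : (0 : ℝ) ≤ i)]
    · filter_upwards [hev x] with i hi
      rw [ENNReal.ofReal_of_nonpos (by linarith), ENNReal.zero_rpow_of_pos hp0]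
      rfl
  have h3 := h1.add h2
  simp only [Pi.zero_apply, lintegral_zero, add_zero] at h3
  obtain ⟨i, hi⟩ := (ENNReal.tendsto_nhds_zero.1 h3 ε (pos_iff_ne_zero.2 hε)).exists
  refine ⟨i, ?_⟩
  rwa [lintegral_indicator (hS i), Measure.restrict_restrict (hS i), inter_comm] at hi

lemma IsData.exists_ae_le {Ω : Set (𝔼 (N + 1))} {h : 𝔼 (N + 1) → ℝ}
    {f : 𝔼 (N + 1) → 𝔼 (N + 1) → ℝ} {u : 𝔼 (N + 1) → ℝ} {du : 𝔼 (N + 1) → 𝔼 (N + 1)}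
    (hh : Measurable h) (hh0 : ∀ x, 0 ≤ h x)
    (D : IsData (N + 1) Ω p q L Q (fun x => h x ^ p) f u du)
    (hN : 1 ≤ N) (hε : 1 / p ≤ min (1 / q + 1 / (N : ℝ)) 1) (hpn : p < (N + 1 : ℕ))
    (hΩt : volume Ω ≠ ⊤) (hL : lorentzN1 (N + 1) Ω h ≠ ⊤) {x₀ : 𝔼 (N + 1)} {R : ℝ} (hR : 0 < R)
    (hR1 : 2 * R ≤ 1) (hcube : cube x₀ (2 * R) ⊆ Ω) :
    ∃ k, ∀ᵐ x ∂volume.restrict (cube x₀ R), u x ≤ k := by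
  have hp := D.one_le_p
  have hpq := D.p_lt_q
  have hp0 : 0 < p := by linarith
  have hn0 : (0 : ℝ) < (N + 1 : ℕ) := by linarith
  have hu := D.u_meas
  have hτ : 0 < 1 / p - 1 / ((N + 1 : ℕ) : ℝ) := sub_pos.2 (one_div_lt_one_div_of_lt hp0 hpn)
  set τ := 1 / p - 1 / ((N + 1 : ℕ) : ℝ) with hτdef
  have hcubem : ∀ ρ : ℝ, MeasurableSet (cube x₀ ρ) := fun ρ => isClosed_cube.measurableSet
  have hlevel : ∀ k : ℝ, MeasurableSet {x | k < u x} := fun k => measurableSet_lt measurable_const hu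
  have hsub : ∀ {ρ}, ρ ≤ 2 * R → cube x₀ ρ ⊆ Ω := fun h => (cube_mono h).trans hcube
  have hΩ0 : volume Ω ≠ 0 := by
    refine ((pos_iff_ne_zero.2 ?_).trans_le (measure_mono hcube)).ne'
    rw [volume_cube (by linarith)]
    have : 0 < (2 * (2 * R)) ^ (N + 1) := by positivity
    simpa using this
  obtain ⟨C₁, hC₁, h₁⟩ := D.exists_caccioppoli hN hε hpn
  obtain ⟨C₂, h₂⟩ := exists_volume_level_le hp hpn (one_div_pos.2 hτ) (by rw [one_div_one_div])
  obtain ⟨C₃, h₃⟩ := exists_lintegral_level_le hp hpn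
  set C : ℝ≥0∞ := 1 + C₁ + C₂ + C₃ with hC
  have hC1 : 1 ≤ C := by rw [hC, add_assoc, add_assoc]; exact le_self_add
  have hCC₁ : C₁ ≤ C := by rw [hC]; exact le_add_right (le_add_right le_add_self)
  have hCC₂ : (C₂ : ℝ≥0∞) ≤ C := by rw [hC]; exact le_add_right le_add_self
  have hCC₃ : (C₃ : ℝ≥0∞) ≤ C := by rw [hC]; exact le_add_self
  set J : ℝ → ℝ → ℝ≥0∞ := fun k ρ =>
    ∫⁻ x in cube x₀ ρ ∩ {x | k < u x}, energy (fun x => h x ^ p) f du x with hJ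
  set W : ℝ → ℝ → ℝ≥0∞ := fun k ρ => ∫⁻ x in cube x₀ ρ, ENNReal.ofReal (u x - k) ^ p with hW
  set M : ℝ → ℝ → ℝ≥0∞ := fun k ρ => volume (cube x₀ ρ ∩ {x | k < u x}) with hM
  set G : ℝ → ℝ → ℝ≥0∞ := fun k ρ =>
    ∫⁻ x in cube x₀ ρ ∩ {x | k < u x}, ENNReal.ofReal (h x ^ p) with hG
  have hset : ∀ k k' ρ σ : ℝ, k ≤ k' → ρ ≤ σ →
      cube x₀ ρ ∩ {x | k' < u x} ⊆ cube x₀ σ ∩ {x | k < u x} := fun k k' ρ σ hk hρ x hx =>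
    ⟨cube_mono hρ hx.1, hk.trans_lt hx.2⟩
  have hTD : ∀ (c : ℝ≥0∞) (k σ : ℝ), σ ≤ 2 * R →
      ∫⁻ x in cube x₀ σ, truncDens p c u du k x ≤ J k σ + c * W k σ := fun c k σ hσ =>
    D.lintegral_truncDens_le (hsub hσ) c k
  suffices hz : ∃ k, M k R = 0 by
    obtain ⟨k, hk⟩ := hz
    refine ⟨k, ?_⟩
    rw [ae_restrict_iff' (hcubem R), ae_iff]
    refine measure_mono_null (fun x hx => ?_) hk
    simp only [mem_ofPred_eq, Classical.not_imp, not_le] at hx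
    exact hx
  refine exists_level_eq_zero (J := J) (W := W) (M := M) (G := G) (p := p) (q := q)
    (τ := τ) (ν := p / (N + 1 : ℕ)) (γ := 2 * q + q / p - 1) (R := R) (C := C) hp hpq hτ
    (div_pos hp0 hn0) hR (by linarith) ?_ hC1 ?_ ?_ ?_ ?_ ?_ ?_ ?_ ?_
  · simp [hC, hC₁]
  · exact fun k k' ρ σ hk hρ => lintegral_mono_set (hset k k' ρ σ hk hρ)
  · intro k k' ρ σ hk hρ
    refine (lintegral_mono_set (cube_mono hρ)).trans (lintegral_mono fun x => ?_)
    exact ENNReal.rpow_le_rpow (ENNReal.ofReal_le_ofReal (by linarith)) hp0.le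
  · exact fun k k' ρ σ hk hρ => measure_mono (hset k k' ρ σ hk hρ)
  · intro k ρ σ hρ hρσ hσ
    refine (h₁ (hR.trans_le hρ) hρσ (hσ.trans hR1) (hsub hσ) k).trans ?_
    refine mul_le_mul' hCC₁ (add_le_add (mul_le_mul_left (ENNReal.rpow_le_rpow ?_ ?_) _) le_rfl)
    · simpa using hTD 1 k σ hσ
    · have := hp0.trans hpq
      positivity
  · intro k k' ρ σ hρ hρσ hσ _
    refine (h₂ D.isW11 (hR.le.trans hρ) hρσ (hsub hσ) k k').trans ?_
    rw [div_div]
    exact mul_le_mul' hCC₂ (ENNReal.rpow_le_rpow (hTD _ k σ hσ) (by positivity))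
  · intro k k' ρ σ hρ hρσ hσ hkk
    refine (h₃ D.isW11 (hR.le.trans hρ) hρσ (hsub hσ) k k' hkk).trans ?_
    exact mul_le_mul' (mul_le_mul_left hCC₃ _) (hTD _ k σ hσ)
  · intro θ hθ0 hθ1
    obtain ⟨E, hE, h₄⟩ := exists_summable_excess D.isOpen.measurableSet hΩt hΩ0 hh hh0 hp hpn hL
      hθ0 hθ1
    refine ⟨E, hE, fun S₀ hS₀ => ?_⟩
    obtain ⟨S, hS, hSS, e, he, h₅⟩ := h₄ S₀ hS₀
    refine ⟨S, hS, hSS, e, he, fun i k ρ _ hρ hMS => ?_⟩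
    have := h₅ i _ (inter_subset_left.trans (hsub hρ)) ((hcubem ρ).inter (hlevel k)) hMS
    refine le_trans (le_of_eq ?_) this
    simp only [hG]
    congr 1 with x
    rw [ENNReal.ofReal_rpow_of_nonneg (hh0 x) hp0.le]
  · exact fun ε hε' => D.exists_level_le hpn isCompact_cube hcube hε'

end OneSided

section Assembly

open Filter
variable {n N : ℕ} {p q L Q : ℝ} {Ω : Set (𝔼 n)} {f : 𝔼 n → 𝔼 n → ℝ} {u u' : 𝔼 n → ℝ}
  {du du' : 𝔼 n → 𝔼 n}

lemma rearr_congr {v w : 𝔼 n → ℝ} (h : v =ᵐ[volume] w) : rearr n v = rearr n w := by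
  ext t
  have : ∀ σ : ℝ, volume {x | σ < |v x|} = volume {x | σ < |w x|} := fun σ =>
    measure_congr (by filter_upwards [h] with x hx; exact congrArg (fun y : ℝ => σ < |y|) hx)
  simp only [rearr, this]

lemma lorentzN1_congr {v w : 𝔼 n → ℝ} (hΩ : MeasurableSet Ω) (h : v =ᵐ[volume.restrict Ω] w) :
    lorentzN1 n Ω v = lorentzN1 n Ω w := by
  have : rearr n (Ω.indicator v) = rearr n (Ω.indicator w) := by
    refine rearr_congr ?_
    filter_upwards [(ae_restrict_iff' hΩ).1 h] with x hx
    by_cases hxΩ : x ∈ Ω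
    · rw [indicator_of_mem hxΩ, indicator_of_mem hxΩ, hx hxΩ]
    · rw [indicator_of_notMem hxΩ, indicator_of_notMem hxΩ]
  simp only [lorentzN1, this]

lemma IsWeakGradOn.congr (h : IsWeakGradOn n Ω u du) (hu : u =ᵐ[volume.restrict Ω] u')
    (hdu : du =ᵐ[volume.restrict Ω] du') : IsWeakGradOn n Ω u' du' := by
  intro φ h1 h2 h3 i
  have h4 := h φ h1 h2 h3 i
  have e1 : ∫ x in Ω, u' x * fderiv ℝ φ x (EuclideanSpace.single i 1) =
      ∫ x in Ω, u x * fderiv ℝ φ x (EuclideanSpace.single i 1) :=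
    integral_congr_ae (by filter_upwards [hu] with x hx; rw [hx])
  have e2 : ∫ x in Ω, du' x i * φ x = ∫ x in Ω, du x i * φ x :=
    integral_congr_ae (by filter_upwards [hdu] with x hx; rw [hx])
  rw [e1, e2]
  exact h4

lemma locallyIntegrableOn_congr {E : Type*} [NormedAddCommGroup E] {v w : 𝔼 n → E}
    (hΩ : IsOpen Ω) (hv : LocallyIntegrableOn v Ω) (h : v =ᵐ[volume.restrict Ω] w) :
    LocallyIntegrableOn w Ω := by
  rw [locallyIntegrableOn_iff hΩ.isLocallyClosed] at hv ⊢
  exact fun K hKΩ hK => (hv K hKΩ hK).congr_fun_ae (ae_restrict_of_ae_restrict_of_subset hKΩ h)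

lemma IsQMinimizer.congr (hΩ : IsOpen Ω) (h : IsQMinimizer n Ω f Q u du)
    (hu : u =ᵐ[volume.restrict Ω] u') (hdu : du =ᵐ[volume.restrict Ω] du') :
    IsQMinimizer n Ω f Q u' du' := by
  obtain ⟨h1, h2, h3, h4⟩ := h
  refine ⟨h1.congr hu hdu, locallyIntegrableOn_congr hΩ h2 hu, locallyIntegrableOn_congr hΩ h3 hdu,
    fun φ dφ hφ hφi hdφi hc hs => ?_⟩
  obtain ⟨h5, h6⟩ := h4 φ dφ hφ hφi hdφi hc hs
  have h7 : du =ᵐ[volume.restrict (tsupport φ)] du' := ae_restrict_of_ae_restrict_of_subset hs hdu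
  have h8 : (fun x => f x (du x)) =ᵐ[volume.restrict (tsupport φ)] fun x => f x (du' x) := by
    filter_upwards [h7] with x hx
    rw [hx]
  have h9 : (fun x => f x (du x + dφ x)) =ᵐ[volume.restrict (tsupport φ)]
      fun x => f x (du' x + dφ x) := by
    filter_upwards [h7] with x hx
    rw [hx]
  refine ⟨h5.congr_fun_ae h8, fun h => ?_⟩
  rw [← integral_congr_ae h8, ← integral_congr_ae h9]
  exact h6 (h.congr_fun_ae h9.symm)

lemma IsQMinimizer.neg (h : IsQMinimizer n Ω f Q u du) :
    IsQMinimizer n Ω (fun x z => f x (-z)) Q (-u) (-du) := by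
  obtain ⟨h1, h2, h3, h4⟩ := h
  refine ⟨h1.neg, h2.neg, h3.neg, fun φ dφ hφ hφi hdφi hc hs => ?_⟩
  have hts : tsupport (-φ) = tsupport φ := by rw [tsupport, tsupport, Function.support_neg]
  have h5 := h4 (-φ) (-dφ) hφ.neg hφi.neg hdφi.neg (by rwa [hts]) (by rwa [hts])
  rw [hts] at h5
  simpa only [Pi.neg_apply, neg_neg, neg_add] using h5

lemma IsData.neg {H : 𝔼 n → ℝ} (D : IsData n Ω p q L Q H f u du) :
    IsData n Ω p q L Q H (fun x z => f x (-z)) (-u) (-du) where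
  isOpen := D.isOpen
  one_le_p := D.one_le_p
  p_lt_q := D.p_lt_q
  one_le_L := D.one_le_L
  one_le_Q := D.one_le_Q
  H_nonneg := D.H_nonneg
  H_int := D.H_int
  f_meas z := D.f_meas (-z)
  f_cont := by
    filter_upwards [D.f_cont] with x hx
    exact hx.comp continuous_neg
  f_conv := by
    filter_upwards [D.f_conv] with x hx
    exact hx.comp_linearMap (-LinearMap.id)
  growth := by
    filter_upwards [D.growth] with x hx z
    simpa using hx (-z)
  qmin := D.qmin.neg
  u_meas := D.u_meas.neg
  du_meas := D.du_meas.neg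

lemma exists_cube_subset {x : 𝔼 n} (hΩ : IsOpen Ω) (hx : x ∈ Ω) :
    ∃ R, 0 < R ∧ 2 * R ≤ 1 ∧ cube x (2 * R) ⊆ Ω := by
  obtain ⟨r, hr, hrΩ⟩ := nhds_basis_closedBall.mem_iff.1 (hΩ.mem_nhds hx)
  refine ⟨min (1 / 2) (r / (2 * (n + 1))), by positivity, ?_, ?_⟩
  · linarith [min_le_left (1 / 2 : ℝ) (r / (2 * (n + 1)))]
  · refine cube_subset_closedBall.trans ((closedBall_subset_closedBall ?_).trans hrΩ)
    have h1 := min_le_right (1 / 2 : ℝ) (r / (2 * (n + 1)))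
    have h2 : 0 < min (1 / 2 : ℝ) (r / (2 * (n + 1))) := by positivity
    rw [le_div_iff₀ (by positivity)] at h1
    nlinarith

lemma IsData.exists_ae_abs_le {Ω : Set (𝔼 (N + 1))} {h : 𝔼 (N + 1) → ℝ}
    {f : 𝔼 (N + 1) → 𝔼 (N + 1) → ℝ} {u : 𝔼 (N + 1) → ℝ} {du : 𝔼 (N + 1) → 𝔼 (N + 1)}
    (hh : Measurable h) (hh0 : ∀ x, 0 ≤ h x)
    (D : IsData (N + 1) Ω p q L Q (fun x => h x ^ p) f u du)
    (hN : 1 ≤ N) (hε : 1 / p ≤ min (1 / q + 1 / (N : ℝ)) 1) (hpn : p < (N + 1 : ℕ))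
    (hΩt : volume Ω ≠ ⊤) (hL : lorentzN1 (N + 1) Ω h ≠ ⊤) {K : Set (𝔼 (N + 1))} (hKΩ : K ⊆ Ω)
    (hK : IsCompact K) : ∃ C : ℝ, ∀ᵐ x ∂volume.restrict K, |u x| ≤ C := by
  refine hK.induction_on (p := fun K => ∃ C : ℝ, ∀ᵐ x ∂volume.restrict K, |u x| ≤ C)
    ⟨0, by simp⟩ ?_ ?_ ?_
  · exact fun s t hst ⟨C, hC⟩ => ⟨C, ae_restrict_of_ae_restrict_of_subset hst hC⟩
  · rintro s t ⟨C, hC⟩ ⟨C', hC'⟩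
    refine ⟨max C C', (ae_restrict_union_iff _ _ _).2 ⟨?_, ?_⟩⟩
    · filter_upwards [hC] with x hx using hx.trans (le_max_left _ _)
    · filter_upwards [hC'] with x hx using hx.trans (le_max_right _ _)
  · intro x hx
    obtain ⟨R, hR, hR1, hcube⟩ := exists_cube_subset D.isOpen (hKΩ hx)
    refine ⟨cube x R, mem_nhdsWithin_of_mem_nhds
      (mem_of_superset (closedBall_mem_nhds x hR) closedBall_subset_cube), ?_⟩
    obtain ⟨k, hk⟩ := D.exists_ae_le hh hh0 hN hε hpn hΩt hL hR hR1 hcube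
    obtain ⟨k', hk'⟩ := D.neg.exists_ae_le hh hh0 hN hε hpn hΩt hL hR hR1 hcube
    refine ⟨max k k', ?_⟩
    filter_upwards [hk, hk'] with y hy hy'
    exact abs_le'.2 ⟨hy.trans (le_max_left _ _), hy'.trans (le_max_right _ _)⟩

end Assembly

theorem local_boundedness_with_rhs_p_lt_n
    (n : ℕ) (hn : 2 ≤ n)
    (Ω : Set (EuclideanSpace ℝ (Fin n)))
    (hΩopen : IsOpen Ω) (hΩconn : IsConnected Ω) (hΩbdd : Bornology.IsBounded Ω)
    (p q : ℝ) (hp : 1 ≤ p) (hpq : p < q)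
    (hε : 0 ≤ min (1 / q + 1 / ((n : ℝ) - 1)) 1 - 1 / p)
    (hpn : p < (n : ℝ))
    (g : EuclideanSpace ℝ (Fin n) → ℝ)
    (hg_nonneg : ∀ᵐ x ∂volume.restrict Ω, 0 ≤ g x)
    (hg_meas : AEMeasurable g (volume.restrict Ω))
    (hg_int : IntegrableOn (fun x => g x ^ (p / (p - 1))) Ω)
    (hg_lorentz : lorentzN1 n Ω (fun x => g x ^ (1 / (p - 1))) < ⊤)
    (f : EuclideanSpace ℝ (Fin n) → EuclideanSpace ℝ (Fin n) → ℝ)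
    (hf_meas : ∀ z : EuclideanSpace ℝ (Fin n),
      AEMeasurable (fun x => f x z) (volume.restrict Ω))
    (hf_cont : ∀ᵐ x ∂volume.restrict Ω, Continuous fun z => f x z)
    (hf_conv : ∀ᵐ x ∂volume.restrict Ω, ConvexOn ℝ univ fun z => f x z)
    (L μ : ℝ) (hL : 1 ≤ L) (hμ : 0 ≤ μ)
    (hgrowth : ∀ᵐ x ∂volume.restrict Ω, ∀ z : EuclideanSpace ℝ (Fin n),
      ‖z‖ ^ p - g x ^ (p / (p - 1)) ≤ f x z ∧ f x z ≤ L * ‖z‖ ^ q + g x ^ (p / (p - 1)))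
    (hdouble : ∀ᵐ x ∂volume.restrict Ω, ∀ z : EuclideanSpace ℝ (Fin n),
      f x (2 • z) ≤ μ + L * f x z)
    (u : EuclideanSpace ℝ (Fin n) → ℝ)
    (du : EuclideanSpace ℝ (Fin n) → EuclideanSpace ℝ (Fin n))
    (hquasi : ∃ Q : ℝ, 1 ≤ Q ∧ IsQMinimizer n Ω f Q u du) :
    ∀ K : Set (EuclideanSpace ℝ (Fin n)), K ⊆ Ω → IsCompact K →
      ∃ C : ℝ, ∀ᵐ x ∂volume.restrict K, |u x| ≤ C := by
  obtain ⟨Q, hQ, hquasi⟩ := hquasi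
  obtain ⟨N, rfl⟩ : ∃ N, n = N + 1 := ⟨n - 1, by omega⟩
  intro K hKΩ hK
  have hum := hquasi.2.1.aestronglyMeasurable
  have hdum := hquasi.2.2.1.aestronglyMeasurable
  set h : EuclideanSpace ℝ (Fin (N + 1)) → ℝ := fun x => max (hg_meas.mk g x) 0 ^ (1 / (p - 1))
    with hh
  have hgm : ∀ᵐ x ∂volume.restrict Ω, max (hg_meas.mk g x) 0 = g x := by
    filter_upwards [hg_meas.ae_eq_mk, hg_nonneg] with x hx hx0
    rw [← hx, max_eq_left hx0]
  have hhm : Measurable h := (hg_meas.measurable_mk.max measurable_const).pow_const _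
  have hh0 : ∀ x, 0 ≤ h x := fun x => Real.rpow_nonneg (le_max_right _ _) _
  have hhg : ∀ᵐ x ∂volume.restrict Ω, h x ^ p = g x ^ (p / (p - 1)) := by
    filter_upwards [hgm] with x hx
    rw [hh, ← Real.rpow_mul (le_max_right _ _), one_div_mul_eq_div, hx]
  have hhL : lorentzN1 (N + 1) Ω h ≠ ⊤ := by
    rw [lorentzN1_congr hΩopen.measurableSet (w := fun x => g x ^ (1 / (p - 1)))]
    · exact hg_lorentz.ne
    · filter_upwards [hgm] with x hx
      simp only [hh]
      rw [hx]
  have D : IsData (N + 1) Ω p q L Q (fun x => h x ^ p) f (hum.mk u) (hdum.mk du) :=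
    { isOpen := hΩopen
      one_le_p := hp
      p_lt_q := hpq
      one_le_L := hL
      one_le_Q := hQ
      H_nonneg := fun x => Real.rpow_nonneg (hh0 x) _
      H_int := hg_int.congr_fun_ae (hhg.mono fun x hx => hx.symm)
      f_meas := hf_meas
      f_cont := hf_cont
      f_conv := hf_conv
      growth := by
        filter_upwards [hgrowth, hhg] with x hx hxg
        rwa [hxg]
      qmin := hquasi.congr hΩopen hum.ae_eq_mk hdum.ae_eq_mk
      u_meas := hum.stronglyMeasurable_mk.measurable
      du_meas := hdum.stronglyMeasurable_mk.measurable }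
  have hε' : 1 / p ≤ min (1 / q + 1 / (N : ℝ)) 1 := by
    push_cast at hε
    rw [add_sub_cancel_right] at hε
    linarith
  obtain ⟨C, hC⟩ := D.exists_ae_abs_le hhm hh0 (by omega) hε' hpn hΩbdd.measure_lt_top.ne hhL hKΩ hK
  refine ⟨C, ?_⟩
  filter_upwards [hC, ae_restrict_of_ae_restrict_of_subset hKΩ hum.ae_eq_mk] with x hx hxu
  rwa [hxu]
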